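/- For every ε > 0 there exist constants c > 0 and C > 0 such that for all sufficiently large x, |Σ_{n ≤ x} Ω(n) − (x·log log x + B₂·x − li_f(x))| ≤ C·x·e^{-c(log x)^{3/5-ε}}, where B₂ = B₁ + Σ_p 1/(p(p−1)). -/

import Mathlib

open Filter Real MeasureTheory
open scoped Classical

/-- `lif x = ∫₂^x {x/t}/log t dt`. -/
noncomputable def lif (x : ℝ) : ℝ := ∫ t in (2:ℝ)..x, Int.fract (x / t) / Real.log t
/-- The Mertens constant `B₁ = γ - Σ_p Σ_{k ≥ 2} 1/(k p^k)`. -/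
noncomputable def mertensB1 : ℝ :=
  Real.eulerMascheroniConstant -
    ∑' p : Nat.Primes, ∑' k : ℕ, 1 / (((k + 2) : ℝ) * ((p : ℕ) : ℝ) ^ (k + 2))

/-- `B₂ = B₁ + Σ_p 1/(p(p-1))`. -/
noncomputable def mertensB2 : ℝ :=
  mertensB1 + ∑' p : Nat.Primes, 1 / (((p : ℕ) : ℝ) * (((p : ℕ) : ℝ) - 1))

set_option linter.all false

namespace VK
open MeasureTheory UnitAddTorus Finset

noncomputable section

attribute [local instance] instMeasureSpaceUnitAddCircle

local instance : Measure.IsAddHaarMeasure (volume : Measure UnitAddCircle) :=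
  inferInstanceAs (Measure.IsAddHaarMeasure AddCircle.haarAddCircle)

local instance : IsProbabilityMeasure (volume : Measure UnitAddCircle) :=
  inferInstanceAs (IsProbabilityMeasure AddCircle.haarAddCircle)

/-- power vector -/
def pw (k:ℕ) (x:ℤ) : Fin k → ℤ := fun j => x ^ (j.1 + 1)

def vec (k:ℕ) {ι : Type*} [Fintype ι] (x : ι → ℤ) : Fin k → ℤ := ∑ i, pw k (x i)

def ef (k:ℕ) (B : Finset ℤ) (α : UnitAddTorus (Fin k)) : ℂ := ∑ x ∈ B, mFourier (pw k x) α

def J (k n:ℕ) (B : Finset ℤ) : ℝ := ∫ α, ‖ef k B α‖ ^ (2 * n)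

lemma integral_mF {k : ℕ} (v : Fin k → ℤ) :
    ∫ α, mFourier v α = if v = 0 then (1:ℂ) else 0 := by
  have h := (orthonormal_iff_ite.mp (orthonormal_mFourier (d := Fin k))) 0 v
  rw [ContinuousMap.inner_toLp] at h
  simp only [mFourier_zero, ContinuousMap.one_apply, map_one, mul_one] at h
  refine h.trans ?_; simp [eq_comm]

lemma int_sq {k : ℕ} {ι : Type*} (P : Finset ι) (v : ι → Fin k → ℤ) :
    ∫ α, ‖∑ i ∈ P, mFourier (v i) α‖ ^ 2 =
      (((P ×ˢ P).filter (fun q => v q.1 = v q.2)).card:ℝ) := by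
  have key : ∀ α, ((‖∑ i ∈ P, mFourier (v i) α‖ ^ 2:ℝ):ℂ) =
      ∑ q ∈ P ×ˢ P, mFourier (v q.1 - v q.2) α := by
    intro α
    rw [← Complex.normSq_eq_norm_sq, ← Complex.mul_conj, map_sum, sum_mul_sum,
      ← sum_product']
    refine sum_congr rfl fun q _ => ?_
    rw [sub_eq_add_neg, mFourier_add, mFourier_neg]
  have : ((∫ α, ‖∑ i ∈ P, mFourier (v i) α‖ ^ 2:ℝ):ℂ) =
      (((P ×ˢ P).filter (fun q => v q.1 = v q.2)).card:ℂ) := by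
    rw [← integral_complex_ofReal]
    simp_rw [key]
    rw [integral_finsetSum]
    · simp_rw [integral_mF, sub_eq_zero]
      rw [card_filter]; push_cast; rfl
    · intro q _
      exact (ContinuousMap.continuous _).integrable_of_hasCompactSupport
        (HasCompactSupport.of_compactSpace _)
  exact_mod_cast this

lemma mF_sum {k : ℕ} {ι : Type*} (s : Finset ι) (v : ι → Fin k → ℤ) (α : UnitAddTorus (Fin k)) :
    mFourier (∑ i ∈ s, v i) α = ∏ i ∈ s, mFourier (v i) α := by
  classical
  induction s using Finset.induction_on with
  | empty => simp [mFourier_zero]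
  | insert a s ha ih => rw [sum_insert ha, prod_insert ha, mFourier_add, ih]

lemma ef_pow (k:ℕ) {ι : Type*} [Fintype ι] [DecidableEq ι] (B : Finset ℤ)
    (α : UnitAddTorus (Fin k)) :
    (ef k B α) ^ (Fintype.card ι) =
      ∑ x ∈ Fintype.piFinset (fun _ : ι => B), mFourier (vec k x) α := by
  have := prod_univ_sum (fun _ : ι => B) (fun _ x => mFourier (pw k x) α)
  simp only [prod_const, card_univ] at this
  rw [ef, this]
  refine sum_congr rfl fun x _ => ?_
  rw [vec, mF_sum]

lemma continuous_ef (k:ℕ) (B : Finset ℤ) : Continuous (ef k B) := by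
  unfold ef; fun_prop

lemma J_eq (k:ℕ) {ι : Type*} [Fintype ι] [DecidableEq ι] (B : Finset ℤ) :
    J k (Fintype.card ι) B =
      ((((Fintype.piFinset (fun _ : ι => B)) ×ˢ (Fintype.piFinset (fun _ : ι => B))).filter
        (fun q => vec k q.1 = vec k q.2)).card:ℝ) := by
  rw [← int_sq, J]
  congr 1; ext α
  rw [← ef_pow, norm_pow, ← pow_mul, mul_comm]

lemma J_nonneg (k n:ℕ) (B : Finset ℤ) : 0 ≤ J k n B := by
  unfold J; positivity

/-- mixed count -/
lemma mixed_eq (k:ℕ) {ι κ : Type*} [Fintype ι] [DecidableEq ι] (B : Finset ℤ)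
    (P : Finset κ) (v : κ → Fin k → ℤ) :
    ∫ α, ‖∑ i ∈ P, mFourier (v i) α‖ ^ 2 * ‖ef k B α‖ ^ (2 * Fintype.card ι) =
      ((((P ×ˢ (Fintype.piFinset (fun _ : ι => B))) ×ˢ
        (P ×ˢ (Fintype.piFinset (fun _ : ι => B)))).filter
        (fun q => v q.1.1 + vec k q.1.2 = v q.2.1 + vec k q.2.2)).card:ℝ) := by
  rw [← int_sq (P ×ˢ (Fintype.piFinset (fun _ : ι => B))) (fun q => v q.1 + vec k q.2)]
  congr 1; ext α
  rw [mul_comm 2, pow_mul, ← norm_pow (ef k B α), ef_pow, ← mul_pow, ← norm_mul, sum_mul_sum,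
    ← sum_product']
  simp only [mFourier_add]

/-- shift count is at most zero shift count -/
lemma shift_le (k:ℕ) {ι : Type*} [Fintype ι] [DecidableEq ι] (B : Finset ℤ) (h : Fin k → ℤ) :
    ((((Fintype.piFinset (fun _ : ι => B)) ×ˢ (Fintype.piFinset (fun _ : ι => B))).filter
        (fun q => h + vec k q.1 = vec k q.2)).card:ℝ) ≤ J k (Fintype.card ι) B := by
  set Q := Fintype.piFinset (fun _ : ι => B)
  have key : ∀ α, mFourier h α * ((‖ef k B α‖ ^ (2 * Fintype.card ι):ℝ):ℂ) =
      ∑ q ∈ Q ×ˢ Q, mFourier (h + vec k q.1 - vec k q.2) α := by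
    intro α
    rw [mul_comm 2, pow_mul, ← norm_pow, ef_pow, ← Complex.normSq_eq_norm_sq, ← Complex.mul_conj,
      map_sum, sum_mul_sum, ← sum_product', mul_sum]
    refine sum_congr rfl fun q _ => ?_
    rw [sub_eq_add_neg, mFourier_add, mFourier_add, mFourier_neg, mul_assoc]
  have e : (((Q ×ˢ Q).filter (fun q => h + vec k q.1 = vec k q.2)).card:ℂ) =
      ∫ α, mFourier h α * ((‖ef k B α‖ ^ (2 * Fintype.card ι):ℝ):ℂ) := by
    simp_rw [key]
    rw [integral_finsetSum]
    · simp_rw [integral_mF, sub_eq_zero]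
      rw [card_filter]; push_cast; rfl
    · intro q _
      exact (ContinuousMap.continuous _).integrable_of_hasCompactSupport
        (HasCompactSupport.of_compactSpace _)
  have e2 := congrArg norm e
  rw [Complex.norm_natCast] at e2
  rw [e2]
  refine (norm_integral_le_integral_norm _).trans (le_of_eq ?_)
  rw [J]
  congr 1; ext α
  rw [norm_mul, Complex.norm_real, Real.norm_of_nonneg (by positivity)]
  have : ‖mFourier h α‖ = 1 := by
    simp only [mFourier, ContinuousMap.coe_mk, norm_prod, fourier_apply, Circle.norm_coe, prod_const_one]
  rw [this, one_mul]

end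
end VK

namespace VK
open MeasureTheory UnitAddTorus Finset

noncomputable section
attribute [local instance] instMeasureSpaceUnitAddCircle

local instance : Measure.IsAddHaarMeasure (volume : Measure UnitAddCircle) :=
  inferInstanceAs (Measure.IsAddHaarMeasure AddCircle.haarAddCircle)

local instance : IsProbabilityMeasure (volume : Measure UnitAddCircle) :=
  inferInstanceAs (IsProbabilityMeasure AddCircle.haarAddCircle)

lemma norm_sum_pow_le {κ : Type*} (A : Finset κ) (w : κ → ℂ) {n : ℕ} (hn : 1 ≤ n) :
    ‖∑ a ∈ A, w a‖ ^ n ≤ (A.card:ℝ) ^ (n - 1) * ∑ a ∈ A, ‖w a‖ ^ n := by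
  obtain ⟨m, rfl⟩ : ∃ m, n = m + 1 := ⟨n - 1, by omega⟩
  rcases A.eq_empty_or_nonempty with rfl | hA
  · simp
  have h1 := pow_sum_div_card_le_sum_pow (s := A) (f := fun a => ‖w a‖) (fun _ _ => norm_nonneg _) m
  rw [div_le_iff₀ (by have := hA.card_pos; positivity)] at h1
  calc ‖∑ a ∈ A, w a‖ ^ (m + 1) ≤ (∑ a ∈ A, ‖w a‖) ^ (m + 1) := by
        gcongr; exact norm_sum_le _ _
    _ ≤ _ := by rw [Nat.add_sub_cancel, mul_comm]; exact h1

lemma mixed_holder {k n : ℕ} (hn : 1 ≤ n) (G : UnitAddTorus (Fin k) → ℝ) (hG : Continuous G)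
    (hG0 : ∀ α, 0 ≤ G α) (B : Finset ℤ) {κ : Type*} [DecidableEq κ] (A : Finset κ) (g : ℤ → κ)
    (hg : ∀ x ∈ B, g x ∈ A) (Mx:ℝ)
    (hM : ∀ a ∈ A, ∫ α, G α * ‖ef k (B.filter (fun x => g x = a)) α‖ ^ (2 * n) ≤ Mx) :
    ∫ α, G α * ‖ef k B α‖ ^ (2 * n) ≤ (A.card:ℝ) ^ (2 * n) * Mx := by
  have hi : ∀ f : UnitAddTorus (Fin k) → ℝ, Continuous f → Integrable f := fun f hf =>
    hf.integrable_of_hasCompactSupport (HasCompactSupport.of_compactSpace _)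
  have hc := fun B => continuous_ef k B
  have h1 : ∀ α, G α * ‖ef k B α‖ ^ (2 * n) ≤ (A.card:ℝ) ^ (2 * n - 1) *
      ∑ a ∈ A, G α * ‖ef k (B.filter (fun x => g x = a)) α‖ ^ (2 * n) := by
    intro α
    have : ef k B α = ∑ a ∈ A, ef k (B.filter (fun x => g x = a)) α := by
      unfold ef
      exact (sum_fiberwise_of_maps_to hg _).symm
    rw [← mul_sum, mul_left_comm, this]
    exact mul_le_mul_of_nonneg_left (norm_sum_pow_le A _ (by omega)) (hG0 α)
  calc _ ≤ ∫ α, (A.card:ℝ) ^ (2 * n - 1) *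
      ∑ a ∈ A, G α * ‖ef k (B.filter (fun x => g x = a)) α‖ ^ (2 * n) := by
        refine integral_mono (hi _ ?_) (hi _ ?_) h1
        · have := hc B; fun_prop
        · have := fun a => hc (B.filter (fun x => g x = a)); fun_prop
    _ = (A.card:ℝ) ^ (2 * n - 1) *
      ∑ a ∈ A, ∫ α, G α * ‖ef k (B.filter (fun x => g x = a)) α‖ ^ (2 * n) := by
        rw [integral_const_mul, integral_finsetSum]
        intro a _
        refine hi _ ?_
        have := hc (B.filter (fun x => g x = a)); fun_prop
    _ ≤ (A.card:ℝ) ^ (2 * n - 1) * ∑ a ∈ A, Mx := by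
        gcongr with a ha; exact hM a ha
    _ = _ := by
        rw [sum_const, nsmul_eq_mul, ← mul_assoc, ← pow_succ]
        congr 2; omega

lemma J_holder {k n : ℕ} (hn : 1 ≤ n) (B : Finset ℤ) {κ : Type*} [DecidableEq κ] (A : Finset κ)
    (g : ℤ → κ) (hg : ∀ x ∈ B, g x ∈ A) (Mx:ℝ)
    (hM : ∀ a ∈ A, J k n (B.filter (fun x => g x = a)) ≤ Mx) :
    J k n B ≤ (A.card:ℝ) ^ (2 * n) * Mx := by
  have := mixed_holder hn (fun _ : UnitAddTorus (Fin k) => (1:ℝ)) continuous_const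
    (fun _ => zero_le_one) B A g hg Mx (by simpa [J] using hM)
  simpa [J] using this

lemma vec_apply (k:ℕ) {ι : Type*} [Fintype ι] (x : ι → ℤ) (j : Fin k) :
    vec k x j = ∑ i, x i ^ (j.1 + 1) := by
  simp [vec, pw, Finset.sum_apply]

lemma sum_shift {ι : Type*} [Fintype ι] (x y : ι → ℤ) (k:ℕ)
    (h : vec k x = vec k y) (a:ℤ) :
    vec k (fun i => x i - a) = vec k (fun i => y i - a) := by
  ext j
  have h' : ∀ l ≤ k, ∑ i, x i ^ l = ∑ i, y i ^ l := by
    intro l hl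
    rcases l with _ | l
    · simp
    · have := congrFun h ⟨l, hl⟩
      simpa [vec_apply] using this
  simp only [vec_apply, sub_eq_add_neg, add_pow]
  rw [sum_comm]
  conv_rhs => rw [sum_comm]
  refine sum_congr rfl fun l hl => ?_
  rw [← sum_mul, ← sum_mul, ← sum_mul, ← sum_mul, h' l]
  have := mem_range.mp hl
  have := j.2
  omega

lemma J_affine (k n:ℕ) (B B' : Finset ℤ) (a p:ℤ) (hp : p ≠ 0)
    (h : ∀ x ∈ B', ∃ u ∈ B, x = a + p * u) : J k n B' ≤ J k n B := by
  have e : Fintype.card (Fin n) = n := Fintype.card_fin n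
  have h1 := J_eq k (ι := Fin n) B
  have h2 := J_eq k (ι := Fin n) B'
  rw [e] at h1 h2
  rw [h1, h2]
  norm_cast
  refine card_le_card_of_injOn
    (fun q => ((fun i => (q.1 i - a) / p), (fun i => (q.2 i - a) / p))) ?_ ?_
  · intro q hq
    simp only [coe_filter, mem_product, Fintype.mem_piFinset, Set.mem_ofPred_eq] at hq ⊢
    obtain ⟨⟨hx, hy⟩, hv⟩ := hq
    refine ⟨⟨fun i => ?_, fun i => ?_⟩, ?_⟩
    · obtain ⟨u, hu, hxu⟩ := h _ (hx i)
      rw [hxu]; simpa [hp] using hu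
    · obtain ⟨u, hu, hxu⟩ := h _ (hy i)
      rw [hxu]; simpa [hp] using hu
    · have h3 := sum_shift _ _ k hv a
      ext j
      have h4 := congrFun h3 j
      rw [vec_apply, vec_apply] at h4 ⊢
      have hpj : p ^ (j.1 + 1) ≠ 0 := pow_ne_zero _ hp
      apply mul_left_cancel₀ hpj
      rw [mul_sum, mul_sum]
      simp only [← mul_pow]
      convert h4 using 2 with i _ i _
      · obtain ⟨u, hu, hxu⟩ := h _ (hx i)
        rw [hxu]; simp [hp]
      · obtain ⟨u, hu, hxu⟩ := h _ (hy i)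
        rw [hxu]; simp [hp]
  · intro q hq q' hq' hqq
    simp only [coe_filter, mem_product, Fintype.mem_piFinset, Set.mem_ofPred_eq] at hq hq'
    simp only [Prod.mk.injEq, funext_iff] at hqq
    ext i
    · obtain ⟨u, hu, hxu⟩ := h _ (hq.1.1 i)
      obtain ⟨u', hu', hxu'⟩ := h _ (hq'.1.1 i)
      have := hqq.1 i
      rw [hxu, hxu'] at this ⊢
      simp [hp] at this; rw [this]
    · obtain ⟨u, hu, hxu⟩ := h _ (hq.1.2 i)
      obtain ⟨u', hu', hxu'⟩ := h _ (hq'.1.2 i)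
      have := hqq.2 i
      rw [hxu, hxu'] at this ⊢
      simp [hp] at this; rw [this]

lemma norm_ef_le (k:ℕ) (B : Finset ℤ) (α : UnitAddTorus (Fin k)) : ‖ef k B α‖ ≤ B.card := by
  unfold ef
  refine (norm_sum_le _ _).trans ?_
  have : ∀ x, ‖mFourier (pw k x) α‖ = 1 := fun x => by
    simp only [mFourier, ContinuousMap.coe_mk, norm_prod, fourier_apply, Circle.norm_coe,
      prod_const_one]
  simp [this]

lemma J_add_le (k n m:ℕ) (B : Finset ℤ) : J k (n + m) B ≤ (B.card:ℝ) ^ (2 * m) * J k n B := by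
  have hi : ∀ f : UnitAddTorus (Fin k) → ℝ, Continuous f → Integrable f := fun f hf =>
    hf.integrable_of_hasCompactSupport (HasCompactSupport.of_compactSpace _)
  have hc := continuous_ef k B
  unfold J
  rw [← integral_const_mul]
  refine integral_mono (hi _ (by fun_prop)) (hi _ (by fun_prop)) fun α => ?_
  simp only
  rw [mul_add, pow_add, mul_comm]
  gcongr
  exact norm_ef_le k B α

lemma J_zero (k:ℕ) (B : Finset ℤ) : J k 0 B = 1 := by simp [J]

lemma J_le_triv (k n:ℕ) (B : Finset ℤ) : J k n B ≤ (B.card:ℝ) ^ (2 * n) := by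
  have := J_add_le k 0 n B
  simpa [J_zero] using this

end
end VK

namespace VK
open Finset

lemma newton_prod {R : Type*} [CommRing R] {k : ℕ} (x y : Fin k → R)
    (hu : ∀ m, 1 ≤ m → m ≤ k → IsUnit (m : R))
    (h : ∀ m, 1 ≤ m → m ≤ k → ∑ i, x i ^ m = ∑ i, y i ^ m) (t : R) :
    ∏ i, (t - x i) = ∏ i, (t - y i) := by
  have hN : ∀ (z : Fin k → R) (m:ℕ), (m : R) * MvPolynomial.aeval z (MvPolynomial.esymm (Fin k) R m)
      = (-1) ^ (m + 1) * ∑ a ∈ antidiagonal m with a.1 < m,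
        (-1) ^ a.1 * MvPolynomial.aeval z (MvPolynomial.esymm (Fin k) R a.1) * ∑ i, z i ^ a.2 := by
    intro z m
    have := congrArg (MvPolynomial.aeval z) (MvPolynomial.mul_esymm_eq_sum (Fin k) R m)
    simpa [MvPolynomial.psum] using this
  have he : ∀ m, m ≤ k → MvPolynomial.aeval x (MvPolynomial.esymm (Fin k) R m) =
      MvPolynomial.aeval y (MvPolynomial.esymm (Fin k) R m) := by
    intro m
    induction m using Nat.strong_induction_on with
    | _ m ih =>
      intro hm
      rcases Nat.eq_zero_or_pos m with rfl | hpos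
      · simp
      · apply (hu m hpos hm).mul_left_cancel
        rw [hN, hN]
        congr 1
        refine sum_congr rfl fun a ha => ?_
        rw [mem_filter] at ha
        have h3 := mem_antidiagonal.mp ha.1
        rw [ih a.1 ha.2 (by omega), h a.2 (by omega) (by omega)]
  have hP : ∀ z : Fin k → R, ∏ i, (t - z i) = ∑ j ∈ range (k + 1), (-1) ^ j *
      (MvPolynomial.aeval z (MvPolynomial.esymm (Fin k) R j) * t ^ (k - j)) := by
    intro z
    have := congrArg (Polynomial.eval t) (Multiset.prod_X_sub_X_eq_sum_esymm (univ.val.map z))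
    simp only [MvPolynomial.aeval_esymm_eq_multiset_esymm]
    rw [Polynomial.eval_multiset_prod, Multiset.map_map, Multiset.map_map] at this
    have e : ∏ i, (t - z i) = (Multiset.map ((Polynomial.eval t ∘ fun t => Polynomial.X - Polynomial.C t) ∘ z)
        univ.val).prod := by
      rw [prod_eq_multiset_prod]; congr 1
      refine Multiset.map_congr rfl fun i _ => ?_
      simp
    rw [e]
    refine this.trans ?_
    rw [Polynomial.eval_finsetSum]
    have hc : (Multiset.map z univ.val).card = k := by
      rw [Multiset.card_map, card_val, card_univ, Fintype.card_fin]
    rw [hc]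
    refine sum_congr rfl fun j _ => ?_
    simp only [Polynomial.eval_mul, Polynomial.eval_pow, Polynomial.eval_neg, Polynomial.eval_one,
      Polynomial.eval_C, Polynomial.eval_X]
  rw [hP, hP]
  refine sum_congr rfl fun j hj => ?_
  rw [he j (by simpa [Nat.lt_succ_iff] using hj)]

lemma fibre_aux {p k : ℕ} (hp : p.Prime) (hk : 1 ≤ k) (hkp : k < p) (x y : Fin k → ℤ)
    (hx : ∀ i l, i ≠ l → ¬ (p:ℤ) ∣ x i - x l)
    (h : ∀ j : Fin k, ((∑ i, x i ^ (j.1 + 1):ℤ) : ZMod (p ^ k)) = ((∑ i, y i ^ (j.1 + 1):ℤ) : ZMod (p ^ k)))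
    (m : Fin k) : ∃ i, ((y m:ℤ) : ZMod (p ^ k)) = ((x i:ℤ) : ZMod (p ^ k)) := by
  have hunit : ∀ z : ℤ, ¬ (p:ℤ) ∣ z → IsUnit (z : ZMod (p ^ k)) := by
    intro z hz
    rw [ZMod.coe_int_isUnit_iff_isCoprime]
    push_cast
    apply IsCoprime.pow_left
    exact (Prime.coprime_iff_not_dvd (Nat.prime_iff_prime_int.mp hp)).mpr hz
  have hprod := newton_prod (fun i => ((x i:ℤ) : ZMod (p ^ k))) (fun i => ((y i:ℤ) : ZMod (p ^ k)))
    (fun m h1 h2 => by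
      have := hunit m (fun hd => by
        have := Int.le_of_dvd (by omega) hd
        omega)
      simpa using this)
    (fun m h1 h2 => by
      have := h ⟨m - 1, by omega⟩
      simp only [Nat.sub_add_cancel h1] at this
      push_cast at this; exact this) ((y m:ℤ) : ZMod (p ^ k))
  have h0 : ∏ i, (((y m:ℤ) : ZMod (p ^ k)) - ((y i:ℤ) : ZMod (p ^ k))) = 0 :=
    prod_eq_zero (mem_univ m) (sub_self _)
  rw [h0] at hprod
  by_contra hne
  push Not at hne
  by_cases hex : ∃ i, (p:ℤ) ∣ y m - x i
  · obtain ⟨i, hi⟩ := hex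
    rw [← mul_prod_erase _ _ (mem_univ i)] at hprod
    have hu : IsUnit (∏ l ∈ univ.erase i, (((y m:ℤ) : ZMod (p ^ k)) - ((x l:ℤ) : ZMod (p ^ k)))) := by
      rw [IsUnit.prod_iff]
      intro l hl
      have := hunit (y m - x l) (fun hd => hx l i (ne_of_mem_erase hl) (by
        have := dvd_sub hi hd; simpa using this))
      simpa using this
    rw [hu.mul_left_eq_zero] at hprod
    exact hne i (sub_eq_zero.mp hprod)
  · push Not at hex
    have hu : IsUnit (∏ l, (((y m:ℤ) : ZMod (p ^ k)) - ((x l:ℤ) : ZMod (p ^ k)))) := by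
      rw [IsUnit.prod_iff]
      intro l hl
      have := hunit (y m - x l) (hex l)
      simpa using this
    rw [hprod] at hu
    have : Fact (1 < p ^ k) := ⟨Nat.one_lt_pow (by omega) hp.one_lt⟩
    exact not_isUnit_zero hu

lemma linnik {p k : ℕ} (hp : p.Prime) (hk : 1 ≤ k) (hkp : k < p) (c : Fin k → ℤ)
    (Q : Finset (Fin k → ℤ))
    (hQ : ∀ x ∈ Q, ∀ i l, i ≠ l → ¬ (p:ℤ) ∣ x i - x l)
    (hinj : ∀ x ∈ Q, ∀ y ∈ Q, ∀ i l,
      ((x i:ℤ) : ZMod (p ^ k)) = ((y l:ℤ) : ZMod (p ^ k)) → x i = y l)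
    (hc : ∀ x ∈ Q, ∀ j : Fin k, (p:ℤ) ^ (j.1 + 1) ∣ ∑ i, x i ^ (j.1 + 1) - c j) :
    Q.card ≤ k ^ k * p ^ (k * (k - 1) / 2) := by
  classical
  let Φ : (Fin k → ℤ) → (Fin k → ZMod (p ^ k)) :=
    fun x j => ((∑ i, x i ^ (j.1 + 1):ℤ) : ZMod (p ^ k))
  let S : Fin k → Finset (ZMod (p ^ k)) := fun j =>
    (range (p ^ (k - 1 - j.1))).image (fun m : ℕ => ((c j + (p:ℤ) ^ (j.1 + 1) * (m:ℤ):ℤ) : ZMod (p ^ k)))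
  have h1 : (Q.image Φ).card ≤ p ^ (k * (k - 1) / 2) := by
    calc (Q.image Φ).card ≤ (Fintype.piFinset S).card := by
          apply card_le_card
          intro z hz
          obtain ⟨x, hx, rfl⟩ := mem_image.mp hz
          rw [Fintype.mem_piFinset]
          intro j
          obtain ⟨q, hq⟩ := hc x hx j
          have hpos : (0:ℤ) < (p:ℤ) ^ (k - 1 - j.1) := by have := hp.pos; positivity
          refine mem_image.mpr ⟨(q % (p:ℤ) ^ (k - 1 - j.1)).toNat, ?_, ?_⟩
          · rw [mem_range]
            zify
            rw [Int.toNat_of_nonneg (Int.emod_nonneg _ hpos.ne')]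
            exact Int.emod_lt_of_pos _ hpos
          · simp only [Φ]
            rw [ZMod.intCast_eq_intCast_iff_dvd_sub, Int.toNat_of_nonneg (Int.emod_nonneg _ hpos.ne')]
            refine ⟨q / (p:ℤ) ^ (k - 1 - j.1), ?_⟩
            have e1 := Int.emod_add_mul_ediv q ((p:ℤ) ^ (k - 1 - j.1))
            have e2 : ((p ^ k:ℕ):ℤ) = (p:ℤ) ^ (j.1 + 1) * (p:ℤ) ^ (k - 1 - j.1) := by
              rw [← pow_add]; push_cast; congr 1; have := j.2; omega
            rw [e2]
            linear_combination hq + (-(p:ℤ) ^ (j.1 + 1)) * e1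
      _ = ∏ j, (S j).card := Fintype.card_piFinset S
      _ ≤ ∏ j : Fin k, p ^ (k - 1 - j.1) := by
          refine prod_le_prod' fun j _ => ?_
          exact card_image_le.trans (by simp)
      _ = p ^ (k * (k - 1) / 2) := by
          rw [prod_pow_eq_pow_sum]
          congr 1
          rw [Fin.sum_univ_eq_sum_range (fun j => k - 1 - j) k, sum_range_reflect (fun j => j) k,
            sum_range_id]
  have h2 : Q.card ≤ k ^ k * (Q.image Φ).card := by
    refine card_le_mul_card_image Q (k ^ k) fun z hz => ?_
    obtain ⟨x0, hx0, rfl⟩ := mem_image.mp hz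
    have hex : ∀ y ∈ Q, Φ y = Φ x0 → ∀ m, ∃ i, y m = x0 i := by
      intro y hy he m
      obtain ⟨i, hi⟩ := fibre_aux hp hk hkp x0 y (hQ x0 hx0) (fun j => (congrFun he j).symm) m
      exact ⟨i, hinj y hy x0 hx0 m i hi⟩
    calc _ ≤ ((univ : Finset (Fin k → Fin k)).image (fun σ => x0 ∘ σ)).card := by
          apply card_le_card
          intro y hy
          rw [mem_filter] at hy
          choose σ hσ using hex y hy.1 hy.2
          exact mem_image.mpr ⟨σ, mem_univ _, funext fun m => (hσ m).symm⟩
      _ ≤ _ := card_image_le.trans (by simp)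
  exact h2.trans (Nat.mul_le_mul_left _ h1)

end VK

namespace VK
open MeasureTheory UnitAddTorus Finset

noncomputable section

attribute [local instance] instMeasureSpaceUnitAddCircle

local instance : Measure.IsAddHaarMeasure (volume : Measure UnitAddCircle) :=
  inferInstanceAs (Measure.IsAddHaarMeasure AddCircle.haarAddCircle)

local instance : IsProbabilityMeasure (volume : Measure UnitAddCircle) :=
  inferInstanceAs (IsProbabilityMeasure AddCircle.haarAddCircle)

/-- energy -/
def En {κ V : Type*} [DecidableEq V] (U : Finset κ) (v : κ → V) : ℕ :=
  ((U ×ˢ U).filter (fun q => v q.1 = v q.2)).card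

lemma En_eq {κ V : Type*} [DecidableEq V] (U : Finset κ) (v : κ → V) (W : Finset V)
    (hW : ∀ x ∈ U, v x ∈ W) : En U v = ∑ w ∈ W, (U.filter (fun x => v x = w)).card ^ 2 := by
  unfold En
  rw [card_eq_sum_card_fiberwise (f := fun q => v q.1) (t := W)
    (fun q hq => hW _ (mem_product.mp (mem_filter.mp hq).1).1)]
  refine sum_congr rfl fun w _ => ?_
  rw [sq, ← card_product]
  congr 1
  ext q
  simp only [mem_filter, mem_product]
  constructor
  · rintro ⟨⟨⟨a, b⟩, c⟩, d⟩; exact ⟨⟨a, d⟩, b, c ▸ d⟩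
  · rintro ⟨⟨a, d⟩, b, c⟩; exact ⟨⟨⟨a, b⟩, d.trans c.symm⟩, d⟩

lemma En_cover {κ V τ : Type*} [DecidableEq V] [DecidableEq κ] (U : Finset κ) (v : κ → V) (T : Finset τ)
    (C : τ → Finset κ) (hC : ∀ x ∈ U, ∃ t ∈ T, x ∈ C t) (M:ℝ) (hM : ∀ t ∈ T, (En (C t) v:ℝ) ≤ M) :
    (En U v:ℝ) ≤ (T.card:ℝ) ^ 2 * M := by
  set W := (U.image v) ∪ T.biUnion (fun t => (C t).image v)
  rw [En_eq U v W (fun x hx => mem_union_left _ (mem_image_of_mem _ hx))]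
  have hM' : ∀ t ∈ T, ∑ w ∈ W, (((C t).filter (fun x => v x = w)).card:ℝ) ^ 2 ≤ M := by
    intro t ht
    have := hM t ht
    rw [En_eq (C t) v W (fun x hx => mem_union_right _
      (mem_biUnion.mpr ⟨t, ht, mem_image_of_mem _ hx⟩))] at this
    exact_mod_cast this
  push_cast
  have h1 : ∀ w, ((U.filter (fun x => v x = w)).card:ℝ) ≤
      ∑ t ∈ T, (((C t).filter (fun x => v x = w)).card:ℝ) := by
    intro w
    have : U.filter (fun x => v x = w) ⊆ T.biUnion (fun t => (C t).filter (fun x => v x = w)) := by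
      intro x hx
      rw [mem_filter] at hx
      obtain ⟨t, ht, hxt⟩ := hC x hx.1
      exact mem_biUnion.mpr ⟨t, ht, mem_filter.mpr ⟨hxt, hx.2⟩⟩
    exact_mod_cast (card_le_card this).trans card_biUnion_le
  calc ∑ w ∈ W, ((U.filter (fun x => v x = w)).card:ℝ) ^ 2
      ≤ ∑ w ∈ W, (T.card:ℝ) * ∑ t ∈ T, (((C t).filter (fun x => v x = w)).card:ℝ) ^ 2 := by
        refine sum_le_sum fun w _ => ?_
        refine (pow_le_pow_left₀ (by positivity) (h1 w) 2).trans ?_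
        exact sq_sum_le_card_mul_sum_sq
    _ = (T.card:ℝ) * ∑ t ∈ T, ∑ w ∈ W, (((C t).filter (fun x => v x = w)).card:ℝ) ^ 2 := by
        rw [← mul_sum, sum_comm]
    _ ≤ (T.card:ℝ) * ∑ t ∈ T, M := by gcongr with t ht; exact hM' t ht
    _ = _ := by rw [sum_const, nsmul_eq_mul]; ring

lemma J_eq_En (k:ℕ) {ι : Type*} [Fintype ι] [DecidableEq ι] (B : Finset ℤ) :
    J k (Fintype.card ι) B = (En (Fintype.piFinset (fun _ : ι => B)) (vec k):ℝ) := J_eq k B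

def dist (k p:ℕ) (B : Finset ℤ) : Finset (Fin k → ℤ) :=
  (Fintype.piFinset (fun _ : Fin k => B)).filter (fun x => ∀ i l, i ≠ l → ¬ (p:ℤ) ∣ x i - x l)

lemma vec_sum (k:ℕ) {ι κ : Type*} [Fintype ι] [Fintype κ] (z : ι ⊕ κ → ℤ) :
    vec k z = vec k (z ∘ Sum.inl) + vec k (z ∘ Sum.inr) := by
  simp [vec]

lemma class_count {p k s X : ℕ} (hp : p.Prime) (hk : 1 ≤ k) (hkp : k < p) (hX : X ≤ p ^ k) (a:ℤ)
    (Ba : Finset ℤ) (hB : ∀ x ∈ Ba, (p:ℤ) ∣ x - a) :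
    ∫ α, ‖∑ x ∈ dist k p (Icc (1:ℤ) X), mFourier (vec k x) α‖ ^ 2 * ‖ef k Ba α‖ ^ (2 * s) ≤
      (X:ℝ) ^ k * ((k:ℝ) ^ k * (p:ℝ) ^ (k * (k - 1) / 2)) * J k s Ba := by
  have h1 := mixed_eq k (ι := Fin s) Ba (dist k p (Icc (1:ℤ) X)) (vec k)
  rw [Fintype.card_fin] at h1
  rw [h1]
  set P := dist k p (Icc (1:ℤ) X) with hPdef
  set Q := Fintype.piFinset (fun _ : Fin s => Ba)
  set T := (P ×ˢ P).filter (fun q => ∀ j : Fin k, (p:ℤ) ^ (j.1 + 1) ∣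
    ∑ i, (q.1 i - a) ^ (j.1 + 1) - ∑ i, (q.2 i - a) ^ (j.1 + 1)) with hT
  have hPc : (P.card:ℝ) ≤ (X:ℝ) ^ k := by
    have : P.card ≤ X ^ k := (card_filter_le _ _).trans (by simp)
    exact_mod_cast this
  have hTc : (T.card:ℝ) ≤ (X:ℝ) ^ k * ((k:ℝ) ^ k * (p:ℝ) ^ (k * (k - 1) / 2)) := by
    have : T.card ≤ (k ^ k * p ^ (k * (k - 1) / 2)) * P.card := by
      refine card_le_mul_card_image_of_maps_to (f := Prod.snd) (t := P)
        (fun q hq => (mem_product.mp (mem_filter.mp hq).1).2) _ fun y hy => ?_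
      let sh : (Fin k → ℤ) → (Fin k → ℤ) := fun x i => x i - a
      have hsh : Function.Injective sh := fun x x' h => funext fun i => by
        have := congrFun h i; simpa [sh] using this
      have hl := linnik hp hk hkp (fun j => ∑ i, (y i - a) ^ (j.1 + 1))
        ((T.filter (fun q => q.2 = y)).image (fun q => sh q.1)) ?_ ?_ ?_
      · refine le_trans (le_of_eq ?_) hl
        rw [card_image_of_injOn]
        intro q hq q' hq' h
        simp only [coe_filter, Set.mem_ofPred_eq] at hq hq'
        exact Prod.ext (hsh h) (hq.2.trans hq'.2.symm)
      · intro x hx i l hil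
        obtain ⟨q, hq, rfl⟩ := mem_image.mp hx
        have := (mem_filter.mp (mem_product.mp (mem_filter.mp
          (mem_filter.mp hq).1).1).1).2 i l hil
        simpa [sh] using this
      · intro x hx x' hx' i l hil
        obtain ⟨q, hq, rfl⟩ := mem_image.mp hx
        obtain ⟨q', hq', rfl⟩ := mem_image.mp hx'
        have m1 := Fintype.mem_piFinset.mp (mem_filter.mp (mem_product.mp (mem_filter.mp
          (mem_filter.mp hq).1).1).1).1 i
        have m2 := Fintype.mem_piFinset.mp (mem_filter.mp (mem_product.mp (mem_filter.mp
          (mem_filter.mp hq').1).1).1).1 l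
        simp only [mem_Icc] at m1 m2
        rw [ZMod.intCast_eq_intCast_iff_dvd_sub] at hil
        have hX' : (X:ℤ) ≤ ((p ^ k:ℕ):ℤ) := by exact_mod_cast hX
        have := Int.eq_zero_of_abs_lt_dvd hil (by simp only [sh]; rw [abs_lt]; constructor <;> omega)
        omega
      · intro x hx j
        obtain ⟨q, hq, rfl⟩ := mem_image.mp hx
        have hq := mem_filter.mp hq
        have := (mem_filter.mp hq.1).2 j
        rw [hq.2] at this
        exact this
    calc (T.card:ℝ) ≤ (k:ℝ) ^ k * (p:ℝ) ^ (k * (k - 1) / 2) * P.card := by exact_mod_cast this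
      _ ≤ (k:ℝ) ^ k * (p:ℝ) ^ (k * (k - 1) / 2) * (X:ℝ) ^ k := by gcongr
      _ = _ := by ring
  refine le_trans ?_ (mul_le_mul_of_nonneg_right hTc (J_nonneg k s Ba))
  rw [card_eq_sum_card_fiberwise (f := fun q => (q.1.1, q.2.1)) (t := T)]
  · push_cast
    refine (sum_le_card_nsmul _ _ (J k s Ba) fun xy _ => ?_).trans (by rw [nsmul_eq_mul])
    have h2 := shift_le k (ι := Fin s) Ba (vec k xy.1 - vec k xy.2)
    rw [Fintype.card_fin] at h2
    refine le_trans ?_ h2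
    norm_cast
    refine card_le_card_of_injOn (fun q => (q.1.2, q.2.2)) ?_ ?_
    · intro q hq
      simp only [coe_filter, mem_filter, mem_product, Set.mem_ofPred_eq] at hq ⊢
      refine ⟨⟨hq.1.1.1.2, hq.1.1.2.2⟩, ?_⟩
      rw [← hq.2]
      have := hq.1.2
      simp only
      rw [sub_add_eq_add_sub, this]; abel
    · intro q hq q' hq' h
      simp only [coe_filter, mem_filter, mem_product, Set.mem_ofPred_eq] at hq hq'
      have e := hq.2.trans hq'.2.symm
      simp only [Prod.mk.injEq] at e h
      ext1 <;> ext1 <;> tauto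
  · intro q hq
    simp only [coe_filter, mem_product, Set.mem_ofPred_eq] at hq
    simp only [hT, coe_filter, mem_product, Set.mem_ofPred_eq]
    refine ⟨⟨hq.1.1.1, hq.1.2.1⟩, fun j => ?_⟩
    have e := sum_shift (Sum.elim q.1.1 q.1.2) (Sum.elim q.2.1 q.2.2) k (by
      rw [vec_sum, vec_sum]; simpa using hq.2) a
    have e' := congrFun e j
    simp only [vec_apply, Fintype.sum_sum_type, Sum.elim_inl, Sum.elim_inr] at e'
    have e2 : ∑ i, (q.1.1 i - a) ^ (j.1 + 1) - ∑ i, (q.2.1 i - a) ^ (j.1 + 1) =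
      ∑ i, (q.2.2 i - a) ^ (j.1 + 1) - ∑ i, (q.1.2 i - a) ^ (j.1 + 1) := by linarith
    rw [e2]
    apply dvd_sub <;> refine dvd_sum fun i _ => pow_dvd_pow_of_dvd (hB _ ?_) _
    · exact Fintype.mem_piFinset.mp hq.1.2.2 i
    · exact Fintype.mem_piFinset.mp hq.1.1.2 i

end
end VK

namespace VK
open MeasureTheory UnitAddTorus Finset

noncomputable section

attribute [local instance] instMeasureSpaceUnitAddCircle

local instance : Measure.IsAddHaarMeasure (volume : Measure UnitAddCircle) :=
  inferInstanceAs (Measure.IsAddHaarMeasure AddCircle.haarAddCircle)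

local instance : IsProbabilityMeasure (volume : Measure UnitAddCircle) :=
  inferInstanceAs (IsProbabilityMeasure AddCircle.haarAddCircle)

lemma J_class {p k s X : ℕ} (hp : p.Prime) (a:ℤ) (_ : a ∈ Ico (0:ℤ) p) :
    J k s ((Icc (1:ℤ) X).filter (fun x => x % p = a)) ≤ J k s (Icc (1:ℤ) ((X / p + 1:ℕ):ℤ)) := by
  have hp0 : (0:ℤ) < p := by exact_mod_cast hp.pos
  refine J_affine k s _ _ (a - p) p hp0.ne' fun x hx => ?_
  rw [mem_filter, mem_Icc] at hx
  refine ⟨x / p + 1, ?_, ?_⟩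
  · rw [mem_Icc]
    have h1 : x / (p:ℤ) ≤ (X:ℤ) / (p:ℤ) := Int.ediv_le_ediv hp0 hx.1.2
    have h2 : 0 ≤ x / (p:ℤ) := Int.ediv_nonneg (by omega) hp0.le
    push_cast
    omega
  · have := Int.emod_add_mul_ediv x p
    rw [hx.2] at this
    linear_combination -this

lemma good_count {p k s X : ℕ} (hp : p.Prime) (hk : 1 ≤ k) (hs : 1 ≤ s) (hkp : k < p) (hX : X ≤ p ^ k) :
    ∫ α, ‖∑ x ∈ dist k p (Icc (1:ℤ) X), mFourier (vec k x) α‖ ^ 2 * ‖ef k (Icc (1:ℤ) X) α‖ ^ (2 * s) ≤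
      (p:ℝ) ^ (2 * s) * ((X:ℝ) ^ k * ((k:ℝ) ^ k * (p:ℝ) ^ (k * (k - 1) / 2)) *
        J k s (Icc (1:ℤ) ((X / p + 1:ℕ):ℤ))) := by
  have hp0 : (0:ℤ) < p := by exact_mod_cast hp.pos
  have h := mixed_holder (k := k) hs
    (fun α => ‖∑ x ∈ dist k p (Icc (1:ℤ) X), mFourier (vec k x) α‖ ^ 2) (by fun_prop)
    (fun _ => by positivity) (Icc (1:ℤ) X) (Ico (0:ℤ) p) (fun x => x % p)
    (fun x _ => mem_Ico.mpr ⟨Int.emod_nonneg _ hp0.ne', Int.emod_lt_of_pos _ hp0⟩) _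
    (fun a ha => (class_count hp hk hkp hX a _ (fun x hx => by
      rw [mem_filter] at hx
      rw [← hx.2]; exact Int.dvd_self_sub_emod)).trans
      (mul_le_mul_of_nonneg_left (J_class hp a ha) (by positivity)))
  simpa using h

lemma bad_count {p k s X : ℕ} (hp : p.Prime) (hk : 1 ≤ k) (g : Fin k → Fin p) :
    J k (k + s) ((Icc (1:ℤ) X).filter (fun x => ∃ l, x % p = (g l).1)) ≤
      (k:ℝ) ^ (2 * (k + s)) * (((X / p + 1:ℕ):ℝ) ^ (2 * k) *
        J k s (Icc (1:ℤ) ((X / p + 1:ℕ):ℤ))) := by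
  have hA : (((univ : Finset (Fin k)).image (fun l => ((g l).1:ℤ))).card:ℝ) ≤ k := by
    have := (card_image_le (s := univ) (f := fun l : Fin k => ((g l).1:ℤ)))
    simp only [card_univ, Fintype.card_fin] at this
    exact_mod_cast this
  have hJ := J_nonneg k s (Icc (1:ℤ) ((X / p + 1:ℕ):ℤ))
  refine (J_holder (by omega) _ ((univ : Finset (Fin k)).image (fun l => ((g l).1:ℤ))) (fun x => x % p)
    ?_ (((X / p + 1:ℕ):ℝ) ^ (2 * k) *
        J k s (Icc (1:ℤ) ((X / p + 1:ℕ):ℤ))) ?_).trans ?_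
  · intro x hx
    obtain ⟨l, hl⟩ := (mem_filter.mp hx).2
    exact mem_image.mpr ⟨l, mem_univ _, hl.symm⟩
  · intro a ha
    obtain ⟨l, -, rfl⟩ := mem_image.mp ha
    have h1 : J k (k + s) (((Icc (1:ℤ) X).filter (fun x : ℤ => ∃ l, x % (p:ℤ) = ((g l).1:ℤ))).filter
        (fun x : ℤ => x % (p:ℤ) = ((g l).1:ℤ))) ≤ J k (k + s) ((Icc (1:ℤ) X).filter (fun x => x % p = ((g l).1:ℤ))) :=
      J_affine k _ _ _ 0 1 one_ne_zero (fun x hx => ⟨x, by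
        simp only [mem_filter] at hx ⊢; tauto, by ring⟩)
    refine h1.trans ((J_class hp _ (by simp)).trans ?_)
    rw [add_comm k s]
    refine (J_add_le _ _ _ _).trans (le_of_eq ?_)
    rw [Int.card_Icc, add_sub_cancel_right, Int.toNat_natCast]
  · gcongr

lemma recursion {p k s X : ℕ} (hp : p.Prime) (hk : 1 ≤ k) (hs : 1 ≤ s) (hkp : k < p) (hX : X ≤ p ^ k) :
    J k (k + s) (Icc (1:ℤ) X) ≤ 4 * (((k + s).factorial:ℝ) ^ 2 *
      ((p:ℝ) ^ (2 * s) * ((X:ℝ) ^ k * ((k:ℝ) ^ k * (p:ℝ) ^ (k * (k - 1) / 2)))) +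
      (p:ℝ) ^ (2 * k) * ((k:ℝ) ^ (2 * (k + s)) * (((X / p + 1:ℕ):ℝ) ^ (2 * k)))) *
        J k s (Icc (1:ℤ) ((X / p + 1:ℕ):ℤ)) := by
  classical
  have hp0 : (0:ℤ) < p := by exact_mod_cast hp.pos
  set JY := J k s (Icc (1:ℤ) ((X / p + 1:ℕ):ℤ))
  have hJY : 0 ≤ JY := J_nonneg _ _ _
  let ι := Fin k ⊕ Fin s
  have hcard : Fintype.card ι = k + s := by simp [ι]
  set U := Fintype.piFinset (fun _ : ι => Icc (1:ℤ) X)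
  let ρ : ℤ → Fin p := fun x => ⟨(x % p).toNat, by
    have := Int.emod_lt_of_pos x hp0
    have := Int.emod_nonneg x hp0.ne'
    omega⟩
  have hρ : ∀ x, ((ρ x).1:ℤ) = x % p := fun x => Int.toNat_of_nonneg (Int.emod_nonneg x hp0.ne')
  let isBad : (ι → ℤ) → Prop := fun z => ∃ g : Fin k → Fin p, ∀ i, ∃ l, z i % p = (g l).1
  have e1 : J k (k + s) (Icc (1:ℤ) X) = (En U (vec k):ℝ) := by
    rw [← hcard]; exact J_eq_En k _
  rw [e1]
  set Good := ((p:ℝ) ^ (2 * s) * ((X:ℝ) ^ k * ((k:ℝ) ^ k * (p:ℝ) ^ (k * (k - 1) / 2)) * JY))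
  set Bad := (k:ℝ) ^ (2 * (k + s)) * (((X / p + 1:ℕ):ℝ) ^ (2 * k) * JY)
  have hbad : (En (U.filter isBad) (vec k):ℝ) ≤ (p:ℝ) ^ (2 * k) * Bad := by
    have := En_cover (U.filter isBad) (vec k) (univ : Finset (Fin k → Fin p))
      (fun g => Fintype.piFinset (fun _ : ι => (Icc (1:ℤ) X).filter (fun x => ∃ l, x % p = (g l).1)))
      (fun z hz => by
        obtain ⟨hz1, g, hg⟩ := mem_filter.mp hz
        refine ⟨g, mem_univ _, Fintype.mem_piFinset.mpr fun i => mem_filter.mpr ⟨?_, hg i⟩⟩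
        exact Fintype.mem_piFinset.mp hz1 i) Bad
      (fun g _ => by rw [← J_eq_En, hcard]; exact bad_count hp hk g)
    refine this.trans (le_of_eq ?_)
    simp only [card_univ, Fintype.card_fun, Fintype.card_fin]
    push_cast
    rw [← pow_mul, mul_comm k 2]
  have hgood : (En (U.filter (fun z => ¬ isBad z)) (vec k):ℝ) ≤ ((k + s).factorial:ℝ) ^ 2 * Good := by
    have := En_cover (U.filter (fun z => ¬ isBad z)) (vec k) (univ : Finset (Equiv.Perm ι))
      (fun ϖ => U.filter (fun z => (z ∘ ϖ) ∘ Sum.inl ∈ dist k p (Icc (1:ℤ) X)))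
      (fun z hz => ?_) Good (fun ϖ _ => ?_)
    · refine this.trans (le_of_eq ?_)
      rw [card_univ, Fintype.card_perm, hcard]
    · obtain ⟨hz1, hz2⟩ := mem_filter.mp hz
      have hc : k ≤ ((univ : Finset ι).image (fun i => ρ (z i))).card := by
        by_contra hlt
        push Not at hlt
        apply hz2
        set R := (univ : Finset ι).image (fun i => ρ (z i))
        let i0 : ι := Sum.inl ⟨0, by omega⟩
        refine ⟨fun l => if h : l.1 < R.card then (R.equivFin.symm ⟨l.1, h⟩).1 else ρ (z i0), fun i => ?_⟩
        have hi : ρ (z i) ∈ R := mem_image_of_mem _ (mem_univ i)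
        refine ⟨⟨(R.equivFin ⟨_, hi⟩).1, ((R.equivFin ⟨_, hi⟩).2).trans hlt⟩, ?_⟩
        simp [hρ]
      obtain ⟨R', hR', hR'c⟩ := exists_subset_card_eq hc
      have hch : ∀ r : R', ∃ i, ρ (z i) = r.1 := fun r => by
        obtain ⟨i, -, hi⟩ := mem_image.mp (hR' r.2); exact ⟨i, hi⟩
      choose e he using hch
      let f : ι → ι := Sum.elim (fun l => e (R'.equivFin.symm (Fin.cast hR'c.symm l))) (fun j => Sum.inr j)
      have hρf : ∀ l, ρ (z (f (Sum.inl l))) = (R'.equivFin.symm (Fin.cast hR'c.symm l)).1 := fun l => he _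
      have hinj : ∀ l l', ρ (z (f (Sum.inl l))) = ρ (z (f (Sum.inl l'))) → l = l' := by
        intro l l' h
        rw [hρf, hρf] at h
        have h2 := R'.equivFin.symm.injective (Subtype.ext h)
        exact Fin.ext (by simpa [Fin.ext_iff] using h2)
      obtain ⟨g, hg⟩ := exists_equiv_extend_of_card_eq (α := ι) (β := ι) (t := univ)
        (by rw [card_univ]) (s := (univ : Finset (Fin k)).image Sum.inl) (f := f)
        (subset_univ _) (by
          intro a ha b hb hab
          simp only [coe_image, coe_univ, Set.image_univ, Set.mem_range] at ha hb
          obtain ⟨l, rfl⟩ := ha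
          obtain ⟨l', rfl⟩ := hb
          rw [hinj l l' (by rw [hab])])
      let ϖ : Equiv.Perm ι := g.trans (Equiv.subtypeUnivEquiv (fun x => mem_univ x))
      have hϖ : ∀ l, ϖ (Sum.inl l) = f (Sum.inl l) := fun l =>
        hg _ (mem_image_of_mem _ (mem_univ l))
      refine ⟨ϖ, mem_univ _, mem_filter.mpr ⟨hz1, mem_filter.mpr ⟨?_, ?_⟩⟩⟩
      · exact Fintype.mem_piFinset.mpr fun l => Fintype.mem_piFinset.mp hz1 _
      · intro i l hil hd
        apply hil
        apply hinj
        simp only [Function.comp, hϖ] at hd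
        apply Fin.ext
        zify
        rw [hρ, hρ]
        exact Int.emod_eq_emod_iff_emod_sub_eq_zero.mpr
          (Int.emod_eq_zero_of_dvd hd)
    · refine le_trans ?_ (good_count (s := s) hp hk hs hkp hX)
      have h1 := mixed_eq k (ι := Fin s) (Icc (1:ℤ) X) (dist k p (Icc (1:ℤ) X)) (vec k)
      rw [Fintype.card_fin] at h1
      rw [h1]
      norm_cast
      unfold En
      refine card_le_card_of_injOn (fun q => (((q.1 ∘ ϖ) ∘ Sum.inl, (q.1 ∘ ϖ) ∘ Sum.inr),
        ((q.2 ∘ ϖ) ∘ Sum.inl, (q.2 ∘ ϖ) ∘ Sum.inr))) ?_ ?_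
      · intro q hq
        simp only [coe_filter, mem_filter, mem_product, Set.mem_ofPred_eq] at hq ⊢
        refine ⟨⟨⟨hq.1.1.2, ?_⟩, hq.1.2.2, ?_⟩, ?_⟩
        · exact Fintype.mem_piFinset.mpr fun l => Fintype.mem_piFinset.mp hq.1.1.1 _
        · exact Fintype.mem_piFinset.mpr fun l => Fintype.mem_piFinset.mp hq.1.2.1 _
        · rw [← vec_sum, ← vec_sum]
          have hv : ∀ z : ι → ℤ, vec k (z ∘ ϖ) = vec k z := fun z => by
            unfold vec
            exact Equiv.sum_comp ϖ (fun i => pw k (z i))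
          rw [hv, hv, hq.2]
      · intro q _ q' _ h
        simp only [Prod.mk.injEq] at h
        have hz : ∀ z z' : ι → ℤ, (z ∘ ϖ) ∘ Sum.inl = (z' ∘ ϖ) ∘ Sum.inl →
            (z ∘ ϖ) ∘ Sum.inr = (z' ∘ ϖ) ∘ Sum.inr → z = z' := by
          intro z z' h1 h2
          have : z ∘ ϖ = z' ∘ ϖ := by
            funext i
            rcases i with i | i
            · exact congrFun h1 i
            · exact congrFun h2 i
          exact ϖ.surjective.injective_comp_right this
        exact Prod.ext (hz _ _ h.1.1 h.1.2) (hz _ _ h.2.1 h.2.2)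
  have := En_cover U (vec k) (univ : Finset Bool) (fun b => if b then U.filter isBad
    else U.filter (fun z => ¬ isBad z)) (fun z hz => by
      by_cases h : isBad z
      · exact ⟨true, mem_univ _, by simp [hz, h]⟩
      · exact ⟨false, mem_univ _, by simp [hz, h]⟩)
      (((k + s).factorial:ℝ) ^ 2 * Good + (p:ℝ) ^ (2 * k) * Bad) (fun b _ => by
        have : 0 ≤ Good := by positivity
        have : 0 ≤ Bad := by positivity
        cases b
        · simp only [Bool.false_eq_true, if_false]
          exact hgood.trans (le_add_of_nonneg_right (by positivity))
        · simp only [if_true]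
          exact hbad.trans (le_add_of_nonneg_left (by positivity)))
  refine this.trans (le_of_eq ?_)
  simp only [card_univ, Fintype.card_bool, Good, Bad]
  push_cast
  ring

end
end VK

namespace VK
open Finset

noncomputable section

lemma vm_const {k s S : ℕ} (hk : 2 ≤ k) (hS : k + s ≤ S) :
    4 * (((k + s).factorial:ℝ) ^ 2 * (k:ℝ) ^ k + (4:ℝ) ^ k * (k:ℝ) ^ (2 * (k + s))) * 2 ^ (4 * s) ≤
      (2 * (S:ℝ)) ^ (8 * S) := by
  have hS2 : 2 ≤ S := by omega
  have hS1 : (1:ℝ) ≤ S := by exact_mod_cast (by omega : 1 ≤ S)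
  have hkS : (k:ℝ) ≤ S := by exact_mod_cast (by omega : k ≤ S)
  have h1 : ((k + s).factorial:ℝ) ≤ (2 * (S:ℝ)) ^ S := by
    have : (k + s).factorial ≤ S ^ S :=
      (Nat.factorial_le hS).trans (Nat.factorial_le_pow S)
    have h2 : ((k + s).factorial:ℝ) ≤ (S:ℝ) ^ S := by exact_mod_cast this
    exact h2.trans (by gcongr; linarith)
  have h2 : (k:ℝ) ^ k ≤ (2 * (S:ℝ)) ^ S :=
    (pow_le_pow_left₀ (by positivity) (by linarith : (k:ℝ) ≤ 2 * S) k).trans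
      (pow_le_pow_right₀ (by linarith) (by omega))
  have h3 : (4:ℝ) ^ k * (k:ℝ) ^ (2 * (k + s)) ≤ (2 * (S:ℝ)) ^ S * (2 * (S:ℝ)) ^ (2 * S) := by
    have a1 : (4:ℝ) ^ k ≤ (2 * (S:ℝ)) ^ S :=
      (pow_le_pow_left₀ (by positivity) (by have : (2:ℝ) ≤ S := by exact_mod_cast hS2
                                            linarith : (4:ℝ) ≤ 2 * S) k).trans
      (pow_le_pow_right₀ (by linarith) (by omega))
    have a2 : (k:ℝ) ^ (2 * (k + s)) ≤ (2 * (S:ℝ)) ^ (2 * S) :=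
      (pow_le_pow_left₀ (by positivity) (by linarith : (k:ℝ) ≤ 2 * S) _).trans
      (pow_le_pow_right₀ (by linarith) (by omega))
    gcongr
  have h4 : (2:ℝ) ^ (4 * s) ≤ (2 * (S:ℝ)) ^ (4 * S) :=
    (pow_le_pow_left₀ (by positivity) (by linarith : (2:ℝ) ≤ 2 * S) _).trans
      (pow_le_pow_right₀ (by linarith) (by omega))
  have h5 : (8:ℝ) ≤ (2 * (S:ℝ)) ^ S := by
    have : (2:ℝ) ≤ S := by exact_mod_cast hS2
    calc (8:ℝ) ≤ (2 * (S:ℝ)) ^ 2 := by nlinarith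
      _ ≤ _ := pow_le_pow_right₀ (by linarith) hS2
  set W := (2 * (S:ℝ)) ^ S with hW
  have e : ∀ n : ℕ, (2 * (S:ℝ)) ^ (n * S) = W ^ n := fun n => by rw [hW, ← pow_mul, mul_comm n S]
  rw [e] at h3 h4 ⊢
  calc _ ≤ 4 * (W ^ 2 * W + W * W ^ 2) * W ^ 4 := by gcongr
    _ = 8 * W ^ 7 := by ring
    _ ≤ W * W ^ 7 := by gcongr
    _ = W ^ 8 := by ring

lemma vm_main {k s p X Y : ℕ} {η E F : ℝ} (hk : 2 ≤ k) (hs : k ^ 2 ≤ s) (hX1 : (1:ℝ) ≤ X) (hp1 : (1:ℝ) ≤ p)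
    (hE : E = 2 * s - k * (k + 1) / 2 + η) (hF : F = k ^ 2 - η) (hE0 : 0 ≤ E) (hF0 : 0 ≤ F)
    (hpr : (p:ℝ) ≤ 2 * (X:ℝ) ^ (1 / k:ℝ)) (hYr : (Y:ℝ) ≤ 2 * X / p) :
    ((p:ℝ) ^ (2 * s) * (p:ℝ) ^ (k * (k - 1) / 2) * (X:ℝ) ^ k) * (Y:ℝ) ^ E ≤
        2 ^ (4 * s) * (X:ℝ) ^ (2 * ((k + s:ℕ):ℝ) - k * (k + 1) / 2 + η * (1 - 1 / k):ℝ) := by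
  have hp0 : (0:ℝ) < p := by linarith
  have hk1 : (2:ℝ) ≤ k := by exact_mod_cast hk
  have hsr : (k:ℝ) ^ 2 ≤ s := by exact_mod_cast hs
  have b1 : (p:ℝ) ^ (2 * s) * (p:ℝ) ^ (k * (k - 1) / 2) = (p:ℝ) ^ (F + E) := by
    rw [← pow_add, ← Real.rpow_natCast]
    congr 1
    have hd : 2 * (k * (k - 1) / 2) = k * (k - 1) := Nat.mul_div_cancel' (Nat.even_mul_pred_self k).two_dvd
    have hd' : (2:ℝ) * ((k * (k - 1) / 2:ℕ):ℝ) = k * (k - 1) := by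
      have : ((2 * (k * (k - 1) / 2):ℕ):ℝ) = ((k * (k - 1):ℕ):ℝ) := by rw [hd]
      push_cast [Nat.cast_sub (by omega : 1 ≤ k)] at this
      exact this
    push_cast
    rw [hF, hE]
    linarith
  have b2 : (Y:ℝ) ^ E ≤ 2 ^ E * (X:ℝ) ^ E / (p:ℝ) ^ E := by
    rw [← Real.mul_rpow (by norm_num) (by linarith), ← Real.div_rpow (by linarith) (by linarith)]
    exact Real.rpow_le_rpow (by positivity) hYr hE0
  have b3 : (p:ℝ) ^ F ≤ 2 ^ F * (X:ℝ) ^ (F / k) := by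
    calc (p:ℝ) ^ F ≤ (2 * (X:ℝ) ^ (1 / k:ℝ)) ^ F := Real.rpow_le_rpow hp0.le hpr hF0
      _ = _ := by
        rw [Real.mul_rpow (by norm_num) (by positivity), ← Real.rpow_mul (by linarith)]
        congr 2; ring
  calc _ ≤ ((p:ℝ) ^ (F + E) * (X:ℝ) ^ k) * (2 ^ E * (X:ℝ) ^ E / (p:ℝ) ^ E) := by
        rw [b1]; gcongr
    _ = (p:ℝ) ^ F * ((X:ℝ) ^ (k:ℝ) * (2 ^ E * (X:ℝ) ^ E)) := by
        rw [Real.rpow_add hp0, Real.rpow_natCast]; field_simp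
    _ ≤ (2 ^ F * (X:ℝ) ^ (F / k)) * ((X:ℝ) ^ (k:ℝ) * (2 ^ E * (X:ℝ) ^ E)) := by gcongr
    _ = 2 ^ (F + E) * (X:ℝ) ^ (F / k + k + E) := by
        rw [Real.rpow_add (by norm_num : (0:ℝ) < 2), Real.rpow_add (by linarith), Real.rpow_add (by linarith)]; ring
    _ ≤ _ := by
        have e1 : F / k + k + E = 2 * ((k + s:ℕ):ℝ) - k * (k + 1) / 2 + η * (1 - 1 / k) := by
          rw [hF, hE]; push_cast; field_simp; ring
        rw [e1]
        gcongr
        rw [← Real.rpow_natCast]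
        apply Real.rpow_le_rpow_of_exponent_le (by norm_num)
        rw [hF, hE]; push_cast; clear * - hsr hk1 hs; nlinarith

lemma vm_step {k s S : ℕ} (hk : 2 ≤ k) (hs : k ^ 2 ≤ s) (hS : k + s ≤ S) {η D : ℝ} (hη0 : 0 ≤ η)
    (hη : η ≤ k * (k + 1) / 2) (hD : (k:ℝ) ^ (k ^ 3) ≤ D)
    (h : ∀ X : ℕ, 1 ≤ X → J k s (Icc (1:ℤ) X) ≤ D * (X:ℝ) ^ (2 * s - k * (k + 1) / 2 + η:ℝ)) :
    ∀ X : ℕ, 1 ≤ X → J k (k + s) (Icc (1:ℤ) X) ≤ D * (2 * (S:ℝ)) ^ (8 * S) *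
      (X:ℝ) ^ (2 * ((k + s:ℕ):ℝ) - k * (k + 1) / 2 + η * (1 - 1 / k):ℝ) := by
  intro X hX
  have hk1 : (2:ℝ) ≤ k := by exact_mod_cast hk
  have hX1 : (1:ℝ) ≤ X := by exact_mod_cast hX
  have hsr : (k:ℝ) ^ 2 ≤ s := by exact_mod_cast hs
  have hS1 : (1:ℝ) ≤ 2 * (S:ℝ) := by
    have : (1:ℝ) ≤ S := by exact_mod_cast (by omega : 1 ≤ S)
    linarith
  have hD0 : 0 < D := lt_of_lt_of_le (by positivity) hD
  have hk0 : 0 ≤ 1 - 1 / (k:ℝ) := by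
    rw [sub_nonneg, div_le_one (by linarith)]; linarith
  rcases lt_or_ge X (k ^ k) with hlt | hge
  · have h1 := J_le_triv k (k + s) (Icc (1:ℤ) X)
    rw [Int.card_Icc, add_sub_cancel_right, Int.toNat_natCast] at h1
    refine h1.trans ?_
    have h2 : (X:ℝ) ^ (2 * (k + s)) = (X:ℝ) ^ (k * (k + 1) / 2 - η * (1 - 1 / k):ℝ) *
       (X:ℝ) ^ (2 * ((k + s:ℕ):ℝ) - k * (k + 1) / 2 + η * (1 - 1 / k):ℝ) := by
      rw [← Real.rpow_add (by linarith), ← Real.rpow_natCast]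
      congr 1; push_cast; ring
    rw [h2]
    gcongr
    have h3 : (X:ℝ) ^ (k * (k + 1) / 2 - η * (1 - 1 / k):ℝ) ≤ (k:ℝ) ^ (k ^ 3) := by
      calc (X:ℝ) ^ (k * (k + 1) / 2 - η * (1 - 1 / k):ℝ) ≤ (X:ℝ) ^ ((k ^ 2:ℕ):ℝ) := by
            apply Real.rpow_le_rpow_of_exponent_le hX1
            push_cast
            have := mul_nonneg hη0 hk0
            clear * - this hk1 hη0; nlinarith
        _ = (X:ℝ) ^ (k ^ 2) := Real.rpow_natCast _ _
        _ ≤ ((k:ℝ) ^ k) ^ (k ^ 2) := by gcongr; exact_mod_cast hlt.le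
        _ = _ := by rw [← pow_mul]; congr 1; ring
    exact h3.trans (hD.trans (le_mul_of_one_le_right hD0.le (one_le_pow₀ hS1)))
  · obtain ⟨m, hm1, hm2⟩ : ∃ m, m ^ k ≤ X ∧ X < (m + 1) ^ k := by
      have hex : ∃ n, X < (n + 1) ^ k := ⟨X, by
        calc X < X + 1 := by omega
          _ ≤ (X + 1) ^ k := Nat.le_self_pow (by omega) _⟩
      refine ⟨Nat.find hex, ?_, Nat.find_spec hex⟩
      rcases Nat.eq_zero_or_pos (Nat.find hex) with h0 | hpos
      · rw [h0, zero_pow (by omega)]; omega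
      · have := Nat.find_min hex (m := Nat.find hex - 1) (by omega)
        rw [not_lt, Nat.sub_add_cancel hpos] at this
        exact this
    have hmk : k ≤ m := by
      by_contra hlt
      have : (m + 1) ^ k ≤ k ^ k := Nat.pow_le_pow_left (by omega) k
      omega
    obtain ⟨p, hp, hmp, hp2⟩ := Nat.exists_prime_lt_and_le_two_mul m (by omega)
    have hXp : X ≤ p ^ k := hm2.le.trans (Nat.pow_le_pow_left (by omega) k)
    have hpX : p ≤ X := by
      calc p ≤ 2 * m := hp2
        _ ≤ m * m := Nat.mul_le_mul_right _ (by omega)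
        _ = m ^ 2 := (sq m).symm
        _ ≤ m ^ k := Nat.pow_le_pow_right (by omega) hk
        _ ≤ X := hm1
    have hp1 : (1:ℝ) ≤ p := by exact_mod_cast hp.one_lt.le
    have hp0 : (0:ℝ) < p := by linarith
    have hXpr : (X:ℝ) ≤ (p:ℝ) ^ k := by exact_mod_cast hXp
    have hpr : (p:ℝ) ≤ 2 * (X:ℝ) ^ (1 / k:ℝ) := by
      have : (m:ℝ) ≤ (X:ℝ) ^ (1 / k:ℝ) := by
        have h1 : ((m:ℝ) ^ k) ^ (1 / k:ℝ) = m := by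
          rw [← Real.rpow_natCast, ← Real.rpow_mul (by positivity), mul_one_div_cancel (by positivity), Real.rpow_one]
        rw [← h1]
        apply Real.rpow_le_rpow (by positivity) (by exact_mod_cast hm1) (by positivity)
      have h2 : (p:ℝ) ≤ 2 * m := by exact_mod_cast hp2
      linarith
    set Y := X / p + 1 with hY
    have hYr : (Y:ℝ) ≤ 2 * X / p := by
      have h1 : ((X / p:ℕ):ℝ) ≤ X / p := Nat.cast_div_le
      have h2 : (1:ℝ) ≤ X / p := by rw [le_div_iff₀ hp0]; simpa using (by exact_mod_cast hpX : (p:ℝ) ≤ X)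
      rw [hY]; push_cast; rw [mul_div_assoc]; linarith
    have hrec := recursion (s := s) hp (by omega) (by clear * - hs hk; nlinarith) (by omega) hXp
    have hJY := h Y (Nat.succ_le_succ (Nat.zero_le _))
    set E : ℝ := 2 * s - k * (k + 1) / 2 + η with hE
    have hE0 : 0 ≤ E := by rw [hE]; clear * - hsr hk1 hη0 hη; nlinarith
    set F : ℝ := k ^ 2 - η with hF
    have hF0 : 0 ≤ F := by rw [hF]; clear * - hsr hk1 hη0 hη; nlinarith
    rw [← hY] at hrec
    clear_value E F Y
    have hcoef : (((k + s).factorial:ℝ) ^ 2 *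
      ((p:ℝ) ^ (2 * s) * ((X:ℝ) ^ k * ((k:ℝ) ^ k * (p:ℝ) ^ (k * (k - 1) / 2)))) +
      (p:ℝ) ^ (2 * k) * ((k:ℝ) ^ (2 * (k + s)) * ((Y:ℝ) ^ (2 * k)))) ≤
      (((k + s).factorial:ℝ) ^ 2 * (k:ℝ) ^ k + (4:ℝ) ^ k * (k:ℝ) ^ (2 * (k + s))) *
        ((p:ℝ) ^ (2 * s) * (p:ℝ) ^ (k * (k - 1) / 2) * (X:ℝ) ^ k) := by
      have a1 : (p:ℝ) ^ (2 * k) * (Y:ℝ) ^ (2 * k) ≤ (4:ℝ) ^ k * ((X:ℝ) ^ k * (X:ℝ) ^ k) := by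
        rw [← mul_pow]
        have : (p:ℝ) * Y ≤ 2 * X := by
          rw [le_div_iff₀ hp0] at hYr; linarith
        calc ((p:ℝ) * Y) ^ (2 * k) ≤ (2 * (X:ℝ)) ^ (2 * k) := by gcongr
          _ = _ := by rw [pow_mul, ← mul_pow, ← mul_pow]; congr 1; ring
      have a2 : (X:ℝ) ^ k ≤ (p:ℝ) ^ (2 * s) * (p:ℝ) ^ (k * (k - 1) / 2) := by
        calc (X:ℝ) ^ k ≤ ((p:ℝ) ^ k) ^ k := by gcongr
          _ = (p:ℝ) ^ (k ^ 2) := by rw [← pow_mul, sq]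
          _ ≤ (p:ℝ) ^ (2 * s) := pow_le_pow_right₀ hp1 (by omega)
          _ ≤ _ := le_mul_of_one_le_right (by positivity) (one_le_pow₀ hp1)
      have a3 : (p:ℝ) ^ (2 * k) * ((k:ℝ) ^ (2 * (k + s)) * ((Y:ℝ) ^ (2 * k))) ≤
          (4:ℝ) ^ k * (k:ℝ) ^ (2 * (k + s)) * ((p:ℝ) ^ (2 * s) * (p:ℝ) ^ (k * (k - 1) / 2) * (X:ℝ) ^ k) := by
        calc _ = (k:ℝ) ^ (2 * (k + s)) * ((p:ℝ) ^ (2 * k) * (Y:ℝ) ^ (2 * k)) := by ring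
          _ ≤ (k:ℝ) ^ (2 * (k + s)) * ((4:ℝ) ^ k * ((X:ℝ) ^ k * (X:ℝ) ^ k)) := by gcongr
          _ ≤ (k:ℝ) ^ (2 * (k + s)) * ((4:ℝ) ^ k * (((p:ℝ) ^ (2 * s) * (p:ℝ) ^ (k * (k - 1) / 2)) * (X:ℝ) ^ k)) := by gcongr
          _ = _ := by ring
      linarith
    have hmain := vm_main (s := s) (Y := Y) hk hs hX1 hp1 hE hF hE0 hF0 hpr hYr
    have hc := vm_const hk hS
    have hJ0 := J_nonneg k s (Icc (1:ℤ) (Y:ℤ))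
    calc _ ≤ _ := hrec
      _ ≤ 4 * ((((k + s).factorial:ℝ) ^ 2 * (k:ℝ) ^ k + (4:ℝ) ^ k * (k:ℝ) ^ (2 * (k + s))) *
        ((p:ℝ) ^ (2 * s) * (p:ℝ) ^ (k * (k - 1) / 2) * (X:ℝ) ^ k)) * (D * (Y:ℝ) ^ E) := by
          gcongr
      _ = D * (4 * (((k + s).factorial:ℝ) ^ 2 * (k:ℝ) ^ k + (4:ℝ) ^ k * (k:ℝ) ^ (2 * (k + s)))) *
        (((p:ℝ) ^ (2 * s) * (p:ℝ) ^ (k * (k - 1) / 2) * (X:ℝ) ^ k) * (Y:ℝ) ^ E) := by ring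
      _ ≤ D * (4 * (((k + s).factorial:ℝ) ^ 2 * (k:ℝ) ^ k + (4:ℝ) ^ k * (k:ℝ) ^ (2 * (k + s)))) *
        (2 ^ (4 * s) * (X:ℝ) ^ (2 * ((k + s:ℕ):ℝ) - k * (k + 1) / 2 + η * (1 - 1 / k):ℝ)) := by gcongr
      _ = D * (4 * (((k + s).factorial:ℝ) ^ 2 * (k:ℝ) ^ k + (4:ℝ) ^ k * (k:ℝ) ^ (2 * (k + s))) * 2 ^ (4 * s)) *
        ((X:ℝ) ^ (2 * ((k + s:ℕ):ℝ) - k * (k + 1) / 2 + η * (1 - 1 / k):ℝ)) := by ring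
      _ ≤ _ := by gcongr

theorem vmvt (R k:ℕ) (hk : 2 ≤ k) (X:ℕ) (hX : 1 ≤ X) :
    J k ((1 + R) * k ^ 2) (Icc (1:ℤ) X) ≤ (k:ℝ) ^ (k ^ 3) *
      (2 * (((1 + R) * k ^ 2:ℕ):ℝ)) ^ (8 * ((1 + R) * k ^ 2) * (R * k)) *
      (X:ℝ) ^ (2 * (((1 + R) * k ^ 2:ℕ):ℝ) - k * (k + 1) / 2 + k ^ 2 * Real.exp (-R):ℝ) := by
  have hk1 : (2:ℝ) ≤ k := by exact_mod_cast hk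
  have hX1 : (1:ℝ) ≤ X := by exact_mod_cast hX
  set S := (1 + R) * k ^ 2 with hS
  have hS1 : (1:ℝ) ≤ 2 * (S:ℝ) := by
    have : (1:ℝ) ≤ S := by
      have : 1 ≤ S := by rw [hS]; have : 0 < k := by omega
                         exact Nat.succ_le_of_lt (by positivity)
      exact_mod_cast this
    linarith
  have hk0 : 0 ≤ 1 - 1 / (k:ℝ) := by
    rw [sub_nonneg, div_le_one (by linarith)]; linarith
  have hk0' : 1 - 1 / (k:ℝ) ≤ 1 := by
    have : 0 ≤ 1 / (k:ℝ) := by positivity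
    linarith
  have main : ∀ n, n ≤ R * k → ∀ X : ℕ, 1 ≤ X → J k (k ^ 2 + n * k) (Icc (1:ℤ) X) ≤
      ((k:ℝ) ^ (k ^ 3) * ((2 * (S:ℝ)) ^ (8 * S)) ^ n) *
      (X:ℝ) ^ (2 * ((k ^ 2 + n * k:ℕ):ℝ) - k * (k + 1) / 2 + k * (k + 1) / 2 * (1 - 1 / k) ^ n:ℝ) := by
    intro n
    induction n with
    | zero =>
      intro _ X hX
      have h1 := J_le_triv k (k ^ 2) (Icc (1:ℤ) X)
      rw [Int.card_Icc, add_sub_cancel_right, Int.toNat_natCast] at h1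
      simp only [zero_mul, add_zero, pow_zero, mul_one, sub_add_cancel]
      refine h1.trans ?_
      rw [← Real.rpow_natCast]
      push_cast
      refine le_mul_of_one_le_left (by positivity) (one_le_pow₀ (by linarith))
    | succ n ih =>
      intro hn X hX
      have := vm_step (s := k ^ 2 + n * k) (S := S) hk (by omega) (by rw [hS]; nlinarith)
        (η := k * (k + 1) / 2 * (1 - 1 / k) ^ n) (by positivity)
        (mul_le_of_le_one_right (by positivity) (pow_le_one₀ hk0 hk0'))
        (le_mul_of_one_le_right (by positivity) (one_le_pow₀ (one_le_pow₀ hS1)))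
        (ih (by omega)) X hX
      have e : k ^ 2 + (n + 1) * k = k + (k ^ 2 + n * k) := by ring
      rw [e]
      refine this.trans (le_of_eq ?_)
      rw [pow_succ _ n, pow_succ (1 - 1 / (k:ℝ)) n]
      ring_nf
  have h := main (R * k) le_rfl X hX
  have e : k ^ 2 + R * k * k = S := by rw [hS]; ring
  rw [e, ← pow_mul] at h
  refine h.trans ?_
  refine mul_le_mul_of_nonneg_left (Real.rpow_le_rpow_of_exponent_le hX1 (add_le_add_right ?_ _)) (by positivity)
  · have h1 : (1 - 1 / (k:ℝ)) ^ (R * k) ≤ Real.exp (-R) := by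
      have : 1 - 1 / (k:ℝ) ≤ Real.exp (-(1 / k)) := by
        have := Real.add_one_le_exp (-(1 / (k:ℝ))); linarith
      calc _ ≤ (Real.exp (-(1 / k))) ^ (R * k) := by gcongr
        _ = _ := by
          rw [← Real.exp_nat_mul]; congr 1; push_cast; field_simp
    have : (k:ℝ) * (k + 1) / 2 ≤ k ^ 2 := by nlinarith
    exact mul_le_mul this h1 (by positivity) (by positivity)

end
end VK

namespace VK
open Finset

noncomputable section

def ee (x:ℝ) : ℂ := Complex.exp (((2 * Real.pi * x:ℝ):ℂ) * Complex.I)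

lemma ee_norm (x:ℝ) : ‖ee x‖ = 1 := Complex.norm_exp_ofReal_mul_I _

lemma ee_add (x y:ℝ) : ee (x + y) = ee x * ee y := by
  unfold ee; rw [← Complex.exp_add]; congr 1; push_cast; ring

lemma ee_zero : ee 0 = 1 := by simp [ee]

lemma ee_neg (x:ℝ) : ee (-x) = (starRingEnd ℂ) (ee x) := by
  unfold ee; rw [← Complex.exp_conj]; congr 1
  rw [map_mul, Complex.conj_I, Complex.conj_ofReal]; push_cast; ring

lemma ee_sum {ι : Type*} (s : Finset ι) (f : ι → ℝ) : ee (∑ i ∈ s, f i) = ∏ i ∈ s, ee (f i) := by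
  classical
  induction s using Finset.induction_on with
  | empty => simp [ee_zero]
  | insert a s ha ih => rw [sum_insert ha, prod_insert ha, ee_add, ih]

/-- pairing -/
def pr {k : ℕ} (φ : Fin k → ℝ) (v : Fin k → ℤ) : ℝ := ∑ j, φ j * v j

lemma pr_sum {k : ℕ} {ι : Type*} (φ : Fin k → ℝ) (s : Finset ι) (v : ι → Fin k → ℤ) :
    pr φ (∑ i ∈ s, v i) = ∑ i ∈ s, pr φ (v i) := by
  unfold pr
  rw [sum_comm]
  refine sum_congr rfl fun j _ => ?_
  rw [Finset.sum_apply]; push_cast; rw [mul_sum]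

lemma pr_sub {k : ℕ} (φ : Fin k → ℝ) (v w : Fin k → ℤ) : pr φ (v - w) = pr φ v + -pr φ w := by
  unfold pr
  rw [← sum_neg_distrib, ← sum_add_distrib]
  refine sum_congr rfl fun j _ => ?_
  simp; ring

abbrev tup (s:ℕ) (B : Finset ℤ) : Finset (Fin s → ℤ) := Fintype.piFinset (fun _ : Fin s => B)

lemma pow_expand {k : ℕ} (s:ℕ) (B : Finset ℤ) (φ : Fin k → ℝ) :
    ((‖∑ x ∈ B, ee (pr φ (pw k x))‖ ^ (2 * s):ℝ):ℂ) =
      ∑ q ∈ tup s B ×ˢ tup s B, ee (pr φ (vec k q.1 - vec k q.2)) := by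
  have h1 : (∑ x ∈ B, ee (pr φ (pw k x))) ^ s = ∑ x ∈ tup s B, ee (pr φ (vec k x)) := by
    have := prod_univ_sum (fun _ : Fin s => B) (fun _ x => ee (pr φ (pw k x)))
    simp only [prod_const, card_univ, Fintype.card_fin] at this
    rw [this]
    refine sum_congr rfl fun x _ => ?_
    rw [vec, pr_sum, ee_sum]
  rw [mul_comm 2, pow_mul, ← norm_pow, h1, ← Complex.normSq_eq_norm_sq, ← Complex.mul_conj, map_sum,
    sum_mul_sum, ← sum_product']
  refine sum_congr rfl fun q _ => ?_
  rw [pr_sub, ee_add, ee_neg]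

def box (k s Y:ℕ) : Finset (Fin k → ℤ) :=
  Fintype.piFinset (fun j : Fin k => Icc (-((s * Y ^ (j.1 + 1):ℕ):ℤ)) ((s * Y ^ (j.1 + 1):ℕ):ℤ))

lemma sum_diff_le (k s Y:ℕ) (G : (Fin k → ℤ) → ℝ) (hG : ∀ μ, 0 ≤ G μ) :
    ∑ q ∈ tup s (Icc (1:ℤ) Y) ×ˢ tup s (Icc (1:ℤ) Y), G (vec k q.1 - vec k q.2) ≤
      J k s (Icc (1:ℤ) Y) * ∑ μ ∈ box k s Y, G μ := by
  have hvec : ∀ x ∈ tup s (Icc (1:ℤ) Y), ∀ j, 0 ≤ vec k x j ∧ vec k x j ≤ ((s * Y ^ (j.1 + 1):ℕ):ℤ) := by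
    intro x hx j
    have hx' := fun i => mem_Icc.mp (Fintype.mem_piFinset.mp hx i)
    rw [vec_apply]
    refine ⟨sum_nonneg fun i _ => pow_nonneg (by linarith [(hx' i).1]) _, ?_⟩
    refine (sum_le_card_nsmul _ _ ((Y:ℤ) ^ (j.1 + 1)) fun i _ =>
      pow_le_pow_left₀ (by linarith [(hx' i).1]) (hx' i).2 _).trans ?_
    simp
  rw [← sum_fiberwise_of_maps_to (s := tup s (Icc (1:ℤ) Y) ×ˢ tup s (Icc (1:ℤ) Y))
    (t := box k s Y) (g := fun q => vec k q.1 - vec k q.2) (f := fun q => G (vec k q.1 - vec k q.2)),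
    mul_sum]
  · refine sum_le_sum fun μ _ => ?_
    rw [sum_congr rfl (g := fun _ => G μ) (fun q hq => by rw [(mem_filter.mp hq).2]),
      sum_const, nsmul_eq_mul]
    refine mul_le_mul_of_nonneg_right ?_ (hG μ)
    have h := shift_le k (ι := Fin s) (Icc (1:ℤ) Y) (-μ)
    rw [Fintype.card_fin] at h
    refine le_trans (le_of_eq ?_) h
    congr 2
    refine filter_congr fun q _ => ?_
    constructor
    · intro h; rw [← h]; abel
    · intro h; rw [← h]; abel
  · intro q hq
    rw [mem_product] at hq
    refine Fintype.mem_piFinset.mpr fun j => mem_Icc.mpr ?_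
    have h1 := hvec q.1 hq.1 j
    have h2 := hvec q.2 hq.2 j
    simp only [Pi.sub_apply]
    constructor <;> linarith

def WW (α:ℝ) (M:ℕ) : ℝ := ∑ ν ∈ Icc (-(M:ℤ)) M, ‖∑ μ ∈ Icc (-(M:ℤ)) M, ee (α * μ * ν)‖

lemma WW_nonneg (α:ℝ) (M:ℕ) : 0 ≤ WW α M := sum_nonneg fun _ _ => norm_nonneg _

lemma real_sum_pow_le {κ : Type*} (A : Finset κ) (w : κ → ℝ) (hw : ∀ a ∈ A, 0 ≤ w a) {n : ℕ} (hn : 1 ≤ n) :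
    (∑ a ∈ A, w a) ^ n ≤ (A.card:ℝ) ^ (n - 1) * ∑ a ∈ A, w a ^ n := by
  obtain ⟨m, rfl⟩ : ∃ m, n = m + 1 := ⟨n - 1, by omega⟩
  rcases A.eq_empty_or_nonempty with rfl | hA
  · simp
  have h1 := pow_sum_div_card_le_sum_pow (s := A) (f := w) hw m
  rw [div_le_iff₀ (by have := hA.card_pos; positivity)] at h1
  rw [Nat.add_sub_cancel, mul_comm]; exact h1

lemma abs_sum_le_of_cast {κ : Type*} (V:ℝ) (A : Finset κ) (w : κ → ℂ) (h : (V:ℂ) = ∑ a ∈ A, w a) :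
    V ≤ ∑ a ∈ A, ‖w a‖ := by
  calc V ≤ |V| := le_abs_self V
    _ = ‖(V:ℂ)‖ := (Complex.norm_real V).symm
    _ ≤ _ := by rw [h]; exact norm_sum_le _ _

lemma box_sum (k s Y:ℕ) (α : Fin k → ℝ) :
    ∑ μ ∈ box k s Y, ‖∑ a ∈ Icc (1:ℤ) Y, ee (pr (fun j => α j * μ j) (pw k a))‖ ^ (2 * s) ≤
      J k s (Icc (1:ℤ) Y) * ∏ j : Fin k, WW (α j) (s * Y ^ (j.1 + 1)) := by
  set Q := tup s (Icc (1:ℤ) Y)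
  have h1 := abs_sum_le_of_cast
    (∑ μ ∈ box k s Y, ‖∑ a ∈ Icc (1:ℤ) Y, ee (pr (fun j => α j * μ j) (pw k a))‖ ^ (2 * s))
    (Q ×ˢ Q) (fun q => ∑ μ ∈ box k s Y, ee (pr (fun j => α j * μ j) (vec k q.1 - vec k q.2))) (by
      rw [sum_comm]
      rw [Complex.ofReal_sum]
      refine sum_congr rfl fun μ _ => ?_
      exact pow_expand s _ _)
  refine h1.trans ?_
  refine (sum_diff_le k s Y (fun ν => ‖∑ μ ∈ box k s Y, ee (pr (fun j => α j * μ j) ν)‖)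
    (fun _ => norm_nonneg _)).trans ?_
  refine mul_le_mul_of_nonneg_left (le_of_eq ?_) (J_nonneg _ _ _)
  unfold WW
  rw [prod_univ_sum]
  refine sum_congr rfl fun ν _ => ?_
  rw [← norm_prod, prod_univ_sum]
  congr 1
  refine sum_congr rfl fun μ _ => ?_
  rw [pr, ee_sum]

theorem bilinear (k s Y:ℕ) (hs : 1 ≤ s) (α : Fin k → ℝ) :
    ‖∑ a ∈ Icc (1:ℤ) Y, ∑ b ∈ Icc (1:ℤ) Y, ee (pr α (pw k (a * b)))‖ ^ (2 * s * (2 * s)) ≤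
      (Y:ℝ) ^ ((2 * s - 1) * (2 * s)) * ((Y:ℝ) ^ (2 * s)) ^ (2 * s - 1) * J k s (Icc (1:ℤ) Y) ^ 2 *
        ∏ j : Fin k, WW (α j) (s * Y ^ (j.1 + 1)) := by
  set Q := tup s (Icc (1:ℤ) Y) with hQ
  have hQc : ((Q ×ˢ Q).card:ℝ) = (Y:ℝ) ^ (2 * s) := by
    rw [card_product, hQ, Fintype.card_piFinset]
    simp; ring
  have hpr : ∀ a b : ℤ, pr α (pw k (a * b)) = pr (fun j => α j * (pw k a j:ℝ)) (pw k b) := by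
    intro a b; unfold pr pw
    refine sum_congr rfl fun j _ => ?_
    push_cast; ring
  have hpr2 : ∀ (a:ℤ) (μ : Fin k → ℤ), pr (fun j => α j * (pw k a j:ℝ)) μ = pr (fun j => α j * μ j) (pw k a) := by
    intro a b; unfold pr
    refine sum_congr rfl fun j _ => ?_
    ring
  set V := ∑ a ∈ Icc (1:ℤ) Y, ‖∑ b ∈ Icc (1:ℤ) Y, ee (pr α (pw k (a * b)))‖ ^ (2 * s) with hV
  have hV0 : 0 ≤ V := sum_nonneg fun _ _ => by positivity
  have h1 : ‖∑ a ∈ Icc (1:ℤ) Y, ∑ b ∈ Icc (1:ℤ) Y, ee (pr α (pw k (a * b)))‖ ^ (2 * s) ≤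
      (Y:ℝ) ^ (2 * s - 1) * V := by
    have := norm_sum_pow_le (Icc (1:ℤ) Y) (fun a => ∑ b ∈ Icc (1:ℤ) Y, ee (pr α (pw k (a * b))))
      (n := 2 * s) (by omega)
    simpa using this
  have h2 : V ≤ ∑ q ∈ Q ×ˢ Q, ‖∑ a ∈ Icc (1:ℤ) Y,
      ee (pr (fun j => α j * ((vec k q.1 - vec k q.2) j:ℝ)) (pw k a))‖ := by
    refine abs_sum_le_of_cast V _ _ ?_
    rw [hV, Complex.ofReal_sum, sum_comm]
    refine sum_congr rfl fun a _ => ?_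
    simp_rw [hpr]
    rw [pow_expand]
    refine sum_congr rfl fun q _ => ?_
    rw [hpr2]
  have h3 : V ^ (2 * s) ≤ ((Y:ℝ) ^ (2 * s)) ^ (2 * s - 1) * (J k s (Icc (1:ℤ) Y) *
      (J k s (Icc (1:ℤ) Y) * ∏ j : Fin k, WW (α j) (s * Y ^ (j.1 + 1)))) := by
    refine (pow_le_pow_left₀ hV0 h2 _).trans ?_
    refine (real_sum_pow_le _ _ (fun _ _ => norm_nonneg _) (by omega)).trans ?_
    rw [hQc]
    refine mul_le_mul_of_nonneg_left ?_ (by positivity)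
    refine (sum_diff_le k s Y (fun μ => ‖∑ a ∈ Icc (1:ℤ) Y, ee (pr (fun j => α j * (μ j:ℝ)) (pw k a))‖ ^ (2 * s))
      (fun _ => by positivity)).trans ?_
    exact mul_le_mul_of_nonneg_left (box_sum k s Y α) (J_nonneg _ _ _)
  rw [pow_mul]
  calc _ ≤ ((Y:ℝ) ^ (2 * s - 1) * V) ^ (2 * s) := by gcongr
    _ = (Y:ℝ) ^ ((2 * s - 1) * (2 * s)) * V ^ (2 * s) := by rw [mul_pow, ← pow_mul]
    _ ≤ _ := mul_le_mul_of_nonneg_left h3 (by positivity)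
    _ = _ := by ring

lemma WW_triv (α:ℝ) {M : ℕ} (hM : 1 ≤ M) : WW α M ≤ 9 * (M:ℝ) ^ 2 := by
  have hc : ((Icc (-(M:ℤ)) M).card:ℝ) ≤ 3 * M := by
    rw [Int.card_Icc]
    have : ((M:ℤ) + 1 - -(M:ℤ)).toNat = 2 * M + 1 := by omega
    rw [this]
    push_cast
    have : (1:ℝ) ≤ M := by exact_mod_cast hM
    linarith
  unfold WW
  calc _ ≤ ∑ ν ∈ Icc (-(M:ℤ)) M, (3 * M:ℝ) := by
        refine sum_le_sum fun ν _ => (norm_sum_le _ _).trans ?_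
        simp only [ee_norm, sum_const, nsmul_eq_mul, mul_one]
        exact hc
    _ ≤ (3 * M) * (3 * M) := by
        rw [sum_const, nsmul_eq_mul]; gcongr
    _ = _ := by ring

lemma geom_bound (M:ℕ) {θ : ℝ} (h0 : θ ≠ 0) (h1 : |θ| ≤ 1 / 2) :
    ‖∑ μ ∈ Icc (-(M:ℤ)) M, ee (θ * μ)‖ ≤ 1 / (2 * |θ|) := by
  have hsub : (1 - ee θ) * ∑ μ ∈ Icc (-(M:ℤ)) M, ee (θ * μ) = ee (θ * (-(M:ℤ):ℤ)) - ee (θ * ((M + 1:ℤ):ℤ)) := by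
    induction M with
    | zero =>
      rw [show Icc (-((0:ℕ):ℤ)) ((0:ℕ):ℤ) = {0} from rfl]
      simp [ee_zero]
    | succ n ih =>
      have : Icc (-((n + 1:ℕ):ℤ)) ((n + 1:ℕ):ℤ) =
          insert (-((n:ℤ) + 1)) (insert ((n:ℤ) + 1) (Icc (-(n:ℤ)) n)) := by
        ext x; simp only [mem_Icc, mem_insert]; push_cast; omega
      rw [this, sum_insert (by simp only [mem_insert, mem_Icc]; omega),
        sum_insert (by simp only [mem_Icc]; omega), mul_add, mul_add, ih]
      have e1 : ee θ * ee (θ * ((-((n:ℤ) + 1):ℤ):ℝ)) = ee (θ * ((-(n:ℤ):ℤ):ℝ)) := by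
        rw [← ee_add]; congr 1; push_cast; ring
      have e2 : ee θ * ee (θ * ((((n:ℤ) + 1):ℤ):ℝ)) = ee (θ * (((((n + 1:ℕ):ℤ) + 1:ℤ)):ℝ)) := by
        rw [← ee_add]; congr 1; push_cast; ring
      rw [sub_mul, sub_mul, e1, e2]
      push_cast; ring
  have hlow : 4 * |θ| ≤ ‖1 - ee θ‖ := by
    have e : ‖1 - ee θ‖ = 2 * |Real.sin (Real.pi * θ)| := by
      rw [norm_sub_rev]
      unfold ee
      have := Complex.norm_exp_I_mul_ofReal_sub_one (2 * Real.pi * θ)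
      rw [mul_comm Complex.I] at this
      rw [this, Real.norm_eq_abs, abs_mul, abs_two]
      congr 3; ring
    rw [e]
    have h2 : |Real.sin (Real.pi * θ)| = Real.sin (Real.pi * |θ|) := by
      rcases abs_cases θ with ⟨h, h'⟩ | ⟨h, h'⟩
      · rw [h, abs_of_nonneg]
        apply Real.sin_nonneg_of_nonneg_of_le_pi (by positivity)
        nlinarith [Real.pi_pos]
      · rw [h, mul_neg, Real.sin_neg, abs_of_nonpos]
        have : 0 ≤ Real.sin (Real.pi * (-θ)) := by
          apply Real.sin_nonneg_of_nonneg_of_le_pi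
          · nlinarith [Real.pi_pos]
          · nlinarith [Real.pi_pos]
        rw [mul_neg, Real.sin_neg] at this; linarith
    rw [h2]
    have := Real.mul_le_sin (x := Real.pi * |θ|) (by positivity) (by nlinarith [Real.pi_pos])
    have e3 : 2 / Real.pi * (Real.pi * |θ|) = 2 * |θ| := by field_simp
    linarith
  have h3 : ‖1 - ee θ‖ * ‖∑ μ ∈ Icc (-(M:ℤ)) M, ee (θ * μ)‖ ≤ 2 := by
    rw [← norm_mul, hsub]
    refine (norm_sub_le _ _).trans ?_
    rw [ee_norm, ee_norm]; norm_num
  rw [le_div_iff₀ (by positivity)]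
  have h4 := mul_le_mul_of_nonneg_right hlow (norm_nonneg (∑ μ ∈ Icc (-(M:ℤ)) M, ee (θ * μ)))
  linarith

lemma WW_save {α : ℝ} {M : ℕ} (hM : 1 ≤ M) (hα : α ≠ 0) (hαM : |α| * M ≤ 1 / 2) :
    WW α M ≤ 3 * M + (1 + Real.log M) / |α| := by
  have hα' : 0 < |α| := abs_pos.mpr hα
  have hM1 : (1:ℝ) ≤ M := by exact_mod_cast hM
  have hs : Icc (-(M:ℤ)) M = insert 0 ((Icc 1 M).image (fun n : ℕ => (n:ℤ)) ∪ (Icc 1 M).image (fun n : ℕ => -(n:ℤ))) := by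
    ext x
    simp only [mem_Icc, mem_insert, mem_union, mem_image]
    constructor
    · intro h
      rcases lt_trichotomy x 0 with h1 | h1 | h1
      · right; right; exact ⟨(-x).toNat, by omega, by omega⟩
      · left; exact h1
      · right; left; exact ⟨x.toNat, by omega, by omega⟩
    · rintro (h | ⟨n, h, rfl⟩ | ⟨n, h, rfl⟩) <;> omega
  have hterm : ∀ ν : ℤ, ν ≠ 0 → |ν| ≤ M → ‖∑ μ ∈ Icc (-(M:ℤ)) M, ee (α * μ * ν)‖ ≤ 1 / (2 * |α|) * (1 / |(ν:ℝ)|) := by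
    intro ν h0 h1
    have h1' : |(ν:ℝ)| ≤ M := by exact_mod_cast h1
    have h2 := geom_bound M (θ := α * ν) (mul_ne_zero hα (by exact_mod_cast h0)) (by
      rw [abs_mul]; exact (mul_le_mul_of_nonneg_left h1' hα'.le).trans hαM)
    rw [abs_mul] at h2
    have e : ∀ μ : ℤ, α * μ * ν = α * ν * μ := fun μ => by ring
    simp_rw [e]
    refine h2.trans (le_of_eq ?_)
    rw [one_div_mul_one_div, mul_assoc]
  unfold WW
  rw [hs, sum_insert, ← hs, sum_union, sum_image, sum_image]
  · have b0 : ‖∑ μ ∈ Icc (-(M:ℤ)) M, ee (α * μ * ((0:ℤ):ℝ))‖ ≤ 3 * M := by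
      simp only [Int.cast_zero, mul_zero, ee_zero, sum_const, nsmul_eq_mul, mul_one]
      rw [Complex.norm_natCast, Int.card_Icc]
      have : ((M:ℤ) + 1 - -(M:ℤ)).toNat = 2 * M + 1 := by omega
      rw [this]; push_cast; linarith
    have hH : ∑ n ∈ Icc 1 M, 1 / (n:ℝ) ≤ 1 + Real.log M := by
      have := harmonic_le_one_add_log M
      rw [harmonic_eq_sum_Icc] at this
      push_cast at this
      simpa using this
    have b1 : ∑ n ∈ Icc 1 M, ‖∑ μ ∈ Icc (-(M:ℤ)) M, ee (α * μ * (((n:ℕ):ℤ):ℝ))‖ ≤ 1 / (2 * |α|) * (1 + Real.log M) := by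
      refine le_trans ?_ (mul_le_mul_of_nonneg_left hH (by positivity))
      rw [mul_sum]
      refine sum_le_sum fun n hn => ?_
      rw [mem_Icc] at hn
      refine (hterm n (by omega) (by rw [abs_of_nonneg (by omega)]; omega)).trans (le_of_eq ?_)
      simp
    have b2 : ∑ n ∈ Icc 1 M, ‖∑ μ ∈ Icc (-(M:ℤ)) M, ee (α * μ * ((-((n:ℕ):ℤ):ℤ):ℝ))‖ ≤ 1 / (2 * |α|) * (1 + Real.log M) := by
      refine le_trans ?_ (mul_le_mul_of_nonneg_left hH (by positivity))
      rw [mul_sum]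
      refine sum_le_sum fun n hn => ?_
      rw [mem_Icc] at hn
      refine (hterm (-(n:ℤ)) (by omega) (by rw [abs_neg, abs_of_nonneg (by omega)]; omega)).trans (le_of_eq ?_)
      simp
    have e : (1 + Real.log M) / |α| = 1 / (2 * |α|) * (1 + Real.log M) + 1 / (2 * |α|) * (1 + Real.log M) := by
      field_simp; ring
    rw [e]
    exact add_le_add b0 (add_le_add b1 b2)
  · intro a _ b _ h; simpa using h
  · intro a _ b _ h; simpa using h
  · rw [disjoint_left]
    intro x h1 h2
    simp only [mem_image, mem_Icc] at h1 h2
    obtain ⟨a, ha, rfl⟩ := h1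
    obtain ⟨b, hb, h⟩ := h2
    omega
  · simp only [mem_union, mem_image, mem_Icc, not_or, not_exists, not_and]
    exact ⟨fun a ha => by omega, fun a ha => by omega⟩

end
end VK

namespace VK
open Finset Real

noncomputable section

lemma eight_le : (8:ℝ) ≤ exp (7 / 3) := by
  have h := exp_one_gt_d9
  have : exp (7 / 3:ℝ) = exp 1 * exp 1 * exp (1 / 3) := by rw [← exp_add, ← exp_add]; norm_num
  rw [this]
  have h3 : (1:ℝ) / 3 + 1 ≤ exp (1 / 3) := add_one_le_exp _
  nlinarith

set_option maxHeartbeats 1000000 in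
lemma save_j {t L l lam : ℝ} {N n Y s j : ℕ} (ht : t = exp L) (hN : (N:ℝ) = exp l)
    (hl : 0 < l) (hlam : L = lam * l) (hlam1 : 3 / 4 ≤ lam) (hlamL : lam ^ 2 ≤ L)
    (hbig : (330 * L + 1) * exp (7 * lam) ≤ exp (L / 8))
    (hY1 : exp (3 / 8 * l) / 2 ≤ Y) (hY2 : (Y:ℝ) ≤ exp (3 / 8 * l)) (hY0 : 1 ≤ Y)
    (hj1 : 2 * lam ≤ j) (hj2 : (j:ℝ) ≤ 3 * lam) (hn1 : N ≤ n) (hn2 : n ≤ 2 * N)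
    (hs0 : 1 ≤ s) (hs1 : 2 * π * j ≤ 9 / 2 * (s:ℝ) ^ 2) (hs2 : (s:ℝ) ≤ 328 * lam ^ 2) {α : ℝ}
    (hα : |α| = t / (2 * π * j * (n:ℝ) ^ j)) :
    WW α (s * Y ^ j) ≤ 9 * ((s * Y ^ j:ℕ):ℝ) ^ 2 * exp (-(L / 8)) := by
  have hL : 0 < L := by rw [hlam]; positivity
  have hlj1 : 2 * L ≤ l * j := by
    calc 2 * L = l * (2 * lam) := by rw [hlam]; ring
      _ ≤ _ := by gcongr
  have hlj2 : l * j ≤ 3 * L := by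
    calc l * j ≤ l * (3 * lam) := by gcongr
      _ = _ := by rw [hlam]; ring
  have hj0 : (0:ℝ) < j := by linarith
  have hjn : 1 ≤ j := by exact_mod_cast hj0
  have hN0 : (0:ℝ) < N := by rw [hN]; positivity
  have hn0 : (0:ℝ) < n := lt_of_lt_of_le hN0 (by exact_mod_cast hn1)
  have ht0 : 0 < t := by rw [ht]; positivity
  have hs0r : (1:ℝ) ≤ s := by exact_mod_cast hs0
  have hα0 : 0 < |α| := by rw [hα]; positivity
  have hMpos : 1 ≤ s * Y ^ j := Nat.succ_le_of_lt (Nat.mul_pos hs0 (pow_pos hY0 j))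
  have hMr : ((s * Y ^ j:ℕ):ℝ) = s * (Y:ℝ) ^ j := by push_cast; ring
  have he1 : 1 ≤ exp (7 * lam) := one_le_exp (by positivity)
  have hT1 : 330 * L + 1 ≤ exp (L / 8) := (le_mul_of_one_le_right (by positivity) he1).trans hbig
  have hT2 : exp (7 * lam) ≤ exp (L / 8) := (le_mul_of_one_le_left (by positivity) (by linarith)).trans hbig
  have h8 : (8:ℝ) ^ j ≤ exp (7 * lam) := by
    have h2 := eight_le
    calc (8:ℝ) ^ j ≤ (exp (7 / 3)) ^ j := by gcongr
      _ = exp (j * (7 / 3)) := by rw [← exp_nat_mul]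
      _ ≤ _ := exp_le_exp.mpr (by linarith)
  have hYj : (Y:ℝ) ^ j ≤ exp (3 / 8 * l * j) := by
    calc (Y:ℝ) ^ j ≤ (exp (3 / 8 * l)) ^ j := by gcongr
      _ = _ := by rw [← exp_nat_mul]; congr 1; ring
  have hYj2 : exp (3 / 8 * l * j) ≤ 2 ^ j * (Y:ℝ) ^ j := by
    calc exp (3 / 8 * l * j) = (exp (3 / 8 * l)) ^ j := by rw [← exp_nat_mul]; congr 1; ring
      _ ≤ (2 * (Y:ℝ)) ^ j := by gcongr; linarith
      _ = _ := mul_pow _ _ _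
  have hnj1 : exp (l * j) ≤ (n:ℝ) ^ j := by
    calc exp (l * j) = (N:ℝ) ^ j := by rw [hN, ← exp_nat_mul]; congr 1; ring
      _ ≤ _ := by gcongr
  have hnj2 : (n:ℝ) ^ j ≤ 2 ^ j * exp (l * j) := by
    calc (n:ℝ) ^ j ≤ (2 * (N:ℝ)) ^ j := by gcongr; exact_mod_cast hn2
      _ = _ := by rw [mul_pow, hN, ← exp_nat_mul]; congr 2; ring
  -- condition (i)
  have hc1 : |α| * ((s * Y ^ j:ℕ):ℝ) ≤ 1 / 2 := by
    rw [hα, hMr, div_mul_eq_mul_div, div_le_iff₀ (by positivity)]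
    have hpi : 1 ≤ π * j := by
      have : (1:ℝ) ≤ j := by exact_mod_cast hjn
      exact one_le_mul_of_one_le_of_one_le (by linarith [pi_gt_three]) this
    calc t * (s * (Y:ℝ) ^ j) ≤ exp L * (exp (L / 8) * exp (3 / 8 * l * j)) := by
          rw [ht]; gcongr; linarith
      _ = exp (L + (L / 8 + 3 / 8 * l * j)) := by rw [exp_add, exp_add]
      _ ≤ exp (l * j) := exp_le_exp.mpr (by linarith)
      _ ≤ (n:ℝ) ^ j := hnj1
      _ ≤ (π * j) * (n:ℝ) ^ j := le_mul_of_one_le_left (by positivity) hpi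
      _ = _ := by ring
  refine (WW_save hMpos (abs_pos.mp hα0) hc1).trans ?_
  set M : ℝ := ((s * Y ^ j:ℕ):ℝ) with hM
  have hM1 : 1 ≤ M := by rw [hM]; exact_mod_cast hMpos
  have hYM : (Y:ℝ) ^ j ≤ M := by rw [hMr]; exact le_mul_of_one_le_left (by positivity) hs0r
  have hE : exp (-(L / 8)) * exp (L / 8) = 1 := by rw [← exp_add]; simp
  have p1 : 3 * M ≤ 9 / 2 * M ^ 2 * exp (-(L / 8)) := by
    have h2 : exp (L / 8) ≤ M := by
      have h28 : (2:ℝ) ^ j ≤ exp (L / 8) :=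
        (pow_le_pow_left₀ (by norm_num) (by norm_num : (2:ℝ) ≤ 8) j).trans (h8.trans hT2)
      have : exp (L / 8) * exp (L / 8) ≤ exp (L / 8) * M := by
        calc exp (L / 8) * exp (L / 8) = exp (L / 8 + L / 8) := by rw [exp_add]
          _ ≤ exp (3 / 8 * l * j) := exp_le_exp.mpr (by linarith)
          _ ≤ 2 ^ j * (Y:ℝ) ^ j := hYj2
          _ ≤ _ := by gcongr
      exact le_of_mul_le_mul_left this (by positivity)
    calc 3 * M = 3 * M * (exp (-(L / 8)) * exp (L / 8)) := by rw [hE, mul_one]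
      _ ≤ 3 * M * (exp (-(L / 8)) * M) := by gcongr
      _ ≤ _ := by
        have : 0 ≤ M ^ 2 * exp (-(L / 8)) := by positivity
        have e : 3 * M * (exp (-(L / 8)) * M) = 3 * (M ^ 2 * exp (-(L / 8))) := by ring
        rw [e]; linarith
  have hlogM : 1 + log M ≤ 330 * L + 1 := by
    have : log M ≤ 328 * L + 2 * L := by
      rw [hMr, log_mul (by positivity) (by positivity)]
      have a1 : log (s:ℝ) ≤ 328 * L := (log_le_self (by positivity)).trans (by linarith)
      have a2 : log ((Y:ℝ) ^ j) ≤ 2 * L := by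
        calc log ((Y:ℝ) ^ j) ≤ log (exp (3 / 8 * l * j)) := log_le_log (by positivity) hYj
          _ = 3 / 8 * l * j := log_exp _
          _ ≤ _ := by linarith
      linarith
    linarith
  have p2 : (1 + log M) / |α| ≤ 9 / 2 * M ^ 2 * exp (-(L / 8)) := by
    rw [hα, div_div_eq_mul_div, div_le_iff₀ ht0]
    have key : (1 + log M) * 8 ^ j ≤ exp (L / 8) :=
      (mul_le_mul hlogM h8 (by positivity) (by linarith)).trans hbig
    have hM2 : M ^ 2 = (s:ℝ) ^ 2 * ((Y:ℝ) ^ j) ^ 2 := by rw [hMr, mul_pow]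
    have e4 : exp (3 / 4 * l * j) ≤ 4 ^ j * ((Y:ℝ) ^ j) ^ 2 := by
      calc exp (3 / 4 * l * j) = (exp (3 / 8 * l * j)) ^ 2 := by rw [← exp_nat_mul]; congr 1; push_cast; ring
        _ ≤ (2 ^ j * (Y:ℝ) ^ j) ^ 2 := by gcongr
        _ = _ := by rw [mul_pow, ← pow_mul, mul_comm j 2, pow_mul]; norm_num
    have h84 : (8:ℝ) ^ j = 2 ^ j * 4 ^ j := by rw [← mul_pow]; norm_num
    have e5 : (n:ℝ) ^ j ≤ 8 ^ j * (exp (3 / 4 * L) * ((Y:ℝ) ^ j) ^ 2) := by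
      calc (n:ℝ) ^ j ≤ 2 ^ j * exp (l * j) := hnj2
        _ = 2 ^ j * (exp (1 / 4 * l * j) * exp (3 / 4 * l * j)) := by rw [← exp_add]; congr 2; ring
        _ ≤ 2 ^ j * (exp (3 / 4 * L) * (4 ^ j * ((Y:ℝ) ^ j) ^ 2)) := by
          exact mul_le_mul_of_nonneg_left (mul_le_mul (exp_le_exp.mpr (by linarith)) e4 (by positivity) (by positivity)) (by positivity)
        _ = _ := by rw [h84]; ring
    calc (1 + log M) * (2 * π * j * (n:ℝ) ^ j)
        ≤ (1 + log M) * (9 / 2 * (s:ℝ) ^ 2 * (8 ^ j * (exp (3 / 4 * L) * ((Y:ℝ) ^ j) ^ 2))) := by gcongr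
      _ = ((1 + log M) * 8 ^ j) * (9 / 2 * M ^ 2 * exp (3 / 4 * L)) := by rw [hM2]; ring
      _ ≤ exp (L / 8) * (9 / 2 * M ^ 2 * exp (3 / 4 * L)) := by gcongr
      _ = 9 / 2 * M ^ 2 * exp (-(L / 8)) * t := by
          rw [ht]
          have : exp (L / 8) * exp (3 / 4 * L) = exp (-(L / 8)) * exp L := by
            rw [← exp_add, ← exp_add]; congr 1; ring
          linear_combination 9 / 2 * M ^ 2 * this
  linarith

end
end VK

namespace VK
open Finset Real

noncomputable section

lemma prod_WW {k s Y : ℕ} (hs : 1 ≤ s) (hY : 1 ≤ Y) (α : Fin k → ℝ) (I : Finset (Fin k)) (δ:ℝ)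
    (hI : ∀ i ∈ I, WW (α i) (s * Y ^ (i.1 + 1)) ≤ 9 * ((s * Y ^ (i.1 + 1):ℕ):ℝ) ^ 2 * δ) :
    ∏ i : Fin k, WW (α i) (s * Y ^ (i.1 + 1)) ≤ (9 * (s:ℝ) ^ 2) ^ k * (Y:ℝ) ^ (k * (k + 1)) * δ ^ I.card := by
  classical
  have h1 : ∏ i : Fin k, WW (α i) (s * Y ^ (i.1 + 1)) ≤
      ∏ i : Fin k, ((9 * ((s * Y ^ (i.1 + 1):ℕ):ℝ) ^ 2) * (if i ∈ I then δ else 1)) := by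
    refine prod_le_prod (fun i _ => WW_nonneg _ _) fun i _ => ?_
    split_ifs with h
    · exact hI i h
    · rw [mul_one]; exact WW_triv _ (Nat.succ_le_of_lt (Nat.mul_pos hs (pow_pos hY _)))
  refine h1.trans (le_of_eq ?_)
  rw [prod_mul_distrib, prod_ite_mem, univ_inter, prod_const]
  congr 1
  have h2 : ∀ i : Fin k, (9 * ((s * Y ^ (i.1 + 1):ℕ):ℝ) ^ 2) = (9 * (s:ℝ) ^ 2) * (Y:ℝ) ^ (2 * (i.1 + 1)) := by
    intro i; push_cast; rw [mul_pow, ← pow_mul, mul_comm 2]; ring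
  simp_rw [h2]
  rw [prod_mul_distrib, prod_const, card_univ, Fintype.card_fin, prod_pow_eq_pow_sum]
  congr 2
  rw [Fin.sum_univ_eq_sum_range (fun i => 2 * (i + 1)) k]
  clear * -
  induction k with
  | zero => simp
  | succ n ih => rw [sum_range_succ, ih]; ring

/-- log form of the main inequality -/
lemma T_log {k Y : ℕ} (hk : 2 ≤ k) (hY : 1 ≤ Y) (α : Fin k → ℝ) (I : Finset (Fin k)) (L:ℝ)
    (hI : ∀ i ∈ I, WW (α i) (8 * k ^ 2 * Y ^ (i.1 + 1)) ≤ 9 * ((8 * k ^ 2 * Y ^ (i.1 + 1):ℕ):ℝ) ^ 2 * exp (-(L / 8)))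
    (hT : 0 < ‖∑ a ∈ Icc (1:ℤ) Y, ∑ b ∈ Icc (1:ℤ) Y, ee (pr α (pw k (a * b)))‖) :
    256 * (k:ℝ) ^ 4 * log ‖∑ a ∈ Icc (1:ℤ) Y, ∑ b ∈ Icc (1:ℤ) Y, ee (pr α (pw k (a * b)))‖ ≤
      256 * (k:ℝ) ^ 4 * (2 * log Y) + 2 * (k:ℝ) ^ 2 * exp (-7) * log Y + 7218 * (k:ℝ) ^ 4 - L / 8 * I.card := by
  have hb := bilinear k (8 * k ^ 2) Y (by nlinarith) α
  have hv := vmvt 7 k hk Y hY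
  have hp := prod_WW (s := 8 * k ^ 2) (by nlinarith) hY α I _ hI
  rw [show (1 + 7) * k ^ 2 = 8 * k ^ 2 by norm_num] at hv
  generalize ‖∑ a ∈ Icc (1:ℤ) Y, ∑ b ∈ Icc (1:ℤ) Y, ee (pr α (pw k (a * b)))‖ = A at hb hT ⊢
  have hk0 : (2:ℝ) ≤ k := by exact_mod_cast hk
  have hk0' : (0:ℝ) < k := by linarith
  have hY1 : (1:ℝ) ≤ Y := by exact_mod_cast hY
  have hY0 : (0:ℝ) < Y := by linarith
  have hPn : 0 ≤ ∏ j : Fin k, WW (α j) (8 * k ^ 2 * Y ^ (j.1 + 1)) := prod_nonneg fun _ _ => WW_nonneg _ _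
  have hA := hb.trans (mul_le_mul (mul_le_mul_of_nonneg_left (pow_le_pow_left₀ (J_nonneg _ _ _) hv 2) (by positivity)) hp hPn (by positivity))
  clear hb hv hp hPn hI
  have hA' := log_le_log (by positivity) hA
  rw [log_mul (by positivity) (by positivity), log_mul (by positivity) (by positivity), log_mul (by positivity) (by positivity),
    log_mul (by positivity) (by positivity), log_mul (by positivity) (by positivity), log_pow, log_pow, log_pow, log_pow, log_pow,
    log_mul (by positivity) (by positivity), log_mul (by positivity) (by positivity), log_pow, log_pow, log_rpow hY0, log_pow,
    log_pow, log_pow, log_exp] at hA'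
  clear hA
  have hk2 : 0 < k ^ 2 := by positivity
  obtain ⟨m, hm⟩ : ∃ m, 2 * (8 * k ^ 2) = m + 1 := ⟨2 * (8 * k ^ 2) - 1, by omega⟩
  have hmr : (m:ℝ) = 16 * (k:ℝ) ^ 2 - 1 := by
    have : ((2 * (8 * k ^ 2):ℕ):ℝ) = m + 1 := by exact_mod_cast hm
    push_cast at this; linarith
  rw [hm, Nat.add_sub_cancel] at hA'
  push_cast at hA'
  rw [hmr] at hA'
  have l1 : log (k:ℝ) ≤ k := log_le_self (by positivity)
  have l2 : log (2 * (8 * (k:ℝ) ^ 2)) ≤ 8 * k := by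
    rw [show 2 * (8 * (k:ℝ) ^ 2) = (4 * k) ^ 2 by ring, log_pow]
    have := log_le_self (x := 4 * (k:ℝ)) (by positivity)
    push_cast; linarith
  have l3 : log (9 * (8 * (k:ℝ) ^ 2) ^ 2) ≤ 48 * k ^ 2 := by
    rw [show 9 * (8 * (k:ℝ) ^ 2) ^ 2 = (24 * k ^ 2) ^ 2 by ring, log_pow]
    have := log_le_self (x := 24 * (k:ℝ) ^ 2) (by positivity)
    push_cast; linarith
  have m1 := mul_le_mul_of_nonneg_left l1 (show 0 ≤ (k:ℝ) ^ 3 by positivity)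
  have m2 := mul_le_mul_of_nonneg_left l2 (show 0 ≤ 8 * (8 * (k:ℝ) ^ 2) * (7 * k) by positivity)
  have m3 := mul_le_mul_of_nonneg_left l3 (show 0 ≤ (k:ℝ) by positivity)
  have m4 : (k:ℝ) ^ 3 ≤ k ^ 4 := pow_le_pow_right₀ (by linarith) (by norm_num)
  ring_nf at hA' m1 m2 m3 ⊢
  linarith

end
end VK

namespace VK
open Finset Real

noncomputable section

lemma card_I {lam : ℝ} (h : 3 / 4 ≤ lam) {k : ℕ} (hk : 5 * lam ≤ k) :
    lam / 2 ≤ ((univ.filter fun i : Fin k => 2 * lam ≤ (i.1 + 1:ℕ) ∧ ((i.1 + 1:ℕ):ℝ) ≤ 3 * lam).card:ℝ) := by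
  set I := univ.filter fun i : Fin k => 2 * lam ≤ (i.1 + 1:ℕ) ∧ ((i.1 + 1:ℕ):ℝ) ≤ 3 * lam with hI
  have h1 : Icc ⌈2 * lam⌉₊ ⌊3 * lam⌋₊ ⊆ I.image (fun i => i.1 + 1) := by
    intro j hj
    rw [mem_Icc] at hj
    have a1 : 2 * lam ≤ j := (Nat.le_ceil _).trans (by exact_mod_cast hj.1)
    have a2 : (j:ℝ) ≤ 3 * lam := (by exact_mod_cast hj.2 : (j:ℝ) ≤ (⌊3 * lam⌋₊:ℕ)).trans (Nat.floor_le (by linarith))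
    have a3 : 0 < j := by
      have : (0:ℝ) < j := by linarith
      exact_mod_cast this
    have a4 : j < k + 1 := by
      have : (j:ℝ) < k + 1 := by linarith
      exact_mod_cast this
    have a5 : j - 1 + 1 = j := by omega
    refine mem_image.mpr ⟨⟨j - 1, by omega⟩, ?_, a5⟩
    simp only [hI, mem_filter, mem_univ, true_and, a5]
    exact ⟨a1, a2⟩
  have h2 := (card_le_card h1).trans card_image_le
  rw [Nat.card_Icc] at h2
  have b1 : (⌈2 * lam⌉₊:ℝ) < 2 * lam + 1 := Nat.ceil_lt_add_one (by linarith)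
  have b2 : 3 * lam < (⌊3 * lam⌋₊:ℝ) + 1 := Nat.lt_floor_add_one _
  have h3 : (⌊3 * lam⌋₊:ℝ) + 1 ≤ I.card + ⌈2 * lam⌉₊ := by
    have : ⌊3 * lam⌋₊ + 1 ≤ I.card + ⌈2 * lam⌉₊ := by omega
    exact_mod_cast this
  have h4 : 1 ≤ I.card := by
    have : ⌈2 * lam⌉₊ ≤ ⌊3 * lam⌋₊ := by
      by_cases hl : 1 ≤ lam
      · have : (⌈2 * lam⌉₊:ℝ) < (⌊3 * lam⌋₊ + 1:ℕ) := by push_cast; linarith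
        have : ⌈2 * lam⌉₊ < ⌊3 * lam⌋₊ + 1 := by exact_mod_cast this
        omega
      · push Not at hl
        have c1 : ⌈2 * lam⌉₊ ≤ 2 := Nat.ceil_le.mpr (by push_cast; linarith)
        have c2 : 2 ≤ ⌊3 * lam⌋₊ := Nat.le_floor (by push_cast; linarith)
        omega
    omega
  have h5 : (1:ℝ) ≤ I.card := by exact_mod_cast h4
  linarith

lemma e7 : exp (-7) ≤ 1 / 1000 := by
  rw [exp_neg, ← one_div]
  apply one_div_le_one_div_of_le (by norm_num)
  have h : (2.71828:ℝ) ≤ exp 1 := by linarith [exp_one_gt_d9]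
  calc (1000:ℝ) ≤ 2.71828 ^ 7 := by norm_num
    _ ≤ exp 1 ^ 7 := by gcongr
    _ = exp 7 := by rw [← exp_nat_mul]; norm_num

lemma T_bound {t L l lam : ℝ} {N n : ℕ} (ht : t = exp L) (hN : (N:ℝ) = exp l)
    (hl : 0 < l) (hlam : L = lam * l) (hlam1 : 3 / 4 ≤ lam) (hlamL : lam ^ 2 ≤ L)
    (hbig : (330 * L + 1) * exp (7 * lam) ≤ exp (L / 8))
    (hn1 : N ≤ n) (hn2 : n ≤ 2 * N) {Y k : ℕ} (hY : Y = ⌊exp (3 / 8 * l)⌋₊) (hk : k = ⌈5 * lam⌉₊) (α : Fin k → ℝ)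
    (hα : ∀ i, |α i| = t / (2 * π * ((i.1 + 1:ℕ):ℝ) * (n:ℝ) ^ (i.1 + 1))) :
    ‖∑ a ∈ Icc (1:ℤ) Y, ∑ b ∈ Icc (1:ℤ) Y, ee (pr α (pw k (a * b)))‖ ≤
      (Y:ℝ) ^ 2 * exp (29 - 1 / 10 ^ 8 * (l / lam ^ 2)) := by
  have hlam0 : 0 < lam := by linarith
  have hYe : 1 ≤ exp (3 / 8 * l) := one_le_exp (by positivity)
  have hY2 : (Y:ℝ) ≤ exp (3 / 8 * l) := by rw [hY]; exact Nat.floor_le (by positivity)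
  have hY0 : 1 ≤ Y := by rw [hY]; exact Nat.le_floor (by exact_mod_cast hYe)
  have hY0r : (1:ℝ) ≤ Y := by exact_mod_cast hY0
  have hY1 : exp (3 / 8 * l) / 2 ≤ Y := by
    have : exp (3 / 8 * l) < Y + 1 := by rw [hY]; exact Nat.lt_floor_add_one _
    linarith
  have hk1 : 5 * lam ≤ k := by rw [hk]; exact Nat.le_ceil _
  have hk2 : (k:ℝ) ≤ 19 / 3 * lam := by
    have : (k:ℝ) < 5 * lam + 1 := by rw [hk]; exact Nat.ceil_lt_add_one (by linarith)
    linarith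
  have hk4 : 4 ≤ k := by
    have : (3:ℝ) < k := by linarith
    have : 3 < k := by exact_mod_cast this
    omega
  have hk4r : (4:ℝ) ≤ k := by exact_mod_cast hk4
  have hksq : (k:ℝ) ^ 2 ≤ 361 / 9 * lam ^ 2 := by
    calc (k:ℝ) ^ 2 ≤ (19 / 3 * lam) ^ 2 := by gcongr
      _ = _ := by ring
  have hk44 : (k:ℝ) ^ 4 ≤ 1610 * lam ^ 4 := by
    calc (k:ℝ) ^ 4 = (k ^ 2) ^ 2 := by ring
      _ ≤ (361 / 9 * lam ^ 2) ^ 2 := by gcongr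
      _ = (361 / 9) ^ 2 * lam ^ 4 := by ring
      _ ≤ _ := by gcongr; norm_num
  set I := univ.filter fun i : Fin k => 2 * lam ≤ (i.1 + 1:ℕ) ∧ ((i.1 + 1:ℕ):ℝ) ≤ 3 * lam with hI
  have hIc : lam / 2 ≤ (I.card:ℝ) := card_I hlam1 hk1
  rcases (norm_nonneg (∑ a ∈ Icc (1:ℤ) Y, ∑ b ∈ Icc (1:ℤ) Y, ee (pr α (pw k (a * b))))).eq_or_lt with h0 | h0
  · rw [← h0]; positivity
  have hT := T_log (by omega : 2 ≤ k) hY0 α I L (by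
    intro i hi
    rw [hI, mem_filter] at hi
    refine save_j ht hN hl hlam hlam1 hlamL hbig hY1 hY2 hY0 hi.2.1 hi.2.2 hn1 hn2 ?_ ?_ ?_ (hα i)
    · exact Nat.succ_le_of_lt (by positivity)
    · have a1 : ((i.1 + 1:ℕ):ℝ) ≤ k := by linarith [hi.2.2]
      have a2 : (k:ℝ) ≤ k ^ 4 := le_self_pow₀ (by linarith) (by norm_num)
      have a3 : (2 * π) * ((i.1 + 1:ℕ):ℝ) ≤ 7 * k := mul_le_mul (by linarith [pi_lt_d2]) a1 (by positivity) (by norm_num)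
      have a4 : 9 / 2 * ((8 * k ^ 2:ℕ):ℝ) ^ 2 = 288 * k ^ 4 := by push_cast; ring
      rw [a4]; linarith
    · push_cast; linarith [sq_nonneg lam]) h0
  generalize ‖∑ a ∈ Icc (1:ℤ) Y, ∑ b ∈ Icc (1:ℤ) Y, ee (pr α (pw k (a * b)))‖ = A at h0 hT ⊢
  clear_value I
  have hlogY : log (Y:ℝ) ≤ 3 / 8 * l := by
    rw [← log_exp (3 / 8 * l)]; exact log_le_log (by linarith) hY2
  have e1 : 2 * (k:ℝ) ^ 2 * exp (-7) * log Y ≤ 2 * (361 / 9 * lam ^ 2) * (1 / 1000) * (3 / 8 * l) := by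
    have := e7
    gcongr
  have e2 : lam ^ 2 * l / 16 ≤ L / 8 * I.card := by
    calc lam ^ 2 * l / 16 = L / 8 * (lam / 2) := by rw [hlam]; ring
      _ ≤ _ := by
        have : 0 ≤ L / 8 := by rw [hlam]; positivity
        gcongr
  have hl2 : 0 < lam ^ 2 * l := by positivity
  have e4 : 256 * (k:ℝ) ^ 4 * (1 / 10 ^ 8 * (l / lam ^ 2)) ≤ lam ^ 2 * l / 32 := by
    calc 256 * (k:ℝ) ^ 4 * (1 / 10 ^ 8 * (l / lam ^ 2)) ≤ 256 * (1610 * lam ^ 4) * (1 / 10 ^ 8 * (l / lam ^ 2)) := by gcongr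
      _ = 256 * 1610 / 10 ^ 8 * (lam ^ 2 * l) := by field_simp
      _ ≤ _ := by linarith
  have e5 : log A ≤ 2 * log Y + (29 - 1 / 10 ^ 8 * (l / lam ^ 2)) := by
    have hkp : 0 < 256 * (k:ℝ) ^ 4 := by positivity
    have : 256 * (k:ℝ) ^ 4 * (log A - 2 * log Y - 29) ≤ 256 * (k:ℝ) ^ 4 * (- (1 / 10 ^ 8 * (l / lam ^ 2))) := by
      rw [mul_neg]; linarith
    have := le_of_mul_le_mul_left this hkp
    linarith
  calc A = exp (log A) := (exp_log h0).symm
    _ ≤ exp (2 * log Y + (29 - 1 / 10 ^ 8 * (l / lam ^ 2))) := exp_le_exp.mpr e5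
    _ = _ := by
      rw [exp_add, two_mul, exp_add, exp_log (by linarith), ← sq]

end
end VK

namespace VK
open Finset Real

noncomputable section

lemma ee_sub_le (x y:ℝ) : ‖ee x - ee y‖ ≤ 2 * π * |x - y| := by
  have h : ee x - ee y = ee y * (Complex.exp (Complex.I * ((2 * π * (x - y):ℝ):ℂ)) - 1) := by
    have : ee x = ee y * ee (x - y) := by rw [← ee_add]; congr 1; ring
    rw [this]; unfold ee
    rw [mul_comm Complex.I]; ring
  rw [h, norm_mul, ee_norm, one_mul]
  refine (Real.norm_exp_I_mul_ofReal_sub_one_le).trans (le_of_eq ?_)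
  rw [Real.norm_eq_abs, abs_mul, abs_of_pos two_pi_pos]

lemma shift_sum (g : ℕ → ℂ) (hg : ∀ n, ‖g n‖ ≤ 1) (N N1 h:ℕ) :
    ‖∑ n ∈ Ioc N N1, g n - ∑ n ∈ Ioc N N1, g (n + h)‖ ≤ 2 * h := by
  induction h with
  | zero => simp
  | succ h ih =>
    rcases lt_or_ge N N1 with hN | hN
    swap
    · rw [Ioc_eq_empty (by omega)]; simp; positivity
    have e : ∑ n ∈ Ioc N N1, g (n + h) - ∑ n ∈ Ioc N N1, g (n + (h + 1)) = g (N + 1 + h) - g (N1 + (h + 1)) := by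
      obtain ⟨m, rfl⟩ : ∃ m, N1 = N + 1 + m := ⟨N1 - N - 1, by omega⟩
      clear hN ih
      induction m with
      | zero => simp [Nat.Ioc_succ_singleton]
      | succ m ihm =>
        rw [← add_assoc, sum_Ioc_succ_top (by omega), sum_Ioc_succ_top (by omega), add_sub_add_comm, ihm]
        rw [show N + 1 + m + (h + 1) = N + 1 + m + 1 + h by ring]; ring
    calc ‖∑ n ∈ Ioc N N1, g n - ∑ n ∈ Ioc N N1, g (n + (h + 1))‖
        = ‖(∑ n ∈ Ioc N N1, g n - ∑ n ∈ Ioc N N1, g (n + h)) + (g (N + 1 + h) - g (N1 + (h + 1)))‖ := by rw [← e]; congr 1; ring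
      _ ≤ 2 * h + (1 + 1) := (norm_add_le _ _).trans (add_le_add ih ((norm_sub_le _ _).trans (add_le_add (hg _) (hg _))))
      _ = _ := by push_cast; ring

def ff (t:ℝ) (n:ℕ) : ℂ := ee (-(t / (2 * π)) * log n)

lemma taylor {t L l lam : ℝ} {N n : ℕ} (ht : t = exp L) (hN : (N:ℝ) = exp l)
    (hl : 0 < l) (hlam : L = lam * l) (hlam1 : 3 / 4 ≤ lam) (hN16 : 16 ≤ N)
    (hn1 : N ≤ n) {Y k : ℕ} (hY2 : (Y:ℝ) ≤ exp (3 / 8 * l)) (hk1 : 5 * lam ≤ k)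
    {a b : ℕ} (ha : a ≤ Y) (hb : b ≤ Y) :
    ‖ff t (n + a * b) - ff t n * ee (pr (fun i : Fin k => (t / (2 * π)) * (-1) ^ (i.1 + 1) / (((i.1 + 1:ℕ):ℝ) * (n:ℝ) ^ (i.1 + 1))) (pw k ((a:ℤ) * b)))‖
      ≤ 2 * exp (- (L / 4)) := by
  have hN0 : (0:ℝ) < N := by rw [hN]; positivity
  have hnr : (N:ℝ) ≤ n := by exact_mod_cast hn1
  have hn0 : (0:ℝ) < n := by linarith
  have ht0 : 0 < t := by rw [ht]; positivity
  set x : ℝ := (a:ℝ) * b / n with hx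
  have hx0 : 0 ≤ x := by positivity
  have hx1 : x ≤ exp (-(l / 4)) := by
    rw [hx, div_le_iff₀ hn0]
    calc (a:ℝ) * b ≤ exp (3 / 8 * l) * exp (3 / 8 * l) := by
          gcongr <;> refine le_trans ?_ hY2 <;> exact_mod_cast ‹_›
      _ = exp (-(l / 4)) * N := by rw [hN, ← exp_add, ← exp_add]; congr 1; ring
      _ ≤ _ := by gcongr
  have hx2 : x ≤ 1 / 2 := by
    refine hx1.trans ?_
    have h16 : log 16 ≤ l := by
      rw [← log_exp l, ← hN]; exact log_le_log (by norm_num) (by exact_mod_cast hN16)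
    have : log 16 = 4 * log 2 := by rw [show (16:ℝ) = 2 ^ 4 by norm_num, log_pow]; norm_num
    calc exp (-(l / 4)) ≤ exp (-log 2) := exp_le_exp.mpr (by linarith)
      _ = 1 / 2 := by rw [exp_neg, exp_log (by norm_num)]; norm_num
  have hlog : log ((n + a * b:ℕ):ℝ) = log n + log (1 + x) := by
    rw [← log_mul (by positivity) (by positivity)]; congr 1; rw [hx]; push_cast; field_simp
  have hf : ff t (n + a * b) = ff t n * ee (-(t / (2 * π)) * log (1 + x)) := by
    unfold ff; rw [← ee_add, hlog]; congr 1; ring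
  rw [hf, ← mul_sub, norm_mul]
  have : ‖ff t n‖ = 1 := ee_norm _
  rw [this, one_mul]
  refine (ee_sub_le _ _).trans ?_
  have hpr : pr (fun i : Fin k => (t / (2 * π)) * (-1) ^ (i.1 + 1) / (((i.1 + 1:ℕ):ℝ) * (n:ℝ) ^ (i.1 + 1))) (pw k ((a:ℤ) * b)) =
      (t / (2 * π)) * ∑ i ∈ range k, (-x) ^ (i + 1) / (i + 1) := by
    unfold pr pw
    rw [← Fin.sum_univ_eq_sum_range (fun i => (-x) ^ (i + 1) / ((i:ℝ) + 1)) k, mul_sum]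
    refine sum_congr rfl fun i _ => ?_
    rw [hx, neg_pow]; push_cast; rw [div_pow]; field_simp
  have hT := Real.abs_log_sub_add_sum_range_le (x := -x) (by rw [abs_neg, abs_of_nonneg hx0]; linarith) k
  rw [sub_neg_eq_add, abs_neg, abs_of_nonneg hx0] at hT
  rw [hpr, show -(t / (2 * π)) * log (1 + x) - t / (2 * π) * ∑ i ∈ range k, (-x) ^ (i + 1) / (i + 1) =
    -((t / (2 * π)) * (∑ i ∈ range k, (-x) ^ (i + 1) / (i + 1) + log (1 + x))) by ring, abs_neg, abs_mul,
    abs_of_pos (by positivity), ← mul_assoc, show 2 * π * (t / (2 * π)) = t by field_simp]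
  have hT2 : x ^ (k + 1) / (1 - x) ≤ 2 * exp (-(5 / 4 * L)) := by
    rw [div_le_iff₀ (by linarith)]
    have h1 : x ^ (k + 1) ≤ exp (-(5 / 4 * L)) := by
      calc x ^ (k + 1) ≤ x ^ k := pow_le_pow_of_le_one hx0 (by linarith) (by omega)
        _ ≤ exp (-(l / 4)) ^ k := by gcongr
        _ = exp (- (l / 4 * k)) := by rw [← exp_nat_mul]; congr 1; ring
        _ ≤ _ := exp_le_exp.mpr (by
          have : l / 4 * (5 * lam) ≤ l / 4 * k := by gcongr
          rw [hlam]; linarith)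
    have h2 : exp (-(5 / 4 * L)) * 1 ≤ exp (-(5 / 4 * L)) * (2 * (1 - x)) := by gcongr; linarith
    linarith
  calc t * _ ≤ t * (2 * exp (-(5 / 4 * L))) := by gcongr; exact hT.trans hT2
    _ = 2 * (exp L * exp (-(5 / 4 * L))) := by rw [ht]; ring
    _ = _ := by rw [← exp_add]; congr 2; ring

lemma sum_cast (Y:ℕ) (g : ℤ → ℂ) : ∑ a ∈ Icc (1:ℤ) Y, g a = ∑ a ∈ Icc 1 Y, g (a:ℤ) := by
  refine (sum_bij (fun (a:ℕ) _ => (a:ℤ)) ?_ ?_ ?_ ?_).symm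
  · intro a ha; rw [mem_Icc] at *; omega
  · intro a _ b _ h; exact_mod_cast h
  · intro b hb; rw [mem_Icc] at hb
    exact ⟨b.toNat, by rw [mem_Icc]; omega, by omega⟩
  · intros; rfl

theorem exp_sum {t L l lam : ℝ} {N N1 : ℕ} (ht : t = exp L) (hN : (N:ℝ) = exp l)
    (hl : 0 < l) (hlam : L = lam * l) (hlam1 : 3 / 4 ≤ lam) (hlamL : lam ^ 2 ≤ L)
    (hbig : (330 * L + 1) * exp (7 * lam) ≤ exp (L / 8)) (hN16 : 16 ≤ N) (hN1 : N1 ≤ 2 * N) :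
    ‖∑ n ∈ Ioc N N1, ff t n‖ ≤ N * exp (30 - 1 / 10 ^ 8 * (l / lam ^ 2)) := by
  obtain ⟨Y, hY⟩ : ∃ Y, Y = ⌊exp (3 / 8 * l)⌋₊ := ⟨_, rfl⟩
  obtain ⟨k, hk⟩ : ∃ k, k = ⌈5 * lam⌉₊ := ⟨_, rfl⟩
  have hYe : 1 ≤ exp (3 / 8 * l) := one_le_exp (by positivity)
  have hY2 : (Y:ℝ) ≤ exp (3 / 8 * l) := by rw [hY]; exact Nat.floor_le (by positivity)
  have hY0 : 1 ≤ Y := by rw [hY]; exact Nat.le_floor (by exact_mod_cast hYe)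
  have hk1 : 5 * lam ≤ k := by rw [hk]; exact Nat.le_ceil _
  have ht0 : 0 < t := by rw [ht]; positivity
  set δ := 1 / 10 ^ 8 * (l / lam ^ 2) with hδ
  set S := ∑ n ∈ Ioc N N1, ff t n with hS
  -- inner bound
  have hin : ∀ n ∈ Ioc N N1, ‖∑ a ∈ Icc 1 Y, ∑ b ∈ Icc 1 Y, ff t (n + a * b)‖ ≤
      (Y:ℝ) ^ 2 * (exp (29 - δ) + 2 * exp (-(L / 4))) := by
    intro n hn
    rw [mem_Ioc] at hn
    have hn0 : (0:ℝ) < n := by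
      have : 0 < n := by omega
      exact_mod_cast this
    set α : Fin k → ℝ := fun i : Fin k => (t / (2 * π)) * (-1) ^ (i.1 + 1) / (((i.1 + 1:ℕ):ℝ) * (n:ℝ) ^ (i.1 + 1)) with hα
    have hb := T_bound ht hN hl hlam hlam1 hlamL hbig (by omega : N ≤ n) (by omega) hY hk α (by
      intro i
      rw [hα]
      simp only
      rw [abs_div, abs_mul, abs_pow, abs_neg, abs_one, one_pow, mul_one, abs_of_pos (by positivity), abs_of_pos (by positivity), div_div]
      congr 1; ring)
    rw [sum_cast] at hb
    simp_rw [sum_cast] at hb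
    have hsplit : ∑ a ∈ Icc 1 Y, ∑ b ∈ Icc 1 Y, ff t (n + a * b) =
        ff t n * (∑ a ∈ Icc 1 Y, ∑ b ∈ Icc 1 Y, ee (pr α (pw k ((a:ℤ) * b)))) +
        ∑ a ∈ Icc 1 Y, ∑ b ∈ Icc 1 Y, (ff t (n + a * b) - ff t n * ee (pr α (pw k ((a:ℤ) * b)))) := by
      rw [mul_sum, ← sum_add_distrib]
      refine sum_congr rfl fun a _ => ?_
      rw [mul_sum, ← sum_add_distrib]
      exact sum_congr rfl fun b _ => by ring
    rw [hsplit]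
    refine (norm_add_le _ _).trans ?_
    rw [norm_mul, show ‖ff t n‖ = 1 from ee_norm _, one_mul, mul_add]
    refine add_le_add hb ?_
    calc _ ≤ ∑ a ∈ Icc 1 Y, ∑ b ∈ Icc 1 Y, (2 * exp (-(L / 4))) := by
          refine (norm_sum_le _ _).trans (sum_le_sum fun a ha => (norm_sum_le _ _).trans (sum_le_sum fun b hb' => ?_))
          exact taylor ht hN hl hlam hlam1 hN16 (by omega) hY2 hk1 (mem_Icc.mp ha).2 (mem_Icc.mp hb').2
      _ = _ := by simp; ring
  have hin2 : ‖∑ a ∈ Icc 1 Y, ∑ b ∈ Icc 1 Y, ∑ n ∈ Ioc N N1, ff t (n + a * b)‖ ≤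
      N * ((Y:ℝ) ^ 2 * (exp (29 - δ) + 2 * exp (-(L / 4)))) := by
    have : ∑ a ∈ Icc 1 Y, ∑ b ∈ Icc 1 Y, ∑ n ∈ Ioc N N1, ff t (n + a * b) = ∑ n ∈ Ioc N N1, ∑ a ∈ Icc 1 Y, ∑ b ∈ Icc 1 Y, ff t (n + a * b) := by
      rw [sum_comm]
      rw [sum_congr rfl fun b _ => sum_comm, sum_comm]
      exact sum_congr rfl fun n _ => sum_comm
    rw [this]
    refine (norm_sum_le _ _).trans ((sum_le_card_nsmul _ _ _ hin).trans ?_)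
    rw [nsmul_eq_mul]
    gcongr
    rw [Nat.card_Ioc]; omega
  have hsh : ‖(Y:ℂ) ^ 2 * S - ∑ a ∈ Icc 1 Y, ∑ b ∈ Icc 1 Y, ∑ n ∈ Ioc N N1, ff t (n + a * b)‖ ≤ (Y:ℝ) ^ 2 * (2 * (Y:ℝ) ^ 2) := by
    have e : (Y:ℂ) ^ 2 * S = ∑ a ∈ Icc 1 Y, ∑ b ∈ Icc 1 Y, S := by simp; ring
    rw [e, ← sum_sub_distrib]
    simp_rw [← sum_sub_distrib]
    calc _ ≤ ∑ a ∈ Icc 1 Y, ∑ b ∈ Icc 1 Y, (2 * (Y:ℝ) ^ 2) := by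
          refine (norm_sum_le _ _).trans (sum_le_sum fun a ha => (norm_sum_le _ _).trans (sum_le_sum fun b hb' => ?_))
          have := shift_sum (ff t) (fun n => (ee_norm _).le) N N1 (a * b)
          refine this.trans ?_
          rw [sq]; push_cast
          gcongr
          · exact (mem_Icc.mp ha).2
          · exact (mem_Icc.mp hb').2
      _ = _ := by simp; ring
  have hfin : (Y:ℝ) ^ 2 * ‖S‖ ≤ (Y:ℝ) ^ 2 * (N * (exp (29 - δ) + 2 * exp (-(L / 4))) + 2 * (Y:ℝ) ^ 2) := by
    have : (Y:ℝ) ^ 2 * ‖S‖ = ‖(Y:ℂ) ^ 2 * S‖ := by simp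
    rw [this]
    have h3 := norm_sub_norm_le ((Y:ℂ) ^ 2 * S) (∑ a ∈ Icc 1 Y, ∑ b ∈ Icc 1 Y, ∑ n ∈ Ioc N N1, ff t (n + a * b))
    linarith
  have h4 := le_of_mul_le_mul_left hfin (by positivity)
  have hY4 : (Y:ℝ) ^ 2 ≤ N * exp (-(l / 4)) := by
    calc (Y:ℝ) ^ 2 ≤ exp (3 / 8 * l) ^ 2 := by gcongr
      _ = _ := by rw [hN, ← exp_nat_mul, ← exp_add]; congr 1; push_cast; ring
  have hδl : δ ≤ l / 8 := by
    have h5 : l / lam ^ 2 ≤ l / (3 / 4) ^ 2 := by gcongr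
    rw [hδ]
    have : l / (3 / 4:ℝ) ^ 2 = 16 / 9 * l := by ring
    rw [this] at h5
    linarith
  have hLl : l / 8 ≤ L / 4 := by rw [hlam]; clear * - hl hlam1; nlinarith
  have q1 : exp (-(l / 4)) ≤ exp (-δ) := exp_le_exp.mpr (by linarith)
  have q2 : exp (-(L / 4)) ≤ exp (-δ) := exp_le_exp.mpr (by linarith)
  have q3 : exp (29 - δ) = exp 29 * exp (-δ) := by rw [← exp_add]; congr 1
  have q4 : exp (30 - δ) = exp 29 * exp 1 * exp (-δ) := by rw [← exp_add, ← exp_add]; congr 1; ring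
  have q5 : exp 29 + 4 ≤ exp 29 * exp 1 := by
    have z1 : (30:ℝ) ≤ exp 29 := by have := add_one_le_exp (29:ℝ); linarith
    have z2 : (2:ℝ) ≤ exp 1 := by have := add_one_le_exp (1:ℝ); linarith
    clear * - z1 z2; nlinarith
  calc ‖S‖ ≤ N * (exp (29 - δ) + 2 * exp (-(L / 4))) + 2 * (N * exp (-(l / 4))) := h4.trans (by gcongr)
    _ ≤ N * (exp 29 * exp (-δ) + 2 * exp (-δ)) + 2 * (N * exp (-δ)) := by rw [q3]; gcongr
    _ = N * ((exp 29 + 4) * exp (-δ)) := by ring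
    _ ≤ N * (exp 29 * exp 1 * exp (-δ)) := by gcongr
    _ = _ := by rw [q4]

end
end VK

namespace VK
open Finset Real

noncomputable section

def vv (n:ℕ) (s:ℂ) : ℂ := (s - 1) * ((n + 1:ℕ):ℂ) ^ (-s) + ((n + 1:ℕ):ℂ) ^ (1 - s) - (n:ℂ) ^ (1 - s)

lemma tel_int {σ : ℝ} (hσ : 0 < σ) {n : ℝ} (hn : 0 < n) :
    ∫ w in n..(n + 1), w ^ (-σ - 1) = (n ^ (-σ) - (n + 1) ^ (-σ)) / σ := by
  rw [integral_rpow (Or.inr ⟨by linarith, by rw [Set.uIcc_of_le (by linarith)]; intro h; linarith [h.1]⟩)]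
  rw [show -σ - 1 + 1 = -σ by ring]
  field_simp; ring

lemma tel_int_int {σ : ℝ} {n : ℝ} (hn : 0 < n) :
    IntervalIntegrable (fun w : ℝ => w ^ (-σ - 1)) MeasureTheory.volume n (n + 1) :=
  intervalIntegral.intervalIntegrable_rpow (Or.inr (by rw [Set.uIcc_of_le (by linarith)]; intro h; linarith [h.1]))

lemma tel_mono {σ σ' : ℝ} (hσ : 0 < σ) (h : σ ≤ σ') {n : ℝ} (hn : 1 ≤ n) :
    (n ^ (-σ') - (n + 1) ^ (-σ')) / σ' ≤ (n ^ (-σ) - (n + 1) ^ (-σ)) / σ := by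
  rw [← tel_int hσ (by linarith), ← tel_int (by linarith) (by linarith)]
  refine intervalIntegral.integral_mono_on (by linarith) (tel_int_int (by linarith)) (tel_int_int (by linarith)) fun w hw => ?_
  exact rpow_le_rpow_of_exponent_le (by linarith [hw.1]) (by linarith)

lemma cpow_diff_le {s : ℂ} (hs : 0 < s.re) {n : ℝ} (hn : 0 < n) {u : ℝ} (hu : u ∈ Set.Icc n (n + 1)) :
    ‖((n + 1:ℝ):ℂ) ^ (-s) - (u:ℂ) ^ (-s)‖ ≤ ‖s‖ / s.re * (n ^ (-s.re) - (n + 1) ^ (-s.re)) := by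
  have hs0 : s ≠ 0 := fun h => by simp [h] at hs
  have hu0 : 0 < u := hn.trans_le hu.1
  have h1 : ∫ w in u..(n + 1), (w:ℂ) ^ (-s - 1) = (((n + 1:ℝ):ℂ) ^ (-s) - (u:ℂ) ^ (-s)) / (-s) := by
    rw [integral_cpow (Or.inr ⟨by intro h; apply hs0; linear_combination -h, by rw [Set.uIcc_of_le hu.2]; intro h; linarith [h.1]⟩)]
    simp
  have h2 : ((n + 1:ℝ):ℂ) ^ (-s) - (u:ℂ) ^ (-s) = -s * ∫ w in u..(n + 1), (w:ℂ) ^ (-s - 1) := by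
    rw [h1]; field_simp
  rw [h2, norm_mul, norm_neg, div_mul_eq_mul_div, mul_div_assoc]
  gcongr
  have hrint := tel_int_int (σ := s.re) hn
  calc ‖∫ w in u..(n + 1), (w:ℂ) ^ (-s - 1)‖ ≤ ∫ w in u..(n + 1), w ^ (-s.re - 1) := by
        refine intervalIntegral.norm_integral_le_of_norm_le hu.2 (Filter.Eventually.of_forall fun w hw => ?_) ?_
        · rw [Complex.norm_cpow_eq_rpow_re_of_pos (hu0.trans hw.1)]; simp
        · exact hrint.mono_set (by rw [Set.uIcc_of_le hu.2, Set.uIcc_of_le (by linarith)]; exact Set.Icc_subset_Icc_left hu.1)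
    _ ≤ ∫ w in n..(n + 1), w ^ (-s.re - 1) := by
        refine intervalIntegral.integral_mono_interval hu.1 hu.2 le_rfl ?_ hrint
        filter_upwards [MeasureTheory.ae_restrict_mem measurableSet_Ioc] with w hw
        exact rpow_nonneg (hn.trans hw.1).le _
    _ = _ := tel_int hs hn

lemma vv_norm_le {s : ℂ} (hs : 0 < s.re) {n : ℕ} (hn : 1 ≤ n) :
    ‖vv n s‖ ≤ ‖s - 1‖ * (‖s‖ / s.re * ((n:ℝ) ^ (-s.re) - ((n + 1:ℕ):ℝ) ^ (-s.re))) := by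
  by_cases hs1 : s = 1
  · subst hs1; simp [vv]
  have hn0 : (0:ℝ) < n := by exact_mod_cast hn
  have hs1' : s - 1 ≠ 0 := sub_ne_zero.mpr hs1
  have hI : ∫ u in (n:ℝ)..((n:ℝ) + 1), (u:ℂ) ^ (-s) = ((((n:ℝ) + 1:ℝ):ℂ) ^ (1 - s) - ((n:ℝ):ℂ) ^ (1 - s)) / (1 - s) := by
    rw [integral_cpow (Or.inr ⟨by intro h; apply hs1; linear_combination -h, by rw [Set.uIcc_of_le (by linarith)]; intro h; linarith [h.1]⟩)]
    rw [show -s + 1 = 1 - s by ring]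
  have hii : IntervalIntegrable (fun w : ℝ => (w:ℂ) ^ (-s)) MeasureTheory.volume n (n + 1) :=
    intervalIntegral.intervalIntegrable_cpow (Or.inr (by rw [Set.uIcc_of_le (by linarith)]; intro h; linarith [h.1]))
  have key : vv n s = (s - 1) * ∫ u in (n:ℝ)..((n:ℝ) + 1), ((((n:ℝ) + 1:ℝ):ℂ) ^ (-s) - (u:ℂ) ^ (-s)) := by
    rw [intervalIntegral.integral_sub (by simp) hii, hI]
    simp only [intervalIntegral.integral_const, add_sub_cancel_left, one_smul]
    unfold vv
    push_cast
    have : (1 - s) ≠ 0 := fun h => hs1' (by linear_combination -h)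
    field_simp
    ring
  rw [key, norm_mul]
  gcongr
  have := intervalIntegral.norm_integral_le_of_norm_le_const (a := (n:ℝ)) (b := (n:ℝ) + 1) (f := fun u : ℝ => ((((n:ℝ) + 1:ℝ):ℂ) ^ (-s) - (u:ℂ) ^ (-s)))
    (C := ‖s‖ / s.re * ((n:ℝ) ^ (-s.re) - ((n + 1:ℕ):ℝ) ^ (-s.re))) (by
      intro u hu
      rw [Set.uIoc_of_le (by linarith)] at hu
      have := cpow_diff_le hs hn0 (u := u) ⟨hu.1.le, hu.2⟩
      push_cast at this ⊢
      exact this)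
  simpa using this

lemma tNm {N : ℕ} : Filter.Tendsto (fun m : ℕ => N + m) Filter.atTop Filter.atTop :=
  Filter.tendsto_atTop_mono (fun m => Nat.le_add_left m N) Filter.tendsto_id

lemma tel_hasSum {σ : ℝ} (hσ : 0 < σ) {N : ℕ} (hN : 1 ≤ N) :
    HasSum (fun n : ℕ => ((N + n:ℕ):ℝ) ^ (-σ) - ((N + n + 1:ℕ):ℝ) ^ (-σ)) ((N:ℝ) ^ (-σ)) := by
  rw [hasSum_iff_tendsto_nat_of_nonneg]
  · have h1 : ∀ m, ∑ i ∈ range m, (((N + i:ℕ):ℝ) ^ (-σ) - ((N + i + 1:ℕ):ℝ) ^ (-σ)) = (N:ℝ) ^ (-σ) - ((N + m:ℕ):ℝ) ^ (-σ) := by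
      intro m
      induction m with
      | zero => simp
      | succ m ih => rw [sum_range_succ, ih, ← add_assoc]; ring
    simp_rw [h1]
    have h2 : Filter.Tendsto (fun m : ℕ => ((N + m:ℕ):ℝ) ^ (-σ)) Filter.atTop (nhds 0) :=
      (tendsto_rpow_neg_atTop hσ).comp (tendsto_natCast_atTop_atTop.comp tNm)
    simpa using tendsto_const_nhds.sub h2
  · intro n
    rw [sub_nonneg]
    have : (0:ℝ) < ((N + n:ℕ):ℝ) := Nat.cast_pos.mpr (by omega)
    exact rpow_le_rpow_of_nonpos this (by push_cast; linarith) (by linarith)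
lemma vv_diff (n:ℕ) (hn : 1 ≤ n) : Differentiable ℂ (vv n) := by
  unfold vv
  have h1 : ((n + 1:ℕ):ℂ) ≠ 0 := Nat.cast_ne_zero.mpr (by omega)
  have h2 : (n:ℂ) ≠ 0 := Nat.cast_ne_zero.mpr (by omega)
  refine (((differentiable_id.sub_const 1).mul ?_).add ?_).sub ?_
  · exact fun s => (differentiableAt_id.neg).const_cpow (Or.inl h1)
  · exact fun s => (differentiableAt_id.const_sub 1).const_cpow (Or.inl h1)
  · exact fun s => (differentiableAt_id.const_sub 1).const_cpow (Or.inl h2)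

lemma vv_partial (N m:ℕ) (s:ℂ) : ∑ i ∈ range m, vv (N + i) s =
    (s - 1) * ∑ n ∈ Ioc N (N + m), (n:ℂ) ^ (-s) + ((N + m:ℕ):ℂ) ^ (1 - s) - (N:ℂ) ^ (1 - s) := by
  induction m with
  | zero => simp
  | succ m ih =>
    rw [sum_range_succ, ih, ← add_assoc, sum_Ioc_succ_top (by omega)]
    unfold vv; push_cast; ring

def zeta_tail (N:ℕ) (s:ℂ) : ℂ := ∑' n : ℕ, vv (N + n) s

lemma zeta_tail_hasSum {N : ℕ} (hN : 1 ≤ N) {s : ℂ} (hs : 0 < s.re) :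
    HasSum (fun n => vv (N + n) s) (zeta_tail N s) ∧ ‖zeta_tail N s‖ ≤ ‖s - 1‖ * (‖s‖ / s.re * (N:ℝ) ^ (-s.re)) := by
  have h1 := ((tel_hasSum hs hN).mul_left (‖s‖ / s.re)).mul_left ‖s - 1‖
  have h2 : ∀ n, ‖vv (N + n) s‖ ≤ ‖s - 1‖ * (‖s‖ / s.re * (((N + n:ℕ):ℝ) ^ (-s.re) - ((N + n + 1:ℕ):ℝ) ^ (-s.re))) :=
    fun n => vv_norm_le hs (by omega)
  exact ⟨(Summable.of_norm_bounded h1.summable h2).hasSum, tsum_of_norm_bounded h1 h2⟩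

lemma zeta_tail_eq {N : ℕ} (hN : 1 ≤ N) {s : ℂ} (hs : 1 < s.re) :
    riemannZeta₁ s = (s - 1) * ∑ n ∈ Icc 1 N, (n:ℂ) ^ (-s) + (N:ℂ) ^ (1 - s) + zeta_tail N s := by
  have h1 := (zeta_tail_hasSum hN (by linarith : 0 < s.re)).1.tendsto_sum_nat
  simp_rw [vv_partial] at h1
  have hs1 : s ≠ 1 := fun h => by simp [h] at hs
  have hz : riemannZeta₁ s = (s - 1) * riemannZeta s := by
    rw [riemannZeta_eq_inv_sub_mul hs1]; field_simp [sub_ne_zero.mpr hs1]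
  have hsum : HasSum (fun n : ℕ => 1 / ((n + 1:ℕ):ℂ) ^ s) (riemannZeta s) := by
    rw [zeta_eq_tsum_one_div_nat_add_one_cpow hs]
    have := (summable_nat_add_iff 1).mpr (Complex.summable_one_div_nat_cpow.mpr hs)
    simpa using this.hasSum
  have h2 : Filter.Tendsto (fun m : ℕ => ∑ n ∈ Icc 1 (N + m), (n:ℂ) ^ (-s)) Filter.atTop (nhds (riemannZeta s)) := by
    have h3 := hsum.tendsto_sum_nat.comp (tNm (N := N))
    refine h3.congr fun m => ?_
    simp only [Function.comp]
    rw [show Icc 1 (N + m) = Ico (0 + 1) (N + m + 1) from rfl, ← sum_Ico_add' (fun n : ℕ => (n:ℂ) ^ (-s)) 0 (N + m) 1, range_eq_Ico]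
    refine sum_congr rfl fun n _ => ?_
    rw [Complex.cpow_neg, one_div]
  have h3 : Filter.Tendsto (fun m : ℕ => ((N + m:ℕ):ℂ) ^ (1 - s)) Filter.atTop (nhds 0) := by
    rw [tendsto_zero_iff_norm_tendsto_zero]
    have : Filter.Tendsto (fun m : ℕ => ((N + m:ℕ):ℝ) ^ (-(s.re - 1))) Filter.atTop (nhds 0) :=
      (tendsto_rpow_neg_atTop (by linarith)).comp (tendsto_natCast_atTop_atTop.comp tNm)
    refine this.congr fun m => ?_
    have h0 : 0 < N + m := by omega
    rw [Complex.norm_natCast_cpow_of_pos h0]; simp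
  have h4 : ∀ m, ∑ n ∈ Ioc N (N + m), (n:ℂ) ^ (-s) = ∑ n ∈ Icc 1 (N + m), (n:ℂ) ^ (-s) - ∑ n ∈ Icc 1 N, (n:ℂ) ^ (-s) := by
    intro m
    rw [show Icc 1 (N + m) = Ioc 0 (N + m) from rfl, show Icc 1 N = Ioc 0 N from rfl,
      ← sum_Ioc_consecutive _ (Nat.zero_le N) (by omega : N ≤ N + m)]; ring
  simp_rw [h4] at h1
  have h5 := tendsto_nhds_unique h1 ((((h2.sub tendsto_const_nhds).const_mul (s - 1)).add h3).sub tendsto_const_nhds)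
  rw [h5, hz]; ring

lemma zeta_tail_eq' {N : ℕ} (hN : 1 ≤ N) {s : ℂ} (hs : 0 < s.re) :
    riemannZeta₁ s = (s - 1) * ∑ n ∈ Icc 1 N, (n:ℂ) ^ (-s) + (N:ℂ) ^ (1 - s) + zeta_tail N s := by
  rcases lt_or_ge 1 s.re with h1s | h1s
  · exact zeta_tail_eq hN h1s
  set U : Set ℂ := {z | s.re / 2 < z.re} ∩ Metric.ball 0 (‖s‖ + 3) with hU
  have hUo : IsOpen U := (isOpen_lt continuous_const Complex.continuous_re).inter Metric.isOpen_ball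
  have hUc : Convex ℝ U := (convex_halfSpace_re_gt _).inter (convex_ball _ _)
  have hsU : s ∈ U := ⟨by simp only [Set.mem_ofPred_eq]; linarith, by simp⟩
  have hre : s.re ≤ ‖s‖ := Complex.re_le_norm s
  have hN0 : (N:ℂ) ≠ 0 := Nat.cast_ne_zero.mpr (by omega)
  have htail : DifferentiableOn ℂ (zeta_tail N) U := by
    have h1 := ((tel_hasSum (σ := s.re / 2) (by linarith) hN).mul_left ((‖s‖ + 4) * ((‖s‖ + 3) / (s.re / 2)))).summable
    set u : ℕ → ℝ := fun n => (‖s‖ + 4) * ((‖s‖ + 3) / (s.re / 2)) * (((N + n:ℕ):ℝ) ^ (-(s.re / 2)) - ((N + n + 1:ℕ):ℝ) ^ (-(s.re / 2))) with hu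
    refine Complex.differentiableOn_tsum_of_summable_norm (u := u) h1 (fun n => (vv_diff _ (by omega)).differentiableOn) hUo fun n z hz => ?_
    have hz1 : s.re / 2 < z.re := hz.1
    have hz2 : ‖z‖ < ‖s‖ + 3 := by simpa using hz.2
    have hz0 : 0 < z.re := by linarith
    have hn0 : (1:ℝ) ≤ ((N + n:ℕ):ℝ) := Nat.one_le_cast.mpr (by omega)
    refine (vv_norm_le hz0 (by omega : 1 ≤ N + n)).trans ?_
    have hm := tel_mono (by linarith : 0 < s.re / 2) hz1.le hn0
    have hnn : 0 ≤ (((N + n:ℕ):ℝ) ^ (-z.re) - (((N + n:ℕ):ℝ) + 1) ^ (-z.re)) / z.re := by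
      refine div_nonneg (sub_nonneg.mpr ?_) hz0.le
      exact rpow_le_rpow_of_nonpos (by linarith) (by linarith) (by linarith)
    have hz3 : ‖z - 1‖ ≤ ‖s‖ + 4 := (norm_sub_le _ _).trans (by rw [norm_one]; linarith)
    have e1 : u n = (‖s‖ + 4) * ((‖s‖ + 3) * ((((N + n:ℕ):ℝ) ^ (-(s.re / 2)) - (((N + n:ℕ):ℝ) + 1) ^ (-(s.re / 2))) / (s.re / 2))) := by
      rw [hu]; push_cast; ring
    have e2 : ‖z - 1‖ * (‖z‖ / z.re * (((N + n:ℕ):ℝ) ^ (-z.re) - ((N + n + 1:ℕ):ℝ) ^ (-z.re))) =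
        ‖z - 1‖ * (‖z‖ * ((((N + n:ℕ):ℝ) ^ (-z.re) - (((N + n:ℕ):ℝ) + 1) ^ (-z.re)) / z.re)) := by push_cast; ring
    rw [e1, e2]
    gcongr
  have hfin : DifferentiableOn ℂ (fun z => (z - 1) * ∑ n ∈ Icc 1 N, (n:ℂ) ^ (-z) + (N:ℂ) ^ (1 - z) + zeta_tail N z) U := by
    refine (DifferentiableOn.add (DifferentiableOn.mul (by fun_prop) (DifferentiableOn.fun_sum fun n hn => ?_)) ?_).add htail
    · have : (n:ℂ) ≠ 0 := Nat.cast_ne_zero.mpr (by have := (mem_Icc.mp hn).1; omega)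
      exact fun z _ => (differentiableAt_id.neg.const_cpow (Or.inl this)).differentiableWithinAt
    · exact fun z _ => ((differentiableAt_id.const_sub 1).const_cpow (Or.inl hN0)).differentiableWithinAt
  have h2U : (2:ℂ) ∈ U := ⟨by simp only [Set.mem_ofPred_eq, Complex.re_ofNat]; linarith, by
    have := norm_nonneg s
    simp; linarith⟩
  have hev : riemannZeta₁ =ᶠ[nhds (2:ℂ)] fun z => (z - 1) * ∑ n ∈ Icc 1 N, (n:ℂ) ^ (-z) + (N:ℂ) ^ (1 - z) + zeta_tail N z := by
    filter_upwards [(isOpen_lt continuous_const Complex.continuous_re).mem_nhds (show (1:ℝ) < (2:ℂ).re by simp)] with z hz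
    exact zeta_tail_eq hN hz
  exact (differentiable_riemannZeta₁.differentiableOn.analyticOnNhd hUo).eqOn_of_preconnected_of_eventuallyEq
    (hfin.analyticOnNhd hUo) hUc.isPreconnected h2U hev hsU

theorem zeta_approx {s : ℂ} (hs : 0 < s.re) (hs1 : s ≠ 1) {N : ℕ} (hN : 1 ≤ N) :
    ‖riemannZeta s - ∑ n ∈ Icc 1 N, (n:ℂ) ^ (-s) - (N:ℂ) ^ (1 - s) / (s - 1)‖ ≤ ‖s‖ / s.re * (N:ℝ) ^ (-s.re) := by
  have h1 := zeta_tail_eq' hN hs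
  have h2 := (zeta_tail_hasSum hN hs).2
  have hs' : s - 1 ≠ 0 := sub_ne_zero.mpr hs1
  have h3 : riemannZeta s - ∑ n ∈ Icc 1 N, (n:ℂ) ^ (-s) - (N:ℂ) ^ (1 - s) / (s - 1) = zeta_tail N s / (s - 1) := by
    have hz : riemannZeta s = riemannZeta₁ s / (s - 1) := by rw [riemannZeta_eq_inv_sub_mul hs1]; field_simp
    rw [hz, h1]; field_simp; ring
  rw [h3, norm_div, div_le_iff₀ (norm_pos_iff.mpr hs')]
  linarith

end
end VK

namespace VK
open Finset Real

noncomputable section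

lemma abel_bound (a : ℕ → ℝ) (g : ℕ → ℂ) {N : ℕ} {B : ℝ} (m:ℕ) (ha : ∀ n, N ≤ n → a (n + 1) ≤ a n)
    (ha0 : ∀ n, 0 ≤ a n)
    (hB : ∀ N1, N1 ≤ N + m → ‖∑ n ∈ Ioc N N1, g n‖ ≤ B) :
    ‖∑ n ∈ Ioc N (N + m), (a n:ℂ) * g n‖ ≤ a N * B := by
  have key : ∀ k ≤ m, ‖∑ n ∈ Ioc N (N + k), (a n:ℂ) * g n - a (N + k) * ∑ n ∈ Ioc N (N + k), g n‖
      ≤ (a N - a (N + k)) * B := by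
    intro k
    induction k with
    | zero => simp
    | succ k ih =>
      intro hk
      have h1 := ih (by omega)
      rw [← add_assoc, sum_Ioc_succ_top (by omega), sum_Ioc_succ_top (by omega)]
      have h2 := ha (N + k) (by omega)
      have e : ∑ n ∈ Ioc N (N + k), (a n:ℂ) * g n + a (N + k + 1) * g (N + k + 1)
          - a (N + k + 1) * (∑ n ∈ Ioc N (N + k), g n + g (N + k + 1))
          = (∑ n ∈ Ioc N (N + k), (a n:ℂ) * g n - a (N + k) * ∑ n ∈ Ioc N (N + k), g n)
          + ((a (N + k) - a (N + k + 1):ℝ):ℂ) * ∑ n ∈ Ioc N (N + k), g n := by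
        push_cast; ring
      rw [e]
      refine (norm_add_le _ _).trans ?_
      rw [norm_mul, Complex.norm_real, Real.norm_of_nonneg (by linarith)]
      have h3 := mul_le_mul_of_nonneg_left (hB (N + k) (by omega)) (sub_nonneg.mpr h2)
      linarith
  have h1 := key m le_rfl
  have h2 := mul_le_mul_of_nonneg_left (hB (N + m) le_rfl) (ha0 (N + m))
  have h3 : ‖(a (N + m):ℂ) * ∑ n ∈ Ioc N (N + m), g n‖ ≤ a (N + m) * B := by
    rw [norm_mul, Complex.norm_real, Real.norm_of_nonneg (ha0 _)]; exact h2
  have h4 := norm_sub_norm_le (∑ n ∈ Ioc N (N + m), (a n:ℂ) * g n) (a (N + m) * ∑ n ∈ Ioc N (N + m), g n)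
  linarith

lemma cpow_eq_ff {n : ℕ} (hn : 0 < n) (σ t:ℝ) :
    (n:ℂ) ^ (-((σ:ℂ) + t * Complex.I)) = ((n:ℝ) ^ (-σ):ℝ) * ff t n := by
  have hn0 : (n:ℂ) ≠ 0 := Nat.cast_ne_zero.mpr (by omega)
  rw [neg_add, Complex.cpow_add _ _ hn0, Complex.ofReal_cpow (Nat.cast_nonneg n)]
  push_cast
  congr 1
  rw [Complex.cpow_def_of_ne_zero hn0, ff, ee, ← Complex.natCast_log]
  congr 1
  have : (π:ℂ) ≠ 0 := by exact_mod_cast pi_ne_zero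
  push_cast
  field_simp

lemma block_bound {Y σ η : ℝ} {N : ℕ} (hY : 2 ≤ Y) (hbig : (330 * Y ^ 3 + 1) * exp (7 * Y) ≤ exp (Y ^ 3 / 8))
    (hη : η * Y ^ 2 ≤ 1 / 10 ^ 8) (hσ : 1 - η ≤ σ) (hσ0 : 0 ≤ σ)
    (hN : exp (Y ^ 2) ≤ N) (hN2 : (N:ℝ) ≤ exp (4 / 3 * Y ^ 3)) :
    ‖∑ n ∈ Ioc N (2 * N), (n:ℂ) ^ (-((σ:ℂ) + (exp (Y ^ 3):ℝ) * Complex.I))‖ ≤ exp 30 := by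
  have hN0 : (0:ℝ) < N := (exp_pos _).trans_le hN
  have hY2 : 4 ≤ Y ^ 2 := by nlinarith
  set l := log N with hl
  have hel : (N:ℝ) = exp l := by rw [hl, exp_log hN0]
  have l1 : Y ^ 2 ≤ l := by rw [hel] at hN; exact exp_le_exp.mp hN
  have l2 : l ≤ 4 / 3 * Y ^ 3 := by rw [hel] at hN2; exact exp_le_exp.mp hN2
  have l0 : 0 < l := by linarith
  have hY3 : Y ^ 3 = Y * Y ^ 2 := by ring
  have hlamY : Y ^ 3 / l ≤ Y := by rw [div_le_iff₀ l0, hY3]; gcongr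
  have hN16 : 16 ≤ N := by
    have : (16:ℝ) ≤ N := by
      have := exp_le_exp.mpr hY2
      have e1 : exp 4 = exp 1 ^ 4 := by rw [← exp_nat_mul]; norm_num
      have e2 := exp_one_gt_d9
      have : (2:ℝ) ^ 4 ≤ exp 1 ^ 4 := by gcongr; linarith
      linarith
    exact_mod_cast this
  have hE : ∀ N1, N1 ≤ N + N → ‖∑ n ∈ Ioc N N1, ff (exp (Y ^ 3)) n‖ ≤
      N * exp (30 - 1/10^8 * (l / (Y ^ 3 / l)^2)) := by
    intro N1 hN1
    refine exp_sum rfl hel l0 (by field_simp) ?_ ?_ ?_ hN16 (by omega)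
    · rw [le_div_iff₀ l0]; linarith
    · calc (Y ^ 3 / l) ^ 2 ≤ Y ^ 2 := by gcongr
        _ ≤ Y ^ 3 := by gcongr <;> linarith
    · refine le_trans ?_ hbig
      gcongr
  have hA := abel_bound (fun n => (n:ℝ) ^ (-σ)) (ff (exp (Y ^ 3))) N
    (fun n hn => rpow_le_rpow_of_nonpos (Nat.cast_pos.mpr (by omega)) (by push_cast; linarith) (by linarith))
    (fun n => by positivity) hE
  rw [two_mul]
  have : ∑ n ∈ Ioc N (N + N), (n:ℂ) ^ (-((σ:ℂ) + (exp (Y ^ 3):ℝ) * Complex.I)) =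
      ∑ n ∈ Ioc N (N + N), (((n:ℝ) ^ (-σ):ℝ):ℂ) * ff (exp (Y ^ 3)) n :=
    sum_congr rfl fun n hn => cpow_eq_ff (by have := (mem_Ioc.mp hn).1; omega) _ _
  rw [this]
  refine hA.trans ?_
  have h5 : (1 - σ) * l ≤ 1/10^8 * (l / (Y ^ 3 / l)^2) := by
    have e : l / (Y ^ 3 / l)^2 = (l ^ 2 / Y ^ 6) * l := by field_simp
    rw [e, ← mul_assoc]
    refine mul_le_mul_of_nonneg_right ?_ l0.le
    have h6 : (1 - σ) ≤ 1/10^8 / Y ^ 2 := by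
      rw [le_div_iff₀ (by positivity)]
      refine le_trans ?_ hη
      gcongr; linarith
    refine h6.trans ?_
    rw [div_eq_mul_inv]
    refine mul_le_mul_of_nonneg_left ?_ (by norm_num)
    rw [le_div_iff₀ (by positivity)]
    calc (Y^2)⁻¹ * Y ^ 6 = (Y ^ 2) ^ 2 := by field_simp
      _ ≤ l ^ 2 := by gcongr
  calc (N:ℝ) ^ (-σ) * (N * exp (30 - 1/10^8 * (l / (Y ^ 3 / l)^2)))
      = exp ((1 - σ) * l + (30 - 1/10^8 * (l / (Y ^ 3 / l)^2))) := by
        rw [rpow_def_of_pos hN0, ← hl, hel, ← exp_add, ← exp_add]; congr 1; ring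
    _ ≤ exp 30 := exp_le_exp.mpr (by linarith)

theorem zeta_growth {Y σ η : ℝ} (hY : 2 ≤ Y) (hbig : (330 * Y ^ 3 + 1) * exp (7 * Y) ≤ exp (Y ^ 3 / 8))
    (hη0 : 0 ≤ η) (hη : η * Y ^ 2 ≤ 1 / 10 ^ 8) (hσ : 1 - η ≤ σ) (hσ2 : σ ≤ 2) :
    ‖riemannZeta ((σ:ℂ) + (exp (Y ^ 3):ℝ) * Complex.I)‖ ≤ exp 34 * Y ^ 3 := by
  have hY2 : 4 ≤ Y ^ 2 := by nlinarith
  have hY3 : 2 * Y ^ 2 ≤ Y ^ 3 := by rw [pow_succ Y 2]; linarith [mul_le_mul_of_nonneg_left hY (sq_nonneg Y)]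
  have hη1 : η ≤ 1 / 10 ^ 8 := le_trans (le_mul_of_one_le_right hη0 (by linarith)) hη
  have hσ0 : 1 / 2 ≤ σ := by linarith
  have h7 : 4 * Y ≤ Y ^ 3 := by rw [pow_succ Y 2]; gcongr
  set t := exp (Y ^ 3) with ht
  set s : ℂ := (σ:ℂ) + (t:ℝ) * Complex.I with hs
  have hsre : s.re = σ := by simp [hs]
  have hsim : s.im = t := by simp [hs]
  have ht0 : 0 < t := exp_pos _
  have hs1 : s ≠ 1 := fun h => by rw [h] at hsim; simp at hsim; linarith
  -- starting point
  set M := ⌈exp (Y ^ 2)⌉₊ with hM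
  have hM1 : exp (Y ^ 2) ≤ M := Nat.le_ceil _
  have he1 : 1 ≤ exp (Y ^ 2) := one_le_exp (by linarith)
  have hM2 : (M:ℝ) ≤ 2 * exp (Y ^ 2) := by linarith [Nat.ceil_lt_add_one (exp_pos (Y ^ 2)).le]
  have hMpos : 0 < M := Nat.ceil_pos.mpr (exp_pos _)
  have hlogM : log M ≤ 1 + Y ^ 2 := by
    calc log M ≤ log (2 * exp (Y ^ 2)) := log_le_log (Nat.cast_pos.mpr hMpos) hM2
      _ = log 2 + Y ^ 2 := by rw [log_mul (by norm_num) (exp_pos _).ne', log_exp]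
      _ ≤ _ := by linarith [log_two_lt_d9]
  have hex : ∃ J : ℕ, exp (4 / 3 * Y ^ 3) < (2 ^ J * M:ℕ) := by
    obtain ⟨J, hJ⟩ := pow_unbounded_of_one_lt (exp (4 / 3 * Y ^ 3)) (one_lt_two)
    refine ⟨J, hJ.trans_le ?_⟩
    have : (1:ℝ) ≤ M := by exact_mod_cast hMpos
    push_cast
    exact le_mul_of_one_le_right (by positivity) this
  classical
  set J := Nat.find hex with hJdef
  have hJ1 := Nat.find_spec hex
  rw [← hJdef] at hJ1
  have hJ2 : ∀ j < J, ((2 ^ j * M:ℕ):ℝ) ≤ exp (4 / 3 * Y ^ 3) := fun j hj => not_lt.mp (Nat.find_min hex hj)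
  set N := 2 ^ J * M with hN
  have hNpos : 0 < N := by positivity
  have hN2 : (N:ℝ) ≤ 2 * exp (4 / 3 * Y ^ 3) := by
    rcases Nat.eq_zero_or_pos J with h | h
    · have : (N:ℝ) = M := by rw [hN, h]; simp
      rw [this]; refine hM2.trans ?_
      gcongr; linarith
    · have := hJ2 (J - 1) (by omega)
      have e : (N:ℝ) = 2 * ((2 ^ (J - 1) * M:ℕ):ℝ) := by
        rw [hN]; conv_lhs => rw [show J = (J - 1) + 1 by omega]
        push_cast; ring
      rw [e]; linarith
  have hlogN : log N ≤ 1 + 4 / 3 * Y ^ 3 := by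
    calc log N ≤ log (2 * exp (4 / 3 * Y ^ 3)) := log_le_log (Nat.cast_pos.mpr hNpos) hN2
      _ = log 2 + 4 / 3 * Y ^ 3 := by rw [log_mul (by norm_num) (exp_pos _).ne', log_exp]
      _ ≤ _ := by linarith [log_two_lt_d9]
  have hJle : (J:ℝ) ≤ 2 + 2 * Y ^ 3 := by
    have h1 : log N = J * log 2 + log M := by
      rw [hN]; push_cast
      rw [log_mul (by positivity) (Nat.cast_ne_zero.mpr hMpos.ne'), log_pow]
    have h2 : 0 ≤ log (M:ℝ) := log_natCast_nonneg M
    have h3 : (J:ℝ) * 0.69 ≤ J * log 2 := by gcongr; linarith [log_two_gt_d9]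
    linarith
  -- blocks
  have hblocks : ∀ j ≤ J, ‖∑ n ∈ Ioc M (2 ^ j * M), (n:ℂ) ^ (-s)‖ ≤ j * exp 30 := by
    intro j
    induction j with
    | zero => simp
    | succ j ih =>
      intro hj
      have h1 := ih (by omega)
      have hjM : M ≤ 2 ^ j * M := Nat.le_mul_of_pos_left _ (by positivity)
      have e : 2 ^ (j + 1) * M = 2 * (2 ^ j * M) := by ring
      rw [e, ← sum_Ioc_consecutive _ hjM (by omega)]
      have h2 := block_bound (σ := σ) (N := 2 ^ j * M) hY hbig hη hσ (by linarith)
        (hM1.trans (by exact_mod_cast hjM)) (hJ2 j (by omega))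
      refine (norm_add_le _ _).trans ?_
      push_cast
      linarith
  have hb := hblocks J le_rfl
  -- small part
  have hsmall : ‖∑ n ∈ Ioc 0 M, (n:ℂ) ^ (-s)‖ ≤ exp 1 * (2 + Y ^ 2) := by
    refine (norm_sum_le _ _).trans ?_
    have h1 : ∀ n ∈ Ioc 0 M, ‖(n:ℂ) ^ (-s)‖ ≤ exp 1 * (n:ℝ)⁻¹ := by
      intro n hn
      have hn' := mem_Ioc.mp hn
      have hn0 : (0:ℝ) < n := Nat.cast_pos.mpr hn'.1
      rw [Complex.norm_natCast_cpow_of_pos hn'.1]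
      have e : (n:ℝ)⁻¹ = exp (- log n) := by rw [exp_neg, exp_log hn0]
      rw [e, rpow_def_of_pos hn0, ← exp_add]
      refine exp_le_exp.mpr ?_
      have h2 : log n ≤ log M := log_le_log hn0 (by exact_mod_cast hn'.2)
      simp only [Complex.neg_re, hsre]
      have h4 : (1 - σ) * log n ≤ η * (1 + Y ^ 2) := by
        calc (1 - σ) * log n ≤ η * log n := by gcongr; linarith
          _ ≤ _ := by gcongr; linarith
      linarith
    refine (sum_le_sum h1).trans ?_
    rw [← mul_sum]
    gcongr
    have h5 := harmonic_le_one_add_log M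
    rw [harmonic_eq_sum_Icc] at h5
    push_cast at h5
    rw [show Ioc 0 M = Icc 1 M from rfl]
    linarith
  have hsum : ‖∑ n ∈ Icc 1 N, (n:ℂ) ^ (-s)‖ ≤ exp 1 * (2 + Y ^ 2) + J * exp 30 := by
    rw [show Icc 1 N = Ioc 0 N from rfl, ← sum_Ioc_consecutive _ (Nat.zero_le M)
      (Nat.le_mul_of_pos_left _ (by positivity))]
    exact (norm_add_le _ _).trans (add_le_add hsmall hb)
  -- tails
  have hN0 : (0:ℝ) < N := Nat.cast_pos.mpr hNpos
  have hNη : η * log N ≤ Y := by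
    have : η * log N ≤ η * (1 + 4 / 3 * Y ^ 3) := by gcongr
    have : 4 / 3 * (η * Y ^ 2) * Y ≤ 4 / 3 * (1 / 10 ^ 8) * Y := by gcongr
    linarith
  have hσN : (1 - σ) * log N ≤ Y := le_trans (by gcongr; linarith) hNη
  have htail1 : ‖(N:ℂ) ^ (1 - s) / (s - 1)‖ ≤ 1 := by
    have h1 : t ≤ ‖s - 1‖ := by
      have := Complex.abs_im_le_norm (s - 1)
      simp only [Complex.sub_im, hsim, Complex.one_im, sub_zero, abs_of_pos ht0] at this
      exact this
    rw [norm_div, Complex.norm_natCast_cpow_of_pos hNpos]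
    rw [div_le_one (by linarith)]
    refine le_trans ?_ h1
    rw [rpow_def_of_pos hN0, ht]
    refine exp_le_exp.mpr ?_
    simp only [Complex.sub_re, Complex.one_re, hsre]
    linarith
  have hA := zeta_approx (s := s) (by rw [hsre]; linarith) hs1 (N := N) hNpos
  have htail2 : ‖s‖ / s.re * (N:ℝ) ^ (-s.re) ≤ exp 5 := by
    rw [hsre]
    have h1 : ‖s‖ ≤ 2 * t + t := by
      refine (norm_add_le _ _).trans ?_
      rw [norm_mul, Complex.norm_I, mul_one, Complex.norm_real, Complex.norm_real, Real.norm_of_nonneg (by linarith), Real.norm_of_nonneg ht0.le]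
      have : 1 ≤ t := one_le_exp (by linarith)
      linarith
    have h2 : ‖s‖ / σ ≤ 6 * t := by
      rw [div_le_iff₀ (by linarith)]
      have : 6 * t * (1 / 2) ≤ 6 * t * σ := by gcongr
      linarith
    have h3 : (N:ℝ) ^ (-σ) ≤ exp (Y - 4 / 3 * Y ^ 3) := by
      rw [rpow_def_of_pos hN0]
      refine exp_le_exp.mpr ?_
      have : 4 / 3 * Y ^ 3 ≤ log N := by rw [le_log_iff_exp_le hN0]; exact hJ1.le
      linarith
    have h6 : (6:ℝ) ≤ exp 5 := by linarith [add_one_le_exp (5:ℝ)]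
    calc ‖s‖ / σ * (N:ℝ) ^ (-σ) ≤ (6 * t) * exp (Y - 4 / 3 * Y ^ 3) := by gcongr
      _ = 6 * exp (Y - 1 / 3 * Y ^ 3) := by rw [ht, mul_assoc, ← exp_add]; congr 2; ring
      _ ≤ 6 * exp 0 * 1 := by
          rw [mul_one]
          gcongr
          linarith
      _ ≤ exp 5 := by rw [exp_zero]; linarith
  have hfin : ‖riemannZeta s‖ ≤ exp 1 * (2 + Y ^ 2) + J * exp 30 + 1 + exp 5 := by
    have e : riemannZeta s = (riemannZeta s - ∑ n ∈ Icc 1 N, (n:ℂ)^(-s) - (N:ℂ)^(1-s)/(s-1)) +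
      ∑ n ∈ Icc 1 N, (n:ℂ)^(-s) + (N:ℂ)^(1-s)/(s-1) := by ring
    rw [e]
    refine (norm_add₃_le).trans ?_
    linarith
  have e30 : exp 34 = exp 4 * exp 30 := by rw [← exp_add]; norm_num
  have e1 : exp 1 ≤ exp 30 := exp_le_exp.mpr (by norm_num)
  have e5 : exp 5 ≤ exp 30 := exp_le_exp.mpr (by norm_num)
  have e0 : 1 ≤ exp 30 := one_le_exp (by norm_num)
  have e4 : 5 ≤ exp 4 := by linarith [add_one_le_exp (4:ℝ)]
  calc _ ≤ exp 1 * (2 + Y ^ 2) + J * exp 30 + 1 + exp 5 := hfin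
    _ ≤ exp 30 * (2 + Y ^ 2) + (2 + 2 * Y ^ 3) * exp 30 + exp 30 + exp 30 := by gcongr
    _ = exp 30 * (6 + Y ^ 2 + 2 * Y ^ 3) := by ring
    _ ≤ exp 30 * (exp 4 * Y ^ 3) := by
        gcongr
        have : 5 * Y ^ 3 ≤ exp 4 * Y ^ 3 := by gcongr
        linarith
    _ = _ := by rw [e30]; ring

end
end VK

namespace VK
open Real

noncomputable section

lemma logDeriv_bound {f : ℂ → ℂ} {r B : ℝ} (hr : 0 < r) (hB : 1 < B)
    (hf : DifferentiableOn ℂ f (Metric.ball 0 r)) (hf0 : ∀ z ∈ Metric.ball (0:ℂ) r, f z ≠ 0)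
    (hfB : ∀ z ∈ Metric.ball (0:ℂ) r, ‖f z‖ ≤ B * ‖f 0‖) {z : ℂ} (hz : ‖z‖ ≤ r / 2) :
    ‖deriv f z / f z‖ ≤ 24 * log B / r := by
  have hM : 0 < log B := log_pos hB
  have h0 : (0:ℂ) ∈ Metric.ball (0:ℂ) r := Metric.mem_ball_self hr
  have hd : DifferentiableOn ℂ (fun z => deriv f z / f z) (Metric.ball 0 r) :=
    (hf.deriv Metric.isOpen_ball).div hf hf0
  obtain ⟨g, hg⟩ := hd.isExactOn_ball
  have hfd : ∀ z ∈ Metric.ball (0:ℂ) r, HasDerivAt f (deriv f z) z := fun z hz =>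
    (hf.differentiableAt (Metric.isOpen_ball.mem_nhds hz)).hasDerivAt
  have hconst : ∀ z ∈ Metric.ball (0:ℂ) r, f z * Complex.exp (-(g z - g 0)) = f 0 := by
    intro z hz
    have := (convex_ball (0:ℂ) r).is_const_of_fderivWithin_eq_zero (𝕜 := ℂ) (f := fun z => f z * Complex.exp (-(g z - g 0)))
      ?_ ?_ hz h0
    · simpa using this
    · intro w hw
      exact (((hfd w hw).differentiableAt).mul (((hg w hw).differentiableAt.sub_const _).neg.cexp)).differentiableWithinAt
    · intro w hw
      have h1 : HasDerivAt (fun z => f z * Complex.exp (-(g z - g 0))) 0 w := by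
        have h2 := (hfd w hw).mul ((((hg w hw).sub_const (g 0)).neg).cexp)
        refine h2.congr_deriv ?_
        have := hf0 w hw
        field_simp; ring
      rw [fderivWithin_of_isOpen Metric.isOpen_ball hw]
      rw [h1.hasFDerivAt.fderiv]; ext; simp
  have hre : ∀ z ∈ Metric.ball (0:ℂ) r, (g z - g 0).re ≤ log B := by
    intro z hz
    have h1 := hconst z hz
    have h2 : ‖f z‖ = ‖f 0‖ * exp ((g z - g 0).re) := by
      rw [← h1, norm_mul, Complex.norm_exp, mul_assoc, ← exp_add]; simp
    have h3 := hfB z hz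
    rw [h2, mul_comm] at h3
    rw [le_log_iff_exp_le (by linarith)]
    exact le_of_mul_le_mul_right h3 (norm_pos_iff.mpr (hf0 0 h0))
  have hbc : ∀ w : ℂ, ‖w‖ ≤ 3 / 4 * r → ‖g w - g 0‖ ≤ 6 * log B := by
    intro w hw
    have h1 := Complex.borelCaratheodory_zero (f := fun z => g z - g 0) (z := w) hM
      (fun z hz => ((hg z hz).differentiableAt.sub_const _).differentiableWithinAt)
      hre hr (by simp; linarith) (by simp)
    refine h1.trans ?_
    rw [div_le_iff₀ (by linarith)]
    nlinarith
  have hzb : z ∈ Metric.ball (0:ℂ) r := by simp; linarith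
  have hsub : Metric.closedBall z (r / 4) ⊆ Metric.ball 0 r := by
    intro w hw
    simp only [Metric.mem_closedBall, dist_eq_norm, Metric.mem_ball, sub_zero] at hw ⊢
    have := norm_add_le (w - z) z
    rw [sub_add_cancel] at this; linarith
  have h5 := Complex.norm_deriv_le_of_forall_mem_sphere_norm_le (f := fun w => g w - g 0) (c := z)
    (R := r / 4) (C := 6 * log B) (by positivity) ?_ ?_
  · have h6 : deriv (fun w => g w - g 0) z = deriv f z / f z := ((hg z hzb).sub_const _).deriv
    rw [h6] at h5
    refine h5.trans (le_of_eq ?_)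
    field_simp; norm_num
  · apply DifferentiableOn.diffContOnCl
    rw [closure_ball _ (by positivity)]
    exact fun w hw => ((hg w (hsub hw)).differentiableAt.sub_const _).differentiableWithinAt
  · intro w hw
    apply hbc
    simp only [Metric.mem_sphere, dist_eq_norm] at hw
    have := norm_add_le (w - z) z
    rw [sub_add_cancel] at this; linarith

lemma max_ball {f : ℂ → ℂ} {U : Set ℂ} {R K : ℝ} (hR : 0 < R) (hU : Metric.closedBall 0 R ⊆ U) (hf : DifferentiableOn ℂ f U)
    (hK : ∀ z : ℂ, ‖z‖ = R → ‖f z‖ ≤ K) {z : ℂ} (hz : ‖z‖ ≤ R) : ‖f z‖ ≤ K := by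
  refine Complex.norm_le_of_forall_mem_frontier_norm_le (U := Metric.ball 0 R) Metric.isBounded_ball ?_ ?_ ?_
  · apply DifferentiableOn.diffContOnCl
    rw [closure_ball _ hR.ne']
    exact hf.mono hU
  · intro z hz
    rw [frontier_ball _ hR.ne'] at hz
    exact hK z (by simpa using hz)
  · rw [closure_ball _ hR.ne']; simpa using hz

/-- splitting off a zero -/
lemma split_zero {f : ℂ → ℂ} {U : Set ℂ} {R K : ℝ} (hR : 0 < R) (hUo : IsOpen U)
    (hU : Metric.closedBall 0 R ⊆ U) (hf : DifferentiableOn ℂ f U) (hf0 : f 0 ≠ 0)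
    (hK0 : 0 ≤ K) (hK : ∀ z : ℂ, ‖z‖ = R → ‖f z‖ ≤ K * ‖f 0‖) {ρ : ℂ} (hρ : ‖ρ‖ ≤ R / 3) (hfρ : f ρ = 0) :
    ∃ g : ℂ → ℂ, DifferentiableOn ℂ g U ∧ g 0 ≠ 0 ∧ (∀ z, f z = (z - ρ) * g z) ∧
      (∀ z : ℂ, ‖z‖ = R → ‖g z‖ ≤ K / 2 * ‖g 0‖) ∧
      deriv f 0 / f 0 = -(1 / ρ) + deriv g 0 / g 0 := by
  have h0U : (0:ℂ) ∈ U := hU (Metric.mem_closedBall_self hR.le)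
  have hρU : ρ ∈ U := hU (by simp; linarith)
  have hg : DifferentiableOn ℂ (dslope f ρ) U := (Complex.differentiableOn_dslope (hUo.mem_nhds hρU)).mpr hf
  have hfg : ∀ z, f z = (z - ρ) * dslope f ρ z := by
    intro z
    have := sub_smul_dslope f ρ z
    rw [hfρ, sub_zero] at this
    exact this.symm
  have hρ0 : ρ ≠ 0 := fun h => hf0 (h ▸ hfρ)
  have hg0 : dslope f ρ 0 ≠ 0 := fun h => hf0 (by rw [hfg 0, h, mul_zero])
  refine ⟨dslope f ρ, hg, hg0, hfg, ?_, ?_⟩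
  · intro z hz
    have h1 := hK z hz
    rw [hfg z, hfg 0, norm_mul, norm_mul, zero_sub, norm_neg] at h1
    have h2 : 2 * R / 3 ≤ ‖z - ρ‖ := by
      have := norm_sub_norm_le z ρ; linarith
    have h3 : 2 * R / 3 * ‖dslope f ρ z‖ ≤ K * (R / 3 * ‖dslope f ρ 0‖) := by
      calc _ ≤ ‖z - ρ‖ * ‖dslope f ρ z‖ := by gcongr
        _ ≤ _ := h1
        _ ≤ _ := by gcongr
    have h4 : 2 * R / 3 * ‖dslope f ρ z‖ ≤ 2 * R / 3 * (K / 2 * ‖dslope f ρ 0‖) := by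
      refine h3.trans (le_of_eq ?_); ring
    exact le_of_mul_le_mul_left h4 (by positivity)
  · have hgd : HasDerivAt (dslope f ρ) (deriv (dslope f ρ) 0) 0 :=
      (hg.differentiableAt (hUo.mem_nhds h0U)).hasDerivAt
    have h1 : HasDerivAt f (1 * dslope f ρ 0 + (0 - ρ) * deriv (dslope f ρ) 0) 0 := by
      have := ((hasDerivAt_id (0:ℂ)).sub_const ρ).mul hgd
      exact this.congr_of_eventuallyEq (Filter.Eventually.of_forall hfg)
    rw [h1.deriv, hfg 0]
    field_simp
    ring

lemma landau_aux {U : Set ℂ} {R B : ℝ} (hR : 0 < R) (hUo : IsOpen U) (hB : 1 < B)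
    (hU : Metric.closedBall 0 R ⊆ U) (n:ℕ) : ∀ (f : ℂ → ℂ) (K:ℝ), DifferentiableOn ℂ f U → f 0 ≠ 0 → 0 ≤ K → K ≤ B →
      K < 2 ^ n → (∀ z : ℂ, ‖z‖ = R → ‖f z‖ ≤ K * ‖f 0‖) → (∀ z, ‖z‖ ≤ R / 3 → f z = 0 → z.re ≤ 0) →
      -(deriv f 0 / f 0).re ≤ 72 * log B / R := by
  induction n with
  | zero =>
    intro f K hf hf0 hK0 hKB hK1 hK _
    have := max_ball hR hU hf hK (z := 0) (by simp [hR.le])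
    have h2 := norm_pos_iff.mpr hf0
    rw [pow_zero] at hK1
    have : K * ‖f 0‖ < 1 * ‖f 0‖ := by gcongr
    linarith
  | succ n ih =>
    intro f K hf hf0 hK0 hKB hK1 hK hre
    by_cases h : ∃ ρ : ℂ, ‖ρ‖ ≤ R / 3 ∧ f ρ = 0
    · obtain ⟨ρ, hρ, hfρ⟩ := h
      obtain ⟨g, hg, hg0, hfg, hgK, hgd⟩ := split_zero hR hUo hU hf hf0 hK0 hK hρ hfρ
      have h1 := ih g (K / 2) hg hg0 (by linarith) (by linarith) (by rw [pow_succ] at hK1; linarith) hgK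
        (fun z hz hgz => hre z hz (by rw [hfg, hgz, mul_zero]))
      rw [hgd, Complex.add_re, Complex.neg_re]
      have h2 : (1 / ρ).re ≤ 0 := by
        rw [one_div, Complex.inv_re]
        exact div_nonpos_of_nonpos_of_nonneg (hre ρ hρ hfρ) (Complex.normSq_nonneg _)
      linarith
    · push Not at h
      have h1 := logDeriv_bound (f := f) (r := R / 3) (B := B) (z := 0) (by positivity) hB ?_ ?_ ?_ (by simp; positivity)
      · have h2 := (Complex.abs_re_le_norm (deriv f 0 / f 0)).trans h1
        have h3 := neg_le_of_abs_le h2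
        have e : 24 * log B / (R / 3) = 72 * log B / R := by field_simp; ring
        linarith
      · refine hf.mono (fun z hz => hU ?_)
        simp at hz ⊢; linarith
      · intro z hz; exact h z (by simp at hz; linarith)
      · intro z hz
        refine (max_ball hR hU hf hK (z := z) (by simp at hz; linarith)).trans ?_
        gcongr

lemma landau {f : ℂ → ℂ} {U : Set ℂ} {R B : ℝ} (hR : 0 < R) (hUo : IsOpen U) (hB : 1 < B)
    (hU : Metric.closedBall 0 R ⊆ U) (hf : DifferentiableOn ℂ f U) (hf0 : f 0 ≠ 0)
    (hK : ∀ z : ℂ, ‖z‖ = R → ‖f z‖ ≤ B * ‖f 0‖) (hre : ∀ z, ‖z‖ ≤ R / 3 → f z = 0 → z.re ≤ 0) :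
    -(deriv f 0 / f 0).re ≤ 72 * log B / R := by
  obtain ⟨n, hn⟩ := pow_unbounded_of_one_lt B one_lt_two
  exact landau_aux hR hUo hB hU n f B hf hf0 (by linarith) le_rfl hn hK hre

lemma landau_zero {f : ℂ → ℂ} {U : Set ℂ} {R B : ℝ} (hR : 0 < R) (hUo : IsOpen U) (hB : 1 < B)
    (hU : Metric.closedBall 0 R ⊆ U) (hf : DifferentiableOn ℂ f U) (hf0 : f 0 ≠ 0)
    (hK : ∀ z : ℂ, ‖z‖ = R → ‖f z‖ ≤ B * ‖f 0‖) (hre : ∀ z, ‖z‖ ≤ R / 3 → f z = 0 → z.re ≤ 0)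
    {ρ : ℂ} (hρ : ‖ρ‖ ≤ R / 3) (hfρ : f ρ = 0) :
    -(deriv f 0 / f 0).re ≤ (1 / ρ).re + 72 * log B / R := by
  obtain ⟨g, hg, hg0, hfg, hgK, hgd⟩ := split_zero hR hUo hU hf hf0 (by linarith) hK hρ hfρ
  have h1 := landau hR hUo hB hU hg hg0 (fun z hz => (hgK z hz).trans (by gcongr; linarith))
    (fun z hz hgz => hre z hz (by rw [hfg, hgz, mul_zero]))
  rw [hgd, Complex.add_re, Complex.neg_re]
  linarith

end
end VK

namespace VK
open Real Filter Topology
open ArithmeticFunction hiding log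

noncomputable section

lemma hasSum_vM {s : ℂ} (hs : 1 < s.re) :
    HasSum (fun n : ℕ => (vonMangoldt n:ℂ) * (n:ℂ) ^ (-s)) (-(deriv riemannZeta s / riemannZeta s)) := by
  have h1 := (LSeriesSummable_vonMangoldt hs).LSeriesHasSum
  rw [LSeries_vonMangoldt_eq_deriv_riemannZeta_div hs] at h1
  rw [← neg_div]
  refine h1.congr_fun (fun n => ?_)
  rcases eq_or_ne n 0 with rfl | hn
  · simp
  · rw [LSeries.term_of_ne_zero hn, Complex.cpow_neg]; rfl

lemma re_vM_term (σ t:ℝ) (n:ℕ) :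
    ((vonMangoldt n:ℂ) * (n:ℂ) ^ (-((σ:ℂ) + t * Complex.I))).re = vonMangoldt n * (n:ℝ) ^ (-σ) * cos (t * log n) := by
  rcases Nat.eq_zero_or_pos n with rfl | hn
  · simp
  rw [cpow_eq_ff hn, ← mul_assoc, ← Complex.ofReal_mul, Complex.re_ofReal_mul]
  congr 1
  rw [ff, ee, Complex.exp_ofReal_mul_I_re, ← cos_neg]
  congr 1; field_simp

/-- `-ζ'/ζ` -/
def nld (s:ℂ) : ℂ := -(deriv riemannZeta s / riemannZeta s)

lemma hasSum_re {σ : ℝ} (hσ : 1 < σ) (t:ℝ) :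
    HasSum (fun n : ℕ => vonMangoldt n * (n:ℝ) ^ (-σ) * cos (t * log n)) (nld ((σ:ℂ) + t * Complex.I)).re := by
  have := (hasSum_vM (s := (σ:ℂ) + t * Complex.I) (by simpa using hσ))
  have h2 := Complex.hasSum_re this
  simpa only [re_vM_term, nld] using h2

lemma hasSum_re0 {σ : ℝ} (hσ : 1 < σ) :
    HasSum (fun n : ℕ => vonMangoldt n * (n:ℝ) ^ (-σ)) (nld (σ:ℂ)).re := by
  simpa using hasSum_re hσ 0

lemma vm341 {σ : ℝ} (hσ : 1 < σ) (t:ℝ) :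
    0 ≤ 3 * (nld (σ:ℂ)).re + 4 * (nld ((σ:ℂ) + t * Complex.I)).re + (nld ((σ:ℂ) + (2 * t:ℝ) * Complex.I)).re := by
  have h := (((hasSum_re0 hσ).mul_left 3).add ((hasSum_re hσ t).mul_left 4)).add (hasSum_re hσ (2 * t))
  refine h.nonneg fun n => ?_
  have h1 : cos (2 * t * log n) = 2 * cos (t * log n) ^ 2 - 1 := by rw [mul_assoc, cos_two_mul]
  rw [h1]
  have h2 : 0 ≤ (vonMangoldt n * (n:ℝ) ^ (-σ)) * (2 * (1 + cos (t * log n)) ^ 2) :=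
    mul_nonneg (mul_nonneg vonMangoldt_nonneg (by positivity)) (by positivity)
  refine h2.trans (le_of_eq (by ring))

lemma norm_nld_le {s : ℂ} {σ : ℝ} (hσ : 1 < σ) (h : σ ≤ s.re) : ‖nld s‖ ≤ (nld (σ:ℂ)).re := by
  refine (hasSum_vM (by linarith)).norm_le_of_bounded (hasSum_re0 hσ) fun n => ?_
  rw [norm_mul, Complex.norm_real, Real.norm_of_nonneg vonMangoldt_nonneg]
  refine mul_le_mul_of_nonneg_left ?_ vonMangoldt_nonneg
  rcases Nat.eq_zero_or_pos n with rfl | hn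
  · rw [Nat.cast_zero, Complex.zero_cpow, norm_zero]
    · positivity
    · intro h; have := congrArg Complex.re h; simp at this; linarith
  rw [Complex.norm_natCast_cpow_of_pos hn]
  exact rpow_le_rpow_of_exponent_le (by exact_mod_cast hn) (by simpa using h)

lemma nld_real_le : ∃ C > (0:ℝ), ∃ d0 > (0:ℝ), ∀ d, 0 < d → d < d0 → (nld ((1 + d:ℝ):ℂ)).re ≤ 1 / d + C := by
  obtain ⟨C, hC, h⟩ := log_deriv_riemannZeta_add_inv_sub_bounded.exists_pos
  have h1 := h.bound
  rw [eventually_nhdsWithin_iff, Metric.eventually_nhds_iff] at h1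
  obtain ⟨d0, hd0, h2⟩ := h1
  refine ⟨C, hC, d0, hd0, fun d hd hdd => ?_⟩
  have h3 := @h2 ((1 + d:ℝ):ℂ) (by simp [abs_of_pos hd, hdd]) (by simp [hd.ne'])
  have h4 := (Complex.abs_re_le_norm _).trans h3
  simp only [norm_one, mul_one] at h4
  have h5 := neg_le_of_abs_le h4
  have e : (((1 + d:ℝ):ℂ) - 1)⁻¹ = ((1 / d:ℝ):ℂ) := by push_cast; simp
  rw [Complex.add_re, e, Complex.ofReal_re] at h5
  rw [nld, Complex.neg_re]; linarith

lemma zeta_lower {s : ℂ} {d : ℝ} (hd : 0 < d) (hd1 : d ≤ 1) (hs : 1 + d ≤ s.re) : d / 3 ≤ ‖riemannZeta s‖ := by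
  have hs1 : 1 < s.re := by linarith
  have h1 := LSeries_zeta_mul_Lseries_moebius hs1
  rw [LSeries_zeta_eq_riemannZeta hs1] at h1
  have hre : (((1 + d:ℝ):ℂ)).re = 1 + d := Complex.ofReal_re _
  have h2 : ‖LSeries (fun n => ((ArithmeticFunction.moebius n:ℤ):ℂ)) s‖ ≤ (riemannZeta ((1 + d:ℝ):ℂ)).re := by
    have h3 := Complex.hasSum_re (LSeriesHasSum_zeta (s := ((1 + d:ℝ):ℂ)) (by rw [hre]; linarith))
    refine (LSeriesSummable_moebius_iff.mpr hs1).LSeriesHasSum.norm_le_of_bounded h3 fun n => ?_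
    rcases eq_or_ne n 0 with rfl | hn
    · simp
    rw [LSeries.norm_term_eq, if_neg hn, LSeries.term_of_ne_zero hn]
    have hn1 : (1:ℝ) ≤ n := by exact_mod_cast Nat.one_le_iff_ne_zero.mpr hn
    have hn0 : (0:ℝ) < n := by linarith
    have e : ((((ArithmeticFunction.zeta n:ℕ):ℂ)) / (n:ℂ) ^ ((1 + d:ℝ):ℂ)) = ((1 / (n:ℝ) ^ (1 + d):ℝ):ℂ) := by
      rw [zeta_apply_ne hn]; push_cast [Complex.ofReal_cpow hn0.le]; rfl
    rw [e, Complex.ofReal_re]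
    gcongr
    have : |moebius n| ≤ 1 := abs_moebius_le_one
    rw [Complex.norm_intCast]; exact_mod_cast this
  have h4 := zeta_approx (s := ((1 + d:ℝ):ℂ)) (by rw [hre]; linarith) (by simp [hd.ne']) (N := 1) le_rfl
  simp only [Finset.Icc_self, Finset.sum_singleton, Nat.cast_one, Complex.one_cpow, Real.one_rpow, mul_one, hre] at h4
  rw [Complex.norm_real, Real.norm_of_nonneg (by linarith), div_self (by linarith)] at h4
  have h5 := (Complex.re_le_norm _).trans h4
  have e : (1:ℂ) / (((1 + d:ℝ):ℂ) - 1) = ((1 / d:ℝ):ℂ) := by push_cast; simp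
  rw [e, Complex.sub_re, Complex.sub_re, Complex.ofReal_re, Complex.one_re] at h5
  have h6 : (riemannZeta ((1 + d:ℝ):ℂ)).re ≤ 3 / d := by
    have : 1 ≤ 1 / d := by rw [le_div_iff₀ hd]; linarith
    have e3 : 3 / d = 3 * (1 / d) := by ring
    linarith
  have h7 : ‖riemannZeta s‖ * ‖LSeries (fun n => ((ArithmeticFunction.moebius n:ℤ):ℂ)) s‖ = 1 := by
    rw [← norm_mul, h1, norm_one]
  have h8 : 1 ≤ ‖riemannZeta s‖ * (3 / d) := by
    rw [← h7]; gcongr; linarith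
  rw [mul_div_assoc', le_div_iff₀ hd] at h8
  linarith

def kap : ℝ := 1 / 10 ^ 9

lemma growth_ev : ∃ T > (3:ℝ), ∀ t ≥ T, ∀ t' : ℝ, t / 2 ≤ t' → t' ≤ 3 * t → ∀ σ : ℝ,
    1 - kap * (log t) ^ (-(2:ℝ)/3) ≤ σ → σ ≤ 2 → ‖riemannZeta ((σ:ℂ) + t' * Complex.I)‖ ≤ 2 * exp 34 * log t := by
  have hY : Tendsto (fun t : ℝ => (log (t / 2)) ^ ((1:ℝ)/3)) atTop atTop :=
    (tendsto_rpow_atTop (by norm_num)).comp (tendsto_log_atTop.comp (tendsto_id.atTop_div_const (by norm_num)))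
  have hb : ∀ᶠ Y : ℝ in atTop, (330 * Y ^ 3 + 1) * exp (7 * Y) ≤ exp (Y ^ 3 / 8) := by
    have h1 := (tendsto_pow_mul_exp_neg_atTop_nhds_zero 3).eventually (ge_mem_nhds (show (0:ℝ) < 1/331 by norm_num))
    filter_upwards [h1, eventually_ge_atTop (8:ℝ)] with Y h1 h8
    have h2 : 330 * Y ^ 3 + 1 ≤ exp Y := by
      have h3 : 1 ≤ Y ^ 3 := one_le_pow₀ (by linarith)
      rw [exp_neg, ← div_eq_mul_inv, div_le_iff₀ (exp_pos _)] at h1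
      linarith
    calc _ ≤ exp Y * exp (7 * Y) := by gcongr
      _ = exp (8 * Y) := by rw [← exp_add]; congr 1; ring
      _ ≤ _ := by
        gcongr
        have : 8 ^ 2 * Y ≤ Y ^ 3 := by rw [pow_succ Y 2]; gcongr
        linarith
  obtain ⟨Y0, hY0⟩ := eventually_atTop.mp hb
  obtain ⟨T, hT⟩ := eventually_atTop.mp (hY.eventually (eventually_ge_atTop (max 2 Y0)))
  refine ⟨max T 4, lt_max_of_lt_right (by norm_num), fun t ht t' h1 h2 σ hσ hσ2 => ?_⟩
  have ht4 : 4 ≤ t := (le_max_right _ _).trans ht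
  have hlt : 0 < log t := log_pos (by linarith)
  have hY1 := hT t ((le_max_left _ _).trans ht)
  set Y := (log t') ^ ((1:ℝ)/3) with hYd
  have hl' : 0 < log t' := log_pos (by linarith)
  have hYY : max 2 Y0 ≤ Y := hY1.trans (rpow_le_rpow (log_nonneg (by linarith)) (log_le_log (by linarith) h1) (by norm_num))
  have hY3 : Y ^ 3 = log t' := by
    rw [hYd, ← rpow_natCast, ← rpow_mul hl'.le]; norm_num
  have hY2 : Y ^ 2 = (log t') ^ ((2:ℝ)/3) := by
    rw [hYd, ← rpow_natCast, ← rpow_mul hl'.le]; norm_num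
  have hl2 : log t' ≤ 2 * log t := by
    rw [show 2 * log t = log (t ^ 2) by rw [log_pow]; norm_num]
    exact log_le_log (by linarith) (by nlinarith)
  have hη : kap * (log t) ^ (-(2:ℝ)/3) * Y ^ 2 ≤ 1 / 10 ^ 8 := by
    rw [hY2]
    have h3 : (log t') ^ ((2:ℝ)/3) ≤ 2 * (log t) ^ ((2:ℝ)/3) := by
      calc (log t') ^ ((2:ℝ)/3) ≤ (2 * log t) ^ ((2:ℝ)/3) := by gcongr
        _ = 2 ^ ((2:ℝ)/3) * (log t) ^ ((2:ℝ)/3) := mul_rpow (by norm_num) hlt.le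
        _ ≤ 2 ^ (1:ℝ) * (log t) ^ ((2:ℝ)/3) := by gcongr <;> norm_num
        _ = _ := by rw [rpow_one]
    have h4 : (log t) ^ (-(2:ℝ)/3) * (log t) ^ ((2:ℝ)/3) = 1 := by
      rw [← rpow_add hlt]; norm_num
    calc kap * (log t) ^ (-(2:ℝ)/3) * (log t') ^ ((2:ℝ)/3)
        ≤ kap * (log t) ^ (-(2:ℝ)/3) * (2 * (log t) ^ ((2:ℝ)/3)) := by gcongr; unfold kap; positivity
      _ = 2 * kap * ((log t) ^ (-(2:ℝ)/3) * (log t) ^ ((2:ℝ)/3)) := by ring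
      _ ≤ _ := by rw [h4]; unfold kap; norm_num
  have h5 := zeta_growth (Y := Y) (σ := σ) (le_of_max_le_left hYY) (hY0 Y (le_of_max_le_right hYY))
    (η := kap * (log t) ^ (-(2:ℝ)/3)) (by unfold kap; positivity) hη hσ hσ2
  rw [hY3, exp_log (by linarith)] at h5
  refine h5.trans ?_
  calc exp 34 * log t' ≤ exp 34 * (2 * log t) := by gcongr
    _ = _ := by ring

end
end VK

namespace VK
open Real Filter Topology

noncomputable section

lemma nld_shift (c:ℂ) : -(deriv (fun z => riemannZeta (c + z)) 0 / riemannZeta (c + 0)).re = (nld c).re := by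
  rw [deriv_comp_const_add, add_zero, nld, Complex.neg_re]

lemma zeta_diff_ball {c : ℂ} (hc : 1 < c.im) :
    DifferentiableOn ℂ (fun z => riemannZeta (c + z)) (Metric.ball 0 1) := by
  intro z hz
  have hne : c + z ≠ 1 := by
    intro h
    have h1 := congrArg Complex.im h
    simp only [Complex.add_im, Complex.one_im] at h1
    have h2 := Complex.abs_im_le_norm z
    have h3 := neg_le_of_abs_le h2
    simp only [Metric.mem_ball, dist_zero_right] at hz
    linarith
  exact ((differentiableAt_riemannZeta hne).comp z ((differentiableAt_id).const_add c)).differentiableWithinAt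

lemma center1 {c : ℂ} {d R G : ℝ} (hc : c.re = 1 + d) (hci : 1 < c.im) (hd : 0 < d) (hd2 : d ≤ 1 / 2)
    (hR0 : 0 < R) (hR : R ≤ 1 / 2) (hG1 : 1 < 3 * G / d)
    (hG : ∀ z : ℂ, ‖z‖ ≤ R → ‖riemannZeta (c + z)‖ ≤ G) :
    (nld c).re ≤ 72 * log (3 * G / d) / R ∧ ∀ σ : ℝ, σ < 1 → 1 - d / 4 ≤ σ → 5 * d / 4 ≤ R / 3 →
      riemannZeta ((σ:ℂ) + c.im * Complex.I) = 0 → (nld c).re ≤ -(4 / (5 * d)) + 72 * log (3 * G / d) / R := by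
  have hlow : d / 3 ≤ ‖riemannZeta (c + 0)‖ := zeta_lower hd (by linarith) (by simp [hc])
  have h0 : riemannZeta (c + 0) ≠ 0 := norm_pos_iff.mp (by linarith)
  have hK : ∀ z : ℂ, ‖z‖ = R → ‖riemannZeta (c + z)‖ ≤ 3 * G / d * ‖riemannZeta (c + 0)‖ := by
    intro z hz
    refine (hG z hz.le).trans ?_
    calc G = 3 * G / d * (d / 3) := by field_simp
      _ ≤ _ := by gcongr
  have hre : ∀ z : ℂ, ‖z‖ ≤ R / 3 → riemannZeta (c + z) = 0 → z.re ≤ 0 := by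
    intro z _ hz
    by_contra h
    exact riemannZeta_ne_zero_of_one_lt_re (s := c + z) (by simp [hc]; linarith) hz
  have hU : Metric.closedBall (0:ℂ) R ⊆ Metric.ball 0 1 := Metric.closedBall_subset_ball (by linarith)
  rw [← nld_shift]
  refine ⟨landau (f := fun z => riemannZeta (c + z)) hR0 Metric.isOpen_ball hG1 hU (zeta_diff_ball hci) h0 hK hre, ?_⟩
  intro σ hσ1 hσ h5 hz
  have hρn : ‖((σ - 1 - d:ℝ):ℂ)‖ ≤ R / 3 := by
    rw [Complex.norm_real, Real.norm_eq_abs, abs_le]; constructor <;> linarith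
  have e : c + ((σ - 1 - d:ℝ):ℂ) = (σ:ℂ) + c.im * Complex.I := by
    apply Complex.ext <;> simp [hc]
  have h1 := landau_zero (f := fun z => riemannZeta (c + z)) hR0 Metric.isOpen_ball hG1 hU (zeta_diff_ball hci) h0 hK hre
    hρn (by simpa only [e] using hz)
  refine h1.trans (add_le_add_left ?_ _)
  have e2 : (1 / ((σ - 1 - d:ℝ):ℂ)) = ((1 / (σ - 1 - d):ℝ):ℂ) := by push_cast; rfl
  rw [e2, Complex.ofReal_re, show σ - 1 - d = -(1 + d - σ) by ring, div_neg]
  refine neg_le_neg ?_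
  rw [div_le_div_iff₀ (by linarith) (by linarith)]
  linarith

lemma ev_cond {ε : ℝ} (hε : 0 < ε) (A k:ℝ) (hk : 0 < k) (M:ℝ) (hM : 0 < M) :
    ∀ᶠ L : ℝ in atTop, A + k * (log (M * L / L ^ (-(2:ℝ)/3 - ε)) / L ^ (-(2:ℝ)/3)) < 1 / L ^ (-(2:ℝ)/3 - ε) / 5 := by
  have h1 : Tendsto (fun L : ℝ => L ^ ε) atTop atTop := tendsto_rpow_atTop hε
  have h2 := ((isLittleO_log_rpow_atTop hε).const_mul_left (k * (5 / 3 + ε))).bound (show (0:ℝ) < 1/20 by norm_num)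
  filter_upwards [h2, h1.eventually (eventually_gt_atTop (20 * (|A| + k * |log M|))), eventually_ge_atTop (1:ℝ)] with L h2 h3 hL
  have hL0 : 0 < L := by linarith
  have hlog : log (M * L / L ^ (-(2:ℝ)/3 - ε)) = log M + (5 / 3 + ε) * log L := by
    rw [log_div (by positivity) (by positivity), log_mul hM.ne' hL0.ne', log_rpow hL0]; ring
  have hX : 1 ≤ L ^ ((2:ℝ)/3) := one_le_rpow hL (by norm_num)
  have e1 : 1 / L ^ (-(2:ℝ)/3 - ε) = L ^ ((2:ℝ)/3) * L ^ ε := by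
    rw [← rpow_add hL0, one_div, ← rpow_neg hL0.le]; congr 1; ring
  have e2 : ∀ y : ℝ, y / L ^ (-(2:ℝ)/3) = y * L ^ ((2:ℝ)/3) := by
    intro y; rw [div_eq_mul_inv, ← rpow_neg hL0.le]; congr 2; ring
  rw [hlog, e1, e2]
  have h5 := le_trans (le_abs_self _) h2
  rw [Real.norm_of_nonneg (by positivity)] at h5
  have h6 : A ≤ |A| * L ^ ((2:ℝ)/3) := (le_abs_self A).trans (le_mul_of_one_le_right (abs_nonneg A) hX)
  have h7 : k * log M ≤ k * |log M| := by gcongr; exact le_abs_self _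
  calc A + k * ((log M + (5 / 3 + ε) * log L) * L ^ ((2:ℝ)/3))
      ≤ |A| * L ^ ((2:ℝ)/3) + (k * |log M| + 1 / 20 * L ^ ε) * L ^ ((2:ℝ)/3) := by
        have e : k * ((log M + (5 / 3 + ε) * log L) * L ^ ((2:ℝ)/3)) =
          (k * log M + k * (5 / 3 + ε) * log L) * L ^ ((2:ℝ)/3) := by ring
        rw [e]; gcongr
    _ = (|A| + k * |log M| + 1 / 20 * L ^ ε) * L ^ ((2:ℝ)/3) := by ring
    _ < (L ^ ε / 20 + 1 / 20 * L ^ ε) * L ^ ((2:ℝ)/3) := by gcongr; linarith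
    _ ≤ (L ^ ε / 5) * L ^ ((2:ℝ)/3) := by gcongr; linarith [show 0 ≤ L ^ ε by positivity]
    _ = _ := by ring

lemma ev_small {ε : ℝ} (hε : 0 < ε) (a:ℝ) (ha : 0 < a) :
    ∀ᶠ L : ℝ in atTop, L ^ (-(2:ℝ)/3 - ε) ≤ a * L ^ (-(2:ℝ)/3) ∧ L ^ (-(2:ℝ)/3) ≤ a := by
  have h1 : Tendsto (fun L : ℝ => L ^ (-ε)) atTop (𝓝 0) := tendsto_rpow_neg_atTop hε
  have h2 : Tendsto (fun L : ℝ => L ^ (-((2:ℝ)/3))) atTop (𝓝 0) := tendsto_rpow_neg_atTop (by norm_num)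
  filter_upwards [h1.eventually (ge_mem_nhds ha), h2.eventually (ge_mem_nhds ha), eventually_gt_atTop 0] with L h1 h2 hL
  rw [← neg_div] at h2
  refine ⟨?_, h2⟩
  rw [sub_eq_add_neg, rpow_add hL, mul_comm]
  gcongr

theorem zero_free {ε : ℝ} (hε : 0 < ε) : ∃ T > (3:ℝ), ∀ t ≥ T, ∀ σ : ℝ, 1 - (log t) ^ (-(2:ℝ)/3 - ε) / 4 ≤ σ →
    riemannZeta ((σ:ℂ) + t * Complex.I) ≠ 0 := by
  obtain ⟨T1, hT1, hG⟩ := growth_ev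
  obtain ⟨C, hC, d0, hd0, hreal⟩ := nld_real_le
  have hk : 0 < kap := by unfold kap; norm_num
  have hev := ((ev_cond hε (3 * C) (5 * (72 / kap)) (by positivity) (6 * exp 34) (by positivity)).and
    ((ev_small hε (4 * kap / 15) (by positivity)).and ((ev_small hε (min 1 d0 / 2) (by positivity)).and
      (eventually_ge_atTop 1))))
  obtain ⟨T2, hT2⟩ := eventually_atTop.mp (tendsto_log_atTop.eventually hev)
  refine ⟨max T1 T2, lt_max_of_lt_left hT1, fun t ht σ hσ hz => ?_⟩
  have htT1 := (le_max_left _ _).trans ht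
  obtain ⟨hc1, ⟨hc2, hc5⟩, ⟨hc3, hc4⟩, hL⟩ := hT2 t ((le_max_right _ _).trans ht)
  set L := log t with hLd
  set d := L ^ (-(2:ℝ)/3 - ε) with hdd
  have hd : 0 < d := by positivity
  have hX : 0 < L ^ (-(2:ℝ)/3) := by positivity
  set X := L ^ (-(2:ℝ)/3) with hXd
  have hX1 : X ≤ 1 := rpow_le_one_of_one_le_of_nonpos hL (by norm_num)
  have hdm : d ≤ min 1 d0 / 2 := hc3.trans (mul_le_of_le_one_right (by positivity) hX1)
  have hd1 : d ≤ 1 / 2 := hdm.trans (by gcongr; exact min_le_left _ _)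
  have hdd0 : d < d0 := by
    have := min_le_right 1 d0; linarith
  have hR : kap * X ≤ 1 / 2 := by
    calc kap * X ≤ kap * 1 := by gcongr
      _ ≤ 1 / 2 := by unfold kap; norm_num
  have hσ1 : σ < 1 := by
    by_contra h
    exact riemannZeta_ne_zero_of_one_le_re (s := (σ:ℂ) + t * Complex.I) (by simp; linarith) hz
  have hG' : ∀ t', t ≤ t' → t' ≤ 2 * t → ∀ z : ℂ, ‖z‖ ≤ kap * X → ‖riemannZeta (((1 + d:ℝ):ℂ) + t' * Complex.I + z)‖ ≤ 2 * exp 34 * L := by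
    intro t' h1 h2 z hz
    obtain ⟨h3, h3'⟩ := abs_le.mp ((Complex.abs_re_le_norm z).trans hz)
    obtain ⟨h4, h4'⟩ := abs_le.mp ((Complex.abs_im_le_norm z).trans hz)
    have h5 := hG t htT1 (t' + z.im) (by linarith) (by linarith) (1 + d + z.re) (by rw [← hLd, ← hXd]; linarith) (by linarith)
    convert h5 using 3
    apply Complex.ext <;> simp
  have hB : 1 < 3 * (2 * exp 34 * L) / d := by
    rw [lt_div_iff₀ hd]
    have : 1 ≤ exp 34 := one_le_exp (by norm_num)
    have := one_le_mul_of_one_le_of_one_le this hL; linarith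
  have h1 := (center1 (c := ((1 + d:ℝ):ℂ) + t * Complex.I) (d := d) (by simp) (by simp; linarith) hd hd1 (by positivity) hR
    hB (hG' t le_rfl (by linarith))).2 σ hσ1 hσ (by linarith) (by simpa using hz)
  have h2 := (center1 (c := ((1 + d:ℝ):ℂ) + (2 * t:ℝ) * Complex.I) (d := d) (by simp) (by simp; linarith) hd hd1 (by positivity) hR
    hB (hG' (2 * t) (by linarith) le_rfl)).1
  have h3 := vm341 (σ := 1 + d) (by linarith) t
  have h4 := hreal d hd hdd0
  have e : 72 * log (3 * (2 * exp 34 * L) / d) / (kap * X) = 72 / kap * (log (6 * exp 34 * L / d) / X) := by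
    rw [show 3 * (2 * exp 34 * L) = 6 * exp 34 * L by ring]; field_simp
  rw [e] at h1 h2
  have e2 : 4 / (5 * d) = 4 * (1 / d) / 5 := by field_simp
  linarith

end
end VK

namespace VK
open Real Filter Topology

noncomputable section

theorem nld_bound {ε : ℝ} (hε : 0 < ε) (hε3 : ε ≤ 1 / 3) : ∃ T > (3:ℝ), ∃ C > (0:ℝ), ∀ t ≥ T, ∀ σ : ℝ,
    1 - (log t) ^ (-(2:ℝ)/3 - ε) / 16 ≤ σ → σ ≤ 2 → 
    riemannZeta ((σ:ℂ) + t * Complex.I) ≠ 0 ∧ 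
    ‖nld ((σ:ℂ) + t * Complex.I)‖ ≤ C * (log t) ^ 3 ∧ ‖riemannZeta ((σ:ℂ) + t * Complex.I)‖ ≤ C * (log t) ^ 3 := by
  obtain ⟨T1, hT1, hG⟩ := growth_ev
  obtain ⟨T3, hT3, hZ⟩ := zero_free hε
  obtain ⟨C, hC, d0, hd0, hreal⟩ := nld_real_le
  have hk : 0 < kap := by unfold kap; norm_num
  have hev := ((ev_small hε kap (by positivity)).and ((ev_small hε (min 1 d0 / 2) (by positivity)).and
      (eventually_ge_atTop 1)))
  obtain ⟨T2, hT2⟩ := eventually_atTop.mp (tendsto_log_atTop.eventually hev)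
  have hC1 : 0 < 96 * (48 * (2 * exp 34)) + 16 + C := by positivity
  refine ⟨max T1 (max T2 (T3 + 1)), lt_max_of_lt_left hT1, 96 * (48 * (2 * exp 34)) + 16 + C, hC1, fun t ht σ hσ hσ2 => ?_⟩
  have htT1 := (le_max_left _ _).trans ht
  have htT3 := (le_max_right _ _).trans ((le_max_right _ _).trans ht)
  obtain ⟨⟨hc2, hc5⟩, ⟨hc3, hc4⟩, hL⟩ := hT2 t ((le_max_left _ _).trans ((le_max_right _ _).trans ht))
  have hzf := hZ t (by linarith) σ
  set L := log t with hLd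
  have hL0 : 0 < L := by linarith
  set d := L ^ (-(2:ℝ)/3 - ε) with hdd
  have hd : 0 < d := by positivity
  have hX : 0 < L ^ (-(2:ℝ)/3) := by positivity
  set X := L ^ (-(2:ℝ)/3) with hXd
  have hX1 : X ≤ 1 := rpow_le_one_of_one_le_of_nonpos hL (by norm_num)
  have hdm : d ≤ min 1 d0 / 2 := hc3.trans (mul_le_of_le_one_right (by positivity) hX1)
  have hd1 : d ≤ 1 / 2 := hdm.trans (by gcongr; exact min_le_left _ _)
  have hdd0 : d < d0 := by
    have := min_le_right 1 d0; linarith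
  have hdL : 1 / d ≤ L := by
    rw [hdd, one_div, ← rpow_neg hL0.le]
    calc L ^ (-(-(2:ℝ)/3 - ε)) ≤ L ^ (1:ℝ) := rpow_le_rpow_of_exponent_le hL (by linarith)
      _ = L := rpow_one L
  have hL3 : L ≤ L ^ 3 := le_self_pow₀ hL (by norm_num)
  have hL31 : 1 ≤ L ^ 3 := one_le_pow₀ hL
  have he : 1 ≤ exp 34 := one_le_exp (by norm_num)
  have hmul : ∀ a : ℝ, 0 ≤ a → a ≤ a * L ^ 3 := fun a ha => le_mul_of_one_le_right ha hL31
  refine ⟨hzf (by linarith), ?_, ?_⟩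
  swap
  · refine (hG t htT1 t (by linarith) (by linarith) σ (by rw [← hLd, ← hXd]; linarith) hσ2).trans ?_
    have h1 : 2 * exp 34 * L ≤ 2 * exp 34 * L ^ 3 := by gcongr
    have h2 : 2 * exp 34 * L ^ 3 ≤ (96 * (48 * (2 * exp 34)) + 16 + C) * L ^ 3 := by gcongr; linarith
    linarith
  rcases le_total (1 + d / 16) σ with h | h
  · refine (norm_nld_le (σ := 1 + d / 16) (by linarith) (by simpa using h)).trans ?_
    refine (hreal (d / 16) (by linarith) (by linarith)).trans ?_
    have e : 1 / (d / 16) = 16 * (1 / d) := by field_simp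
    rw [e]
    have h1 : C ≤ C * L ^ 3 := hmul C hC.le
    have h2 : 0 ≤ 96 * (48 * (2 * exp 34)) * L ^ 3 := by positivity
    have h3 : (96 * (48 * (2 * exp 34)) + 16 + C) * L ^ 3 = 96 * (48 * (2 * exp 34)) * L ^ 3 + 16 * L ^ 3 + C * L ^ 3 := by ring
    rw [h3]; linarith
  have hlogt : ∀ t', t - 1 ≤ t' → t' ≤ t + 1 → d * (3 / 4) ≤ (log t') ^ (-(2:ℝ)/3 - ε) := by
    intro t' h1 h2
    have h3 : log t' ≤ 4 / 3 * L := by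
      have h4 : log t' ≤ log (t * (1 + 1 / t)) := log_le_log (by linarith) (by
        rw [mul_add, mul_one_div_cancel (by linarith)]; linarith)
      have h5 : 1 / t ≤ 1 / 3 := one_div_le_one_div_of_le (by norm_num) (by linarith)
      have h6 : 0 < 1 / t := one_div_pos.mpr (by linarith)
      rw [log_mul (by linarith) (by linarith)] at h4
      have := log_le_sub_one_of_pos (show 0 < 1 + 1 / t by linarith)
      linarith
    have h5 : 0 < log t' := log_pos (by linarith)
    calc d * (3 / 4) ≤ (4 / 3:ℝ) ^ (-(2:ℝ)/3 - ε) * d := by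
          rw [mul_comm]; gcongr
          calc (3 / 4:ℝ) = (4 / 3:ℝ) ^ (-1:ℝ) := by rw [rpow_neg_one]; norm_num
            _ ≤ _ := rpow_le_rpow_of_exponent_le (by norm_num) (by linarith)
      _ = (4 / 3 * L) ^ (-(2:ℝ)/3 - ε) := by rw [mul_rpow (by norm_num) hL0.le]
      _ ≤ _ := rpow_le_rpow_of_nonpos h5 h3 (by linarith)
  set c : ℂ := ((1 + d / 16:ℝ):ℂ) + t * Complex.I with hcd
  have hrep : ∀ z : ℂ, c + z = ((1 + d / 16 + z.re:ℝ):ℂ) + ((t + z.im:ℝ):ℂ) * Complex.I := by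
    intro z; apply Complex.ext <;> simp [c]
  have hin : ∀ z ∈ Metric.ball (0:ℂ) (d / 4), |z.re| ≤ d / 4 ∧ |z.im| ≤ d / 4 := by
    intro z hz
    rw [mem_ball_zero_iff] at hz
    exact ⟨(Complex.abs_re_le_norm z).trans hz.le, (Complex.abs_im_le_norm z).trans hz.le⟩
  have hlow : d / 48 ≤ ‖riemannZeta (c + 0)‖ := by
    have := zeta_lower (s := c + 0) (d := d / 16) (by linarith) (by linarith) (by simp [c])
    linarith
  have hB : 1 < 48 * (2 * exp 34 * L) / d := by
    rw [lt_div_iff₀ hd]; have := one_le_mul_of_one_le_of_one_le (one_le_exp (by norm_num : (0:ℝ) ≤ 34)) hL; linarith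
  have key := logDeriv_bound (f := fun z => riemannZeta (c + z)) (r := d / 4) (B := 48 * (2 * exp 34 * L) / d) (by linarith) hB
    ((zeta_diff_ball (by simp [c]; linarith)).mono (Metric.ball_subset_ball (by linarith))) ?_ ?_
    (z := ((σ - 1 - d / 16:ℝ):ℂ)) ?_
  · have e : c + ((σ - 1 - d / 16:ℝ):ℂ) = (σ:ℂ) + t * Complex.I := by
      apply Complex.ext <;> simp [c]
    rw [deriv_comp_const_add, e] at key
    rw [nld, norm_neg]
    refine key.trans ?_
    have h1 : log (48 * (2 * exp 34 * L) / d) ≤ 48 * (2 * exp 34 * L) / d := by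
      have := log_le_sub_one_of_pos (show 0 < 48 * (2 * exp 34 * L) / d by positivity)
      linarith
    calc 24 * log (48 * (2 * exp 34 * L) / d) / (d / 4) ≤ 24 * (48 * (2 * exp 34 * L) / d) / (d / 4) := by gcongr
      _ = 96 * (48 * (2 * exp 34)) * (L * (1 / d) * (1 / d)) := by field_simp; norm_num
      _ ≤ 96 * (48 * (2 * exp 34)) * (L * L * L) := by gcongr
      _ = 96 * (48 * (2 * exp 34)) * L ^ 3 := by ring
      _ ≤ _ := by gcongr; linarith
  · intro z hz
    obtain ⟨h1, h2⟩ := hin z hz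
    rw [abs_le] at h1 h2
    obtain ⟨h1, h1'⟩ := h1
    obtain ⟨h2, h2'⟩ := h2
    simp only [hrep]
    refine hZ _ (by linarith) _ ?_
    have := hlogt (t + z.im) (by linarith) (by linarith)
    linarith
  · intro z hz
    obtain ⟨h1, h2⟩ := hin z hz
    rw [abs_le] at h1 h2
    obtain ⟨h1, h1'⟩ := h1
    obtain ⟨h2, h2'⟩ := h2
    have h5 := hG t htT1 (t + z.im) (by linarith) (by linarith) (1 + d / 16 + z.re) (by rw [← hLd, ← hXd]; linarith) (by linarith)
    simp only [hrep z]
    refine h5.trans ?_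
    calc 2 * exp 34 * L = 48 * (2 * exp 34 * L) / d * (d / 48) := by field_simp
      _ ≤ _ := by gcongr
  · rw [Complex.norm_real, Real.norm_eq_abs, abs_le]; constructor <;> linarith

def FF (s:ℂ) : ℂ := -(deriv riemannZeta₁ s / riemannZeta₁ s) - riemannZeta₀ s

lemma zeta1_ne {s : ℂ} (hs : s ≠ 1) (h : riemannZeta s ≠ 0) : riemannZeta₁ s ≠ 0 := by
  intro h0; rw [riemannZeta_eq_inv_sub_mul hs, h0, mul_zero] at h; exact h rfl

lemma zeta1_ne_of_re {s : ℂ} (hs : 1 ≤ s.re) : riemannZeta₁ s ≠ 0 := by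
  by_cases h : s = 1
  · simp [h]
  · exact zeta1_ne h (riemannZeta_ne_zero_of_one_le_re hs)

lemma FF_diff {s : ℂ} (h : riemannZeta₁ s ≠ 0) : DifferentiableAt ℂ FF s := by
  have h1 := differentiable_riemannZeta₁ s
  have h2 : DifferentiableAt ℂ (deriv riemannZeta₁) s := differentiable_riemannZeta₁.deriv s
  exact ((h2.div h1 h).neg).sub (differentiable_riemannZeta₀ s)

lemma FF_eq {s : ℂ} (hs : s ≠ 1) (h : riemannZeta s ≠ 0) : FF s = nld s - riemannZeta s := by
  have h1 := zeta1_ne hs h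
  have h2 : s - 1 ≠ 0 := sub_ne_zero.mpr hs
  have e : riemannZeta =ᶠ[𝓝 s] fun s => (s - 1)⁻¹ * riemannZeta₁ s := by
    filter_upwards [isOpen_ne.mem_nhds hs] with w hw
    exact riemannZeta_eq_inv_sub_mul hw
  have h3 : HasDerivAt (fun s => (s - 1)⁻¹ * riemannZeta₁ s) _ s :=
    (((hasDerivAt_id s).sub_const 1).inv h2).mul (differentiable_riemannZeta₁ s).hasDerivAt
  rw [nld, e.deriv_eq, h3.deriv, FF, riemannZeta_eq_inv_sub_add hs, ← riemannZeta_eq_inv_sub_add hs, riemannZeta_eq_inv_sub_mul hs]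
  have h0 : riemannZeta₀ s = (s - 1)⁻¹ * riemannZeta₁ s - (s - 1)⁻¹ := by
    rw [← riemannZeta_eq_inv_sub_mul hs, riemannZeta_eq_inv_sub_add hs]; ring
  rw [h0]; simp only [id, Pi.inv_apply]; field_simp; ring

lemma nld_conj (s:ℂ) : nld (star s) = star (nld s) := by
  have e : (starRingEnd ℂ ∘ riemannZeta ∘ starRingEnd ℂ : ℂ → ℂ) = riemannZeta := by
    funext z; have := riemannZeta_conj z
    simp only [Function.comp, this, Complex.conj_conj]
  have h := congrFun (deriv_conj_conj (f := riemannZeta) (𝕜 := ℂ)) (star s)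
  rw [e] at h
  simp only [Function.comp, Complex.star_def, Complex.conj_conj] at h
  simp only [nld, Complex.star_def, h, riemannZeta_conj, map_neg, map_div₀]

theorem region {ε : ℝ} (hε : 0 < ε) (hε3 : ε ≤ 1 / 3) : ∃ T0 > (3:ℝ), ∃ C > (0:ℝ), ∀ T ≥ T0, ∀ s : ℂ,
    1 - (log T) ^ (-(2:ℝ)/3 - ε) / 16 ≤ s.re → s.re ≤ 2 → |s.im| ≤ T →
    riemannZeta₁ s ≠ 0 ∧ ‖FF s‖ ≤ C * (log T) ^ 3 := by
  obtain ⟨T1, hT1, C1, hC1, hN⟩ := nld_bound hε hε3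
  set K := Set.Icc (1:ℝ) 2 ×ℂ Set.Icc (-T1) T1 with hK
  have hKc : IsCompact K := isCompact_Icc.reProdIm isCompact_Icc
  have hopen : IsOpen {s : ℂ | riemannZeta₁ s ≠ 0} :=
    isOpen_ne.preimage differentiable_riemannZeta₁.continuous
  obtain ⟨δ, hδ, hsub⟩ := hKc.exists_cthickening_subset_open hopen (fun s hs => zeta1_ne_of_re (by
    exact (Complex.mem_reProdIm.mp hs).1.1))
  obtain ⟨C2, hC2⟩ := (hKc.cthickening (r := δ)).exists_bound_of_continuousOn (f := FF)
    (fun s hs => (FF_diff (hsub hs)).continuousAt.continuousWithinAt)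
  obtain ⟨T2, hT2⟩ := eventually_atTop.mp (tendsto_log_atTop.eventually ((ev_small hε (min 1 δ) (by positivity)).and (eventually_ge_atTop 1)))
  refine ⟨max T1 T2, lt_max_of_lt_left hT1, 2 * C1 + |C2|, by positivity, fun T hT s h1 h2 h3 => ?_⟩
  obtain ⟨⟨h4, h5⟩, hL⟩ := hT2 T ((le_max_right _ _).trans hT)
  have hTT1 := (le_max_left _ _).trans hT
  have hL0 : 0 < log T := by linarith
  have hL31 : 1 ≤ (log T) ^ 3 := one_le_pow₀ hL
  have hd : 0 < (log T) ^ (-(2:ℝ)/3 - ε) := by positivity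
  have hX1 : (log T) ^ (-(2:ℝ)/3) ≤ 1 := rpow_le_one_of_one_le_of_nonpos hL (by norm_num)
  have hdm : (log T) ^ (-(2:ℝ)/3 - ε) ≤ min 1 δ := h4.trans (mul_le_of_le_one_right (by positivity) hX1)
  have hdδ := hdm.trans (min_le_right _ _)
  have big : ∀ s : ℂ, 1 - (log T) ^ (-(2:ℝ)/3 - ε) / 16 ≤ s.re → s.re ≤ 2 → T1 ≤ s.im → s.im ≤ T →
      riemannZeta s ≠ 0 ∧ ‖nld s‖ ≤ C1 * (log T) ^ 3 ∧ ‖riemannZeta s‖ ≤ C1 * (log T) ^ 3 := by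
    intro s h1 h2 h3 h3'
    have hl : 0 < log s.im := log_pos (by linarith)
    have hl2 : log s.im ≤ log T := log_le_log (by linarith) h3'
    have h6 := hN s.im h3 s.re (by
      have := rpow_le_rpow_of_nonpos hl hl2 (show -(2:ℝ)/3 - ε ≤ 0 by linarith)
      linarith) h2
    rw [Complex.re_add_im] at h6
    obtain ⟨h6, h7, h8⟩ := h6
    have : C1 * (log s.im) ^ 3 ≤ C1 * (log T) ^ 3 := by gcongr
    exact ⟨h6, h7.trans this, h8.trans this⟩
  rcases le_total T1 |s.im| with h | h
  · have main : riemannZeta s ≠ 0 ∧ ‖nld s‖ ≤ C1 * (log T) ^ 3 ∧ ‖riemannZeta s‖ ≤ C1 * (log T) ^ 3 := by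
      rcases le_total 0 s.im with hs | hs
      · rw [abs_of_nonneg hs] at h h3
        exact big s h1 h2 h h3
      · rw [abs_of_nonpos hs] at h h3
        have := big (star s) (by simpa using h1) (by simpa using h2) (by simpa using h) (by simpa using h3)
        rw [nld_conj, norm_star, show riemannZeta (star s) = star (riemannZeta s) from riemannZeta_conj s, norm_star,
          star_ne_zero] at this
        exact this
    obtain ⟨m1, m2, m3⟩ := main
    have hne : s ≠ 1 := by
      rintro rfl; simp at h; linarith
    refine ⟨zeta1_ne hne m1, ?_⟩
    rw [FF_eq hne m1]
    have h0 : 0 ≤ |C2| * (log T) ^ 3 := by positivity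
    have := norm_sub_le (nld s) (riemannZeta s)
    linarith
  · have hmem : s ∈ Metric.cthickening δ K := by
      have hmk : (⟨max s.re 1, s.im⟩:ℂ) ∈ K := by
        rw [hK, Complex.mem_reProdIm]
        exact ⟨⟨le_max_right _ _, max_le h2 one_le_two⟩, abs_le.mp h⟩
      refine Metric.mem_cthickening_of_dist_le s _ δ K hmk ?_
      rw [dist_eq_norm]
      have : s - ⟨max s.re 1, s.im⟩ = ((s.re - max s.re 1:ℝ):ℂ) := by apply Complex.ext <;> simp
      rw [this, Complex.norm_real, norm_eq_abs, abs_le]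
      constructor
      · rcases le_total s.re 1 with h' | h'
        · rw [max_eq_right h']; linarith
        · rw [max_eq_left h']; linarith
      · linarith [le_max_left s.re 1]
    refine ⟨hsub hmem, (hC2 s hmem).trans ((le_abs_self C2).trans ?_)⟩
    calc |C2| = |C2| * 1 := (mul_one _).symm
      _ ≤ (2 * C1 + |C2|) * (log T) ^ 3 := by gcongr; linarith

end
end VK

namespace VK
open Real Filter Topology MeasureTheory
open ArithmeticFunction hiding log

noncomputable section

def aa (n:ℕ) : ℝ := if n = 0 then 0 else vonMangoldt n - 1

lemma FF_hasSum {s : ℂ} (hs : 1 < s.re) : HasSum (fun n : ℕ => (aa n:ℂ) * (n:ℂ) ^ (-s)) (FF s) := by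
  have hs0 : -s ≠ 0 := by intro h; have := congrArg Complex.re h; simp at this; linarith
  have h2 : HasSum (fun n : ℕ => (n:ℂ) ^ (-s)) (riemannZeta s) := by
    have h3 : Summable (fun n : ℕ => 1 / (n:ℂ) ^ s) := Complex.summable_one_div_nat_cpow.mpr hs
    have := h3.hasSum
    rw [← zeta_eq_tsum_one_div_nat_cpow hs] at this
    simpa only [one_div, ← Complex.cpow_neg] using this
  have h1 := (hasSum_vM hs).sub h2
  rw [FF_eq (by rintro rfl; simp at hs) (riemannZeta_ne_zero_of_one_lt_re hs), nld]
  refine h1.congr_fun fun n => ?_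
  rcases eq_or_ne n 0 with rfl | hn
  · simp [Complex.zero_cpow hs0, aa]
  · simp only [aa, hn, if_false]; push_cast; ring

lemma kern_bound {s : ℂ} (h : 1 / 2 ≤ s.re) : ‖1 / (s * (s + 1))‖ ≤ 4 * (1 + s.im ^ 2)⁻¹ := by
  have h1 : (1 + s.im ^ 2) / 4 ≤ ‖s‖ ^ 2 := by
    rw [Complex.sq_norm, Complex.normSq_apply]; nlinarith
  have h2 : ‖s‖ ≤ ‖s + 1‖ := by
    rw [← sq_le_sq₀ (norm_nonneg _) (norm_nonneg _), Complex.sq_norm, Complex.sq_norm, Complex.normSq_apply, Complex.normSq_apply]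
    simp only [Complex.add_re, Complex.one_re, Complex.add_im, Complex.one_im]; nlinarith
  rw [norm_div, norm_one, norm_mul, ← one_div, mul_one_div, div_le_div_iff₀ (by nlinarith [norm_nonneg s, sq_nonneg s.im]) (by positivity)]
  nlinarith [norm_nonneg s]

lemma kern_ne {s : ℂ} (h : 1 / 2 ≤ s.re) : s * (s + 1) ≠ 0 := by
  refine mul_ne_zero ?_ ?_ <;> intro h' <;> have := congrArg Complex.re h' <;> simp at this <;> linarith

lemma kern_int {c : ℝ} (hc : 1 / 2 ≤ c) :
    Integrable (fun u : ℝ => 1 / (((c:ℂ) + u * Complex.I) * ((c:ℂ) + u * Complex.I + 1))) := by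
  refine (integrable_inv_one_add_sq.const_mul 4).mono' ?_ (ae_of_all _ fun u => ?_)
  · refine Continuous.aestronglyMeasurable ?_
    refine continuous_const.div (by fun_prop) fun u => kern_ne (by simpa using hc)
  · simpa using kern_bound (s := (c:ℂ) + u * Complex.I) (by simpa using hc)

lemma mellin_tri {s : ℂ} (hs : 0 < s.re) :
    HasMellin (fun t : ℝ => ((max 0 (1 - t):ℝ):ℂ)) s (1 / (s * (s + 1))) := by
  have h1 := hasMellin_one_Ioc hs
  have h2 := hasMellin_cpow_Ioc 1 (s := s) (by simp; linarith)
  have h3 := hasMellin_sub h1.1 h2.1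
  rw [h1.2, h2.2] at h3
  have e : ∀ t ∈ Set.Ioi (0:ℝ), (Set.Ioc (0:ℝ) 1).indicator (fun _ => 1 : ℝ → ℂ) t - (Set.Ioc (0:ℝ) 1).indicator (fun t => (t:ℂ) ^ (1:ℂ) : ℝ → ℂ) t
      = ((max 0 (1 - t):ℝ):ℂ) := by
    intro t ht
    have ht : 0 < t := ht
    by_cases h : t ≤ 1
    · have hm : t ∈ Set.Ioc (0:ℝ) 1 := ⟨ht, h⟩
      rw [Set.indicator_of_mem hm, Set.indicator_of_mem hm, max_eq_right (by linarith)]; simp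
    · have hm : t ∉ Set.Ioc (0:ℝ) 1 := fun h' => h h'.2
      rw [Set.indicator_of_notMem hm, Set.indicator_of_notMem hm, max_eq_left (by linarith)]; simp
  have e2 : 1 / (s * (s + 1)) = 1 / s - 1 / (s + 1) := by
    have h1 : s ≠ 0 := by rintro rfl; simp at hs
    have h2 : s + 1 ≠ 0 := by intro h; have := congrArg Complex.re h; simp at this; linarith
    field_simp; ring
  rw [e2]
  constructor
  · exact h3.1.congr_fun (fun t ht => by simp only [e t ht]) measurableSet_Ioi
  · rw [← h3.2]
    exact setIntegral_congr_fun measurableSet_Ioi (fun t ht => by simp only [e t ht])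

def gker (x:ℝ) (s:ℂ) : ℂ := FF s * (x:ℂ) ^ s / (s * (s + 1))

def SS (x:ℝ) : ℝ := ∑ n ∈ Finset.Icc 1 ⌊x⌋₊, aa n * (1 - n / x)

lemma tri_inv {c y : ℝ} (hc : 1 < c) (hy : 0 < y) :
    ∫ u : ℝ, (y:ℂ) ^ (-((c:ℂ) + u * Complex.I)) * (1 / (((c:ℂ) + u * Complex.I) * ((c:ℂ) + u * Complex.I + 1)))
      = 2 * π * ((max 0 (1 - y):ℝ):ℂ) := by
  have h := mellinInv_mellin_eq c (fun t : ℝ => ((max 0 (1 - t):ℝ):ℂ)) hy (mellin_tri (by simp; linarith)).1 ?_ ?_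
  · rw [mellinInv] at h
    rw [← h, Complex.real_smul]
    push_cast
    rw [← mul_assoc, mul_one_div_cancel (by simp [pi_ne_zero]), one_mul]
    refine integral_congr_ae (ae_of_all _ fun u => ?_)
    simp only [smul_eq_mul]
    rw [(mellin_tri (s := (c:ℂ) + u * Complex.I) (by simp; linarith)).2]
  · refine (kern_int (c := c) (by linarith)).congr (ae_of_all _ fun u => ?_)
    simp only
    rw [(mellin_tri (s := (c:ℂ) + u * Complex.I) (by simp; linarith)).2]
  · fun_prop

theorem perron {c x : ℝ} (hc : 1 < c) (hx : 0 < x) :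
    ((2 * π * SS x:ℝ):ℂ) = ∫ u : ℝ, gker x ((c:ℂ) + u * Complex.I) := by
  set F : ℕ → ℝ → ℂ := fun n u => (aa n:ℂ) * ((((n / x:ℝ):ℂ) ^ (-((c:ℂ) + u * Complex.I)) *
    (1 / (((c:ℂ) + u * Complex.I) * ((c:ℂ) + u * Complex.I + 1))))) with hF
  have hre : ∀ u : ℝ, ((c:ℂ) + u * Complex.I).re = c := fun u => by simp
  have hFn : ∀ n u, ‖F n u‖ = (|aa n| * (n / x) ^ (-c)) * ‖1 / (((c:ℂ) + u * Complex.I) * ((c:ℂ) + u * Complex.I + 1))‖ := by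
    intro n u
    rcases Nat.eq_zero_or_pos n with rfl | hn
    · simp [hF, aa]
    have : 0 < (n / x:ℝ) := div_pos (Nat.cast_pos.mpr hn) hx
    simp only [hF]
    rw [norm_mul, norm_mul, Complex.norm_real, norm_eq_abs, Complex.norm_cpow_eq_rpow_re_of_pos this, Complex.neg_re, hre, mul_assoc]
  have hint : ∀ n, Integrable (F n) := by
    intro n
    rcases Nat.eq_zero_or_pos n with rfl | hn
    · simp [hF, aa]
    have h0 : 0 < (n / x:ℝ) := div_pos (Nat.cast_pos.mpr hn) hx
    refine ((kern_int (c := c) (by linarith)).norm.const_mul (|aa n| * (n / x) ^ (-c))).mono' ?_ (ae_of_all _ fun u => (hFn n u).le)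
    refine Continuous.aestronglyMeasurable (continuous_const.mul (Continuous.mul ?_ ?_))
    · exact Continuous.const_cpow (by fun_prop) (Or.inl (by exact_mod_cast h0.ne'))
    · refine continuous_const.div (by fun_prop) fun u => kern_ne (by simp; linarith)
  have hsum : Summable fun n => ∫ u, ‖F n u‖ := by
    simp only [hFn, integral_const_mul]
    refine Summable.mul_right _ ?_
    have h1 := (FF_hasSum (s := (c:ℂ)) (by simpa using hc)).summable.norm
    refine (h1.mul_right (x ^ c)).congr fun n => ?_
    rcases Nat.eq_zero_or_pos n with rfl | hn
    · simp [aa]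
    rw [norm_mul, Complex.norm_real, norm_eq_abs, Complex.norm_natCast_cpow_of_pos hn, Complex.neg_re, Complex.ofReal_re,
      div_rpow (by positivity) hx.le, rpow_neg hx.le c]
    field_simp
  have key := hasSum_integral_of_summable_integral_norm hint hsum
  have h1 : ∀ u : ℝ, ∑' n, F n u = gker x ((c:ℂ) + u * Complex.I) := by
    intro u
    set s := (c:ℂ) + u * Complex.I with hs
    have hsre : s.re = c := hre u
    have h2 := (FF_hasSum (s := s) (by rw [hsre]; exact hc)).mul_right ((x:ℂ) ^ s / (s * (s + 1)))
    have h3 : gker x s = FF s * ((x:ℂ) ^ s / (s * (s + 1))) := by rw [gker, mul_div_assoc]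
    rw [h3, ← h2.tsum_eq]
    refine tsum_congr fun n => ?_
    simp only [hF]
    rw [← hs, show ((n / x:ℝ):ℂ) = ((n:ℝ):ℂ) * ((x⁻¹:ℝ):ℂ) by push_cast; rw [div_eq_mul_inv],
      Complex.mul_cpow_ofReal_nonneg (by positivity) (by positivity), Complex.ofReal_inv,
      Complex.inv_cpow _ _ (by rw [Complex.arg_ofReal_of_nonneg hx.le]; exact pi_pos.ne),
      Complex.cpow_neg (x:ℂ), inv_inv, Complex.ofReal_natCast]
    ring
  simp only [h1] at key
  have h4 : ∀ n, ∫ u, F n u = ((2 * π * (aa n * max 0 (1 - n / x)):ℝ):ℂ) := by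
    intro n
    rcases Nat.eq_zero_or_pos n with rfl | hn
    · simp [hF, aa]
    have h0 : 0 < (n / x:ℝ) := div_pos (Nat.cast_pos.mpr hn) hx
    simp only [hF]
    rw [integral_const_mul, tri_inv hc h0]; push_cast; ring
  simp only [h4] at key
  rw [← key.tsum_eq, tsum_eq_sum (s := Finset.Icc 1 ⌊x⌋₊)]
  · rw [← Complex.ofReal_sum, SS, Finset.mul_sum]
    congr 1
    refine Finset.sum_congr rfl fun n hn => ?_
    have h5 : (n:ℝ) ≤ x := (Nat.le_floor_iff hx.le).mp (Finset.mem_Icc.mp hn).2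
    rw [max_eq_right]
    rw [sub_nonneg, div_le_one hx]; exact h5
  · intro n hn
    rcases Nat.eq_zero_or_pos n with rfl | hn0
    · simp [aa]
    have h5 : x < n := by
      by_contra h
      exact hn (Finset.mem_Icc.mpr ⟨hn0, Nat.le_floor (not_lt.mp h)⟩)
    rw [max_eq_left]; · simp
    rw [sub_nonpos, one_le_div hx]; exact h5.le

end
end VK

namespace VK
open Real Filter Topology MeasureTheory

noncomputable section

lemma re_li (a b:ℝ) : ((a:ℂ) + b * Complex.I).re = a := by simp

lemma im_li (a b:ℝ) : ((a:ℂ) + b * Complex.I).im = b := by simp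

lemma gker_norm {x : ℝ} (hx : 0 < x) {s : ℂ} (hs : 1 / 2 ≤ s.re) {M : ℝ} (hM : ‖FF s‖ ≤ M) :
    ‖gker x s‖ ≤ M * x ^ s.re * (4 * (1 + s.im ^ 2)⁻¹) := by
  rw [gker, ← mul_one_div, norm_mul, norm_mul, Complex.norm_cpow_eq_rpow_re_of_pos hx]
  have := kern_bound hs
  have hM0 : 0 ≤ M := (norm_nonneg _).trans hM
  gcongr

lemma gker_diff {x : ℝ} (hx : 0 < x) {s : ℂ} (hs : 1 / 2 ≤ s.re) (h1 : riemannZeta₁ s ≠ 0) :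
    DifferentiableAt ℂ (gker x) s := by
  refine ((FF_diff h1).mul ?_).div (by fun_prop) (kern_ne hs)
  exact (differentiableAt_id).const_cpow (Or.inl (Complex.ofReal_ne_zero.mpr hx.ne'))

theorem SS_pre {ε : ℝ} (hε : 0 < ε) (hε3 : ε ≤ 1 / 3) : ∃ T0 > (3:ℝ), ∃ C > (0:ℝ), ∀ T ≥ T0, ∀ x ≥ exp 1,
    |SS x| ≤ C * (log T) ^ 3 * (x ^ (1 - (log T) ^ (-(2:ℝ)/3 - ε) / 16) + x / T) + C * x * T ^ (-(1/4:ℝ)) := by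
  obtain ⟨T1, hT1, C1, hC1, hR⟩ := region hε hε3
  have hlog : ∃ T2, ∀ u ≥ T2, (log u) ^ 3 ≤ u ^ (1 / 4:ℝ) := by
    have := (isLittleO_pow_log_id_atTop (n := 12)).bound (show (0:ℝ) < 1 by norm_num)
    obtain ⟨T2, hT2⟩ := eventually_atTop.mp this
    refine ⟨max T2 1, fun u hu => ?_⟩
    have h1 := hT2 u ((le_max_left _ _).trans hu)
    have hu1 := (le_max_right _ _).trans hu
    have hl := log_nonneg hu1
    rw [norm_of_nonneg (by positivity), id, norm_of_nonneg (by linarith), one_mul] at h1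
    calc (log u) ^ 3 = ((log u) ^ 12) ^ (1/4:ℝ) := by
          rw [← rpow_natCast (log u) 12, ← rpow_mul hl, ← rpow_natCast (log u) 3]; norm_num
      _ ≤ _ := rpow_le_rpow (by positivity) h1 (by norm_num)
  obtain ⟨T2, hT2⟩ := hlog
  have hI : Integrable (fun u : ℝ => (1 + ‖u‖ ^ 2) ^ (-(3/2:ℝ) / 2)) :=
    integrable_rpow_neg_one_add_norm_sq (by simp; norm_num)
  set I0 := ∫ u : ℝ, (1 + ‖u‖ ^ 2) ^ (-(3/2:ℝ) / 2) with hI0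
  refine ⟨max T1 T2, lt_max_of_lt_left hT1, 4 * π * C1 + 16 * C1 * exp 1 + 4 * C1 * exp 1 * I0, by positivity, fun T hT x hx => ?_⟩
  have hTT1 := (le_max_left _ _).trans hT
  have hTT2 := (le_max_right _ _).trans hT
  have hT3 : 3 < T := by linarith
  have hx0 : 0 < x := (exp_pos 1).trans_le hx
  have hlx : 1 ≤ log x := (le_log_iff_exp_le hx0).mpr hx
  have hlT : 1 ≤ log T := (le_log_iff_exp_le (by linarith)).mpr (by linarith [exp_one_lt_d9])
  set η := (log T) ^ (-(2:ℝ)/3 - ε) / 16 with hη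
  have hη0 : 0 < η := by positivity
  have hη1 : η ≤ 1 / 16 := by
    have : (log T) ^ (-(2:ℝ)/3 - ε) ≤ 1 := rpow_le_one_of_one_le_of_nonpos hlT (by linarith)
    rw [hη]; linarith
  set c := 1 + 1 / log x with hc
  have hc1 : 1 < c := by rw [hc]; linarith [one_div_pos.mpr (show 0 < log x by linarith)]
  have hc2 : c ≤ 2 := by
    have : 1 / log x ≤ 1 := by rw [div_le_one (by linarith)]; exact hlx
    linarith
  have hxc : x ^ c = exp 1 * x := by
    rw [hc, rpow_add hx0, rpow_one, rpow_def_of_pos hx0, mul_one_div_cancel (by linarith), mul_comm]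
  set M := C1 * (log T) ^ 3 with hM
  have hp := perron hc1 hx0
  have hx1 : 1 ≤ x := (one_le_exp (by norm_num)).trans hx
  have hfin : ∀ B : ℝ, ‖∫ u : ℝ, gker x ((c:ℂ) + u * Complex.I)‖ ≤ B → |SS x| ≤ B := by
    intro B hB
    rw [← hp, Complex.norm_real, norm_eq_abs, abs_mul, abs_of_pos (by positivity)] at hB
    have : |SS x| * 1 ≤ |SS x| * (2 * π) := by gcongr; linarith [pi_gt_three]
    linarith
  refine hfin _ ?_
  by_cases hint : Integrable (fun u : ℝ => gker x ((c:ℂ) + u * Complex.I))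
  swap
  · rw [integral_undef hint, norm_zero]; positivity
  rw [← integral_add_compl (measurableSet_Ioc (a := -T) (b := T)) hint]
  -- tail
  have htail : ‖∫ u in (Set.Ioc (-T) T)ᶜ, gker x ((c:ℂ) + u * Complex.I)‖ ≤ 4 * C1 * exp 1 * I0 * x * T ^ (-(1/4:ℝ)) := by
    have hb : ∀ u ∈ (Set.Ioc (-T) T)ᶜ, ‖gker x ((c:ℂ) + u * Complex.I)‖ ≤
        (4 * C1 * exp 1 * x * T ^ (-(1/4:ℝ))) * (1 + ‖u‖ ^ 2) ^ (-(3/2:ℝ) / 2) := by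
      intro u hu
      have hu' : T ≤ |u| := by
        rw [le_abs]; by_contra h; push Not at h
        exact hu ⟨by linarith, h.1.le⟩
      have h1 := (hR |u| (by linarith) ((c:ℂ) + u * Complex.I) (by
        have : 0 < log |u| := log_pos (by linarith)
        have : 0 < (log |u|) ^ (-(2:ℝ)/3 - ε) := by positivity
        rw [re_li]; linarith) (by rwa [re_li]) (by rw [im_li])).2
      have h2 := gker_norm hx0 (by rw [re_li]; linarith) h1
      rw [re_li, im_li, hxc] at h2
      refine h2.trans ?_
      have h3 := hT2 |u| (by linarith)
      have hA : 0 < 1 + u ^ 2 := by positivity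
      have h4 : |u| ^ (1/4:ℝ) ≤ (1 + u ^ 2) ^ (1/8:ℝ) := by
        calc |u| ^ (1/4:ℝ) = (|u| ^ (2:ℝ)) ^ (1/8:ℝ) := by rw [← rpow_mul (abs_nonneg u)]; norm_num
          _ ≤ _ := rpow_le_rpow (by positivity) (by rw [rpow_two, sq_abs]; linarith) (by norm_num)
      have h5 : (1 + u ^ 2) ^ (-(1/8:ℝ)) ≤ T ^ (-(1/4:ℝ)) := by
        rw [rpow_neg hA.le, rpow_neg (by linarith)]
        refine inv_anti₀ (by positivity) ((rpow_le_rpow (by linarith) hu' (by norm_num)).trans h4)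
      have e : (1 + u ^ 2) ^ (1/8:ℝ) * (1 + u ^ 2)⁻¹ = (1 + u ^ 2) ^ (-(1/8:ℝ)) * (1 + u ^ 2) ^ (-(3/2:ℝ) / 2) := by
        rw [← rpow_neg_one (1 + u ^ 2), ← rpow_add hA, ← rpow_add hA]; norm_num
      rw [norm_eq_abs, sq_abs]
      calc C1 * (log |u|) ^ 3 * (exp 1 * x) * (4 * (1 + u ^ 2)⁻¹)
          ≤ C1 * (1 + u ^ 2) ^ (1/8:ℝ) * (exp 1 * x) * (4 * (1 + u ^ 2)⁻¹) := by gcongr; exact h3.trans h4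
        _ = 4 * C1 * exp 1 * x * ((1 + u ^ 2) ^ (1/8:ℝ) * (1 + u ^ 2)⁻¹) := by ring
        _ = 4 * C1 * exp 1 * x * ((1 + u ^ 2) ^ (-(1/8:ℝ)) * (1 + u ^ 2) ^ (-(3/2:ℝ) / 2)) := by rw [e]
        _ ≤ 4 * C1 * exp 1 * x * (T ^ (-(1/4:ℝ)) * (1 + u ^ 2) ^ (-(3/2:ℝ) / 2)) := by gcongr
        _ = _ := by ring
    refine (norm_integral_le_of_norm_le (hI.const_mul _).integrableOn
      ((ae_restrict_iff' measurableSet_Ioc.compl).mpr (ae_of_all _ hb))).trans ?_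
    refine (setIntegral_le_integral (hI.const_mul _) (ae_of_all _ fun u => by positivity)).trans ?_
    rw [integral_const_mul]; exact le_of_eq (by ring)
  -- rectangle
  have hrect := Complex.integral_boundary_rect_eq_zero_of_differentiableOn (gker x) (⟨1 - η, -T⟩:ℂ) (⟨c, T⟩:ℂ) (by
    intro s hs
    rw [Complex.mem_reProdIm, Set.uIcc_of_le (by simp; linarith), Set.uIcc_of_le (by simp; linarith)] at hs
    simp only [Set.mem_Icc] at hs
    obtain ⟨⟨h1, h2⟩, h3, h4⟩ := hs
    exact (gker_diff hx0 (by linarith) (hR T hTT1 s h1 (by linarith) (abs_le.mpr ⟨h3, h4⟩)).1).differentiableWithinAt)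
  simp only at hrect
  have hhor : ∀ t : ℝ, |t| = T → ‖∫ y : ℝ in (1 - η)..c, gker x ((y:ℂ) + (t:ℂ) * Complex.I)‖ ≤ 8 * exp 1 * M * (x / T) := by
    intro t ht
    have h1 : ∀ y ∈ Set.uIoc (1 - η) c, ‖gker x ((y:ℂ) + (t:ℂ) * Complex.I)‖ ≤ 4 * exp 1 * M * (x / T) := by
      intro y hy
      rw [Set.uIoc_of_le (by linarith)] at hy
      obtain ⟨h1, h2⟩ := hy
      have h3 := gker_norm hx0 (s := (y:ℂ) + (t:ℂ) * Complex.I) (by simp; linarith)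
        (hR T hTT1 _ (by simp; linarith) (by simp; linarith) (by simp [ht])).2
      rw [re_li, im_li] at h3
      refine h3.trans ?_
      rw [← sq_abs t, ht]
      have h4 : x ^ y ≤ exp 1 * x := hxc ▸ rpow_le_rpow_of_exponent_le hx1 h2
      have h5 : (1 + T ^ 2)⁻¹ ≤ T⁻¹ := inv_anti₀ (by linarith) (by have := sq_nonneg (T - 1); linarith)
      calc C1 * (log T) ^ 3 * x ^ y * (4 * (1 + T ^ 2)⁻¹) ≤ C1 * (log T) ^ 3 * (exp 1 * x) * (4 * T⁻¹) := by gcongr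
        _ = _ := by rw [hM]; ring
    refine (intervalIntegral.norm_integral_le_of_norm_le_const h1).trans ?_
    have : |c - (1 - η)| ≤ 2 := by rw [abs_le]; constructor <;> linarith
    calc 4 * exp 1 * M * (x / T) * |c - (1 - η)| ≤ 4 * exp 1 * M * (x / T) * 2 := by gcongr
      _ = _ := by ring
  have hleft : ‖∫ y : ℝ in (-T)..T, gker x (((1 - η:ℝ):ℂ) + y * Complex.I)‖ ≤ 4 * π * M * x ^ (1 - η) := by
    have h1 : ∀ y ∈ Set.Ioc (-T) T, ‖gker x (((1 - η:ℝ):ℂ) + y * Complex.I)‖ ≤ (4 * M * x ^ (1 - η)) * (1 + y ^ 2)⁻¹ := by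
      intro y hy
      obtain ⟨h1, h2⟩ := hy
      have h3 := gker_norm hx0 (s := ((1 - η:ℝ):ℂ) + (y:ℂ) * Complex.I) (by rw [re_li]; linarith)
        (hR T hTT1 _ (by rw [re_li]) (by rw [re_li]; linarith) (by rw [im_li, abs_le]; constructor <;> linarith)).2
      rw [re_li, im_li] at h3
      exact h3.trans (le_of_eq (by rw [hM]; ring))
    have hi : Integrable (fun y : ℝ => (4 * M * x ^ (1 - η)) * (1 + y ^ 2)⁻¹) := integrable_inv_one_add_sq.const_mul _
    refine (intervalIntegral.norm_integral_le_of_norm_le (by linarith) (ae_of_all _ h1) hi.intervalIntegrable).trans ?_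
    rw [intervalIntegral.integral_of_le (by linarith)]
    refine (setIntegral_le_integral hi (ae_of_all _ fun u => by positivity)).trans ?_
    rw [integral_const_mul, integral_univ_inv_one_add_sq]; exact le_of_eq (by ring)
  have hmid : ‖∫ u in Set.Ioc (-T) T, gker x ((c:ℂ) + u * Complex.I)‖ ≤ 4 * π * M * x ^ (1 - η) + 16 * exp 1 * M * (x / T) := by
    rw [← intervalIntegral.integral_of_le (by linarith)]
    have hl := hhor (-T) (by rw [abs_neg, abs_of_pos (by linarith)])
    have hh := hhor T (abs_of_pos (by linarith))
    set A := ∫ y : ℝ in (1 - η)..c, gker x ((y:ℂ) + ((-T:ℝ):ℂ) * Complex.I)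
    set B := ∫ y : ℝ in (1 - η)..c, gker x ((y:ℂ) + (T:ℂ) * Complex.I)
    set D := ∫ y : ℝ in (-T)..T, gker x ((c:ℂ) + y * Complex.I)
    set E := ∫ y : ℝ in (-T)..T, gker x (((1 - η:ℝ):ℂ) + y * Complex.I)
    have e : Complex.I * D = Complex.I * E + (B - A) := by
      simp only [smul_eq_mul] at hrect; linear_combination hrect
    have e2 : ‖D‖ = ‖Complex.I * D‖ := by rw [norm_mul, Complex.norm_I, one_mul]
    rw [e2, e]
    refine (norm_add_le _ _).trans ?_
    rw [norm_mul, Complex.norm_I, one_mul]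
    linarith [norm_sub_le B A]
  refine (norm_add_le _ _).trans ((add_le_add hmid htail).trans ?_)
  have : 0 ≤ (16 * (C1 * exp 1) + 4 * (C1 * exp 1 * I0)) * ((log T) ^ 3 * x ^ (1 - η)) + (4 * (π * C1) + 4 * (C1 * exp 1 * I0)) * ((log T) ^ 3 * (x / T))
      + (4 * (π * C1) + 16 * (C1 * exp 1)) * (x * T ^ (-(1/4:ℝ))) := by positivity
  linarith

end
end VK

namespace VK
open Real Filter Topology MeasureTheory
open ArithmeticFunction hiding log

noncomputable section

lemma ev_pow_exp (A k:ℝ) {c b : ℝ} (hc : 0 < c) (hb : 0 < b) : ∀ᶠ L : ℝ in atTop, A * L ^ k ≤ exp (c * L ^ b) := by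
  have h1 := (tendsto_exp_mul_div_rpow_atTop (k / b) c hc).comp (tendsto_rpow_atTop hb)
  filter_upwards [h1.eventually (eventually_ge_atTop A), eventually_gt_atTop 0] with L h2 hL
  simp only [Function.comp] at h2
  rw [← rpow_mul hL.le, mul_div_cancel₀ _ hb.ne', le_div_iff₀ (by positivity)] at h2
  exact h2

theorem SS_bound {ε : ℝ} (hε : 0 < ε) (hε3 : ε ≤ 1 / 3) : ∃ X0 : ℝ, ∃ C > (0:ℝ), ∀ x ≥ X0,
    |SS x| ≤ C * x * exp (-(log x) ^ (3/5 - 3/5 * ε) / 32) := by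
  obtain ⟨T0, hT0, C, hC, hS⟩ := SS_pre hε hε3
  set b := 3/5 - 3/5 * ε with hb
  have hb0 : 0 < b := by rw [hb]; linarith
  have hev := ((tendsto_rpow_atTop (show (0:ℝ) < 3/5 by norm_num)).eventually (eventually_ge_atTop (log T0))).and
    ((ev_pow_exp 3 2 (c := 1/32) (by norm_num) hb0).and (eventually_ge_atTop 1))
  obtain ⟨X0, hX0⟩ := eventually_atTop.mp (tendsto_log_atTop.eventually hev)
  refine ⟨max X0 (exp 1), C, hC, fun x hx => ?_⟩
  obtain ⟨h1, h2, hL⟩ := hX0 x ((le_max_left _ _).trans hx)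
  have hxe := (le_max_right _ _).trans hx
  have hx0 : 0 < x := (exp_pos 1).trans_le hxe
  set L := log x with hLd
  have hL0 : 0 < L := by linarith
  have hT : T0 ≤ exp (L ^ (3/5:ℝ)) := by
    rwa [← log_le_iff_le_exp (by linarith)]
  have h3 := hS _ hT x hxe
  rw [log_exp] at h3
  have e1 : (L ^ (3/5:ℝ)) ^ (-(2:ℝ)/3 - ε) = L ^ (b - 1) := by
    rw [← rpow_mul hL0.le]; congr 1; rw [hb]; ring
  have e2 : x ^ (1 - L ^ (b - 1) / 16) = x * exp (-L ^ b / 16) := by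
    rw [sub_eq_add_neg, rpow_add hx0, rpow_one, rpow_def_of_pos hx0, ← hLd, rpow_sub hL0, rpow_one]
    congr 2; field_simp
  have hLb : L ^ b ≤ L ^ (3/5:ℝ) := rpow_le_rpow_of_exponent_le hL (by rw [hb]; linarith)
  have hLb0 : 0 < L ^ b := by positivity
  have e3 : x / exp (L ^ (3/5:ℝ)) ≤ x * exp (-L ^ b / 16) := by
    rw [div_eq_mul_inv, ← exp_neg]; gcongr; linarith
  have e4 : exp (L ^ (3/5:ℝ)) ^ (-(1/4:ℝ)) ≤ exp (-L ^ b / 16) := by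
    rw [← exp_mul]; gcongr; linarith
  have e5 : (L ^ (3/5:ℝ)) ^ 3 ≤ L ^ (2:ℝ) := by
    rw [← rpow_natCast, ← rpow_mul hL0.le]; exact rpow_le_rpow_of_exponent_le hL (by norm_num)
  have e6 : 1 ≤ L ^ (2:ℝ) := one_le_rpow hL (by norm_num)
  rw [e1, e2] at h3
  refine h3.trans ?_
  calc C * (L ^ (3/5:ℝ)) ^ 3 * (x * exp (-L ^ b / 16) + x / exp (L ^ (3/5:ℝ))) + C * x * exp (L ^ (3/5:ℝ)) ^ (-(1/4:ℝ))
      ≤ C * L ^ (2:ℝ) * (x * exp (-L ^ b / 16) + x * exp (-L ^ b / 16)) + C * x * (L ^ (2:ℝ) * exp (-L ^ b / 16)) := by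
        gcongr
        exact e4.trans (le_mul_of_one_le_left (exp_pos _).le e6)
    _ = C * x * (3 * L ^ (2:ℝ)) * exp (-L ^ b / 16) := by ring
    _ ≤ C * x * exp (1/32 * L ^ b) * exp (-L ^ b / 16) := by gcongr
    _ = C * x * exp (-L ^ b / 32) := by rw [mul_assoc, ← exp_add]; congr 2; ring

def RR (x:ℝ) : ℝ := ∑ n ∈ Finset.Icc 1 ⌊x⌋₊, aa n

lemma aa_ge (n:ℕ) : -1 ≤ aa n := by
  unfold aa; split_ifs
  · norm_num
  · linarith [vonMangoldt_nonneg (n := n)]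

lemma unsmooth {y z : ℝ} (hy : 0 < y) (hyz : y ≤ z) :
    (z - y) * RR y - (z - y) * (z - y + 1) ≤ z * SS z - y * SS y ∧
    z * SS z - y * SS y ≤ (z - y) * RR z + (z - y) * (z - y + 1) := by
  have hz : 0 < z := by linarith
  have hfl : ⌊y⌋₊ ≤ ⌊z⌋₊ := Nat.floor_le_floor hyz
  have hsplit : ∀ f : ℕ → ℝ, ∑ n ∈ Finset.Icc 1 ⌊z⌋₊, f n = ∑ n ∈ Finset.Icc 1 ⌊y⌋₊, f n + ∑ n ∈ Finset.Ioc ⌊y⌋₊ ⌊z⌋₊, f n := by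
    intro f
    rw [← Finset.sum_union]
    · congr 1; ext n; simp only [Finset.mem_Icc, Finset.mem_union, Finset.mem_Ioc]; omega
    · rw [Finset.disjoint_left]; intro n; simp only [Finset.mem_Icc, Finset.mem_Ioc]; omega
  have hB : ∀ w, 0 < w → w * SS w = ∑ n ∈ Finset.Icc 1 ⌊w⌋₊, aa n * (w - n) := by
    intro w hw
    rw [SS, Finset.mul_sum]
    refine Finset.sum_congr rfl fun n _ => ?_
    field_simp
  have hcard : ((Finset.Ioc ⌊y⌋₊ ⌊z⌋₊).card:ℝ) ≤ z - y + 1 := by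
    rw [Nat.card_Ioc, Nat.cast_sub hfl]
    linarith [Nat.floor_le hz.le, Nat.lt_floor_add_one y]
  have hlow : ∀ f : ℕ → ℝ, (∀ n ∈ Finset.Ioc ⌊y⌋₊ ⌊z⌋₊, 0 ≤ f n ∧ f n ≤ z - y) →
      -((z - y) * (z - y + 1)) ≤ ∑ n ∈ Finset.Ioc ⌊y⌋₊ ⌊z⌋₊, aa n * f n := by
    intro f hf
    have h1 : ∑ n ∈ Finset.Ioc ⌊y⌋₊ ⌊z⌋₊, (-(z - y)) ≤ ∑ n ∈ Finset.Ioc ⌊y⌋₊ ⌊z⌋₊, aa n * f n := by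
      refine Finset.sum_le_sum fun n hn => ?_
      obtain ⟨h1, h2⟩ := hf n hn
      have := mul_le_mul_of_nonneg_right (aa_ge n) h1
      linarith
    rw [Finset.sum_const, nsmul_eq_mul] at h1
    have := mul_le_mul_of_nonneg_right hcard (show 0 ≤ z - y by linarith)
    linarith
  have hmem : ∀ n ∈ Finset.Ioc ⌊y⌋₊ ⌊z⌋₊, y < n ∧ (n:ℝ) ≤ z := by
    intro n hn
    rw [Finset.mem_Ioc] at hn
    exact ⟨(Nat.floor_lt hy.le).mp hn.1, (Nat.le_floor_iff hz.le).mp hn.2⟩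
  have e1 : z * SS z - y * SS y = (z - y) * RR y + ∑ n ∈ Finset.Ioc ⌊y⌋₊ ⌊z⌋₊, aa n * (z - n) := by
    rw [hB z hz, hB y hy, hsplit, RR, Finset.mul_sum, add_sub_right_comm, ← Finset.sum_sub_distrib]
    congr 1; refine Finset.sum_congr rfl fun n _ => ?_; ring
  have e2 : z * SS z - y * SS y = (z - y) * RR z - ∑ n ∈ Finset.Ioc ⌊y⌋₊ ⌊z⌋₊, aa n * (n - y) := by
    rw [e1, RR, RR, hsplit, mul_add, add_sub_assoc, Finset.mul_sum (Finset.Ioc _ _), ← Finset.sum_sub_distrib]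
    congr 1; refine Finset.sum_congr rfl fun n _ => ?_; ring
  constructor
  · rw [e1]
    have := hlow (fun n => z - n) fun n hn => by
      obtain ⟨h1, h2⟩ := hmem n hn; constructor <;> linarith
    linarith
  · rw [e2]
    have := hlow (fun n => n - y) fun n hn => by
      obtain ⟨h1, h2⟩ := hmem n hn; constructor <;> linarith
    linarith

theorem RR_bound {ε : ℝ} (hε : 0 < ε) (hε3 : ε ≤ 1 / 3) : ∃ X0 : ℝ, ∃ C > (0:ℝ), ∀ x ≥ X0,
    |RR x| ≤ C * x * exp (-(log x) ^ (3/5 - 3/5 * ε) / 128) := by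
  obtain ⟨X1, C, hC, hS⟩ := SS_bound hε hε3
  set b := 3/5 - 3/5 * ε with hb
  have hb0 : 0 < b := by rw [hb]; linarith
  have hb1 : b ≤ 1 := by rw [hb]; linarith
  obtain ⟨X0, hX0⟩ := eventually_atTop.mp (tendsto_log_atTop.eventually ((ev_pow_exp 2 0 (c := 1/128) (by norm_num) hb0).and
    (eventually_ge_atTop 2)))
  refine ⟨max X0 (max (2 * X1) 1), 8 * C + 2, by positivity, fun x hx => ?_⟩
  obtain ⟨h1, hL⟩ := hX0 x ((le_max_left _ _).trans hx)
  have hx1 : 2 * X1 ≤ x := (le_max_left _ _).trans ((le_max_right _ _).trans hx)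
  have hx2 : 1 ≤ x := (le_max_right _ _).trans ((le_max_right _ _).trans hx)
  have hx0 : 0 < x := by linarith
  set L := log x with hLd
  have hL0 : 0 < L := by linarith
  rw [rpow_zero, mul_one] at h1
  set D := exp (-L ^ b / 128) with hD
  have hDi : D = (exp (1/128 * L ^ b))⁻¹ := by rw [← exp_neg, hD]; congr 1; ring
  have hD2 : D ≤ 1 / 2 := by rw [hDi, one_div (2:ℝ)]; exact inv_anti₀ (by norm_num) h1
  have hLb : L ^ b ≤ L := by
    calc L ^ b ≤ L ^ (1:ℝ) := rpow_le_rpow_of_exponent_le (by linarith) hb1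
      _ = L := rpow_one L
  have hxD : 1 ≤ x * D := by
    rw [hDi, ← div_eq_mul_inv, one_le_div (exp_pos _)]
    calc exp (1/128 * L ^ b) ≤ exp L := by gcongr; linarith
      _ = x := exp_log hx0
  have hy : ∀ y, x / 2 ≤ y → y ≤ 2 * x → |y * SS y| ≤ 4 * C * x ^ 2 * D ^ 2 := by
    intro y h1 h2
    have hy0 : 0 < y := by linarith
    have h3 := hS y (by linarith)
    have h4 : L / 2 ≤ log y := by
      have : log (x / 2) ≤ log y := log_le_log (by linarith) h1
      rw [log_div hx0.ne' (by norm_num)] at this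
      have := log_two_lt_d9
      linarith
    have h5 : L ^ b / 2 ≤ (log y) ^ b := by
      calc L ^ b / 2 = L ^ b * (1/2) ^ (1:ℝ) := by rw [rpow_one]; ring
        _ ≤ L ^ b * (1/2) ^ b := by gcongr ?_ * ?_; exact rpow_le_rpow_of_exponent_ge (by norm_num) (by norm_num) hb1
        _ = (L / 2) ^ b := by rw [← mul_rpow hL0.le (by norm_num)]; congr 1; ring
        _ ≤ _ := rpow_le_rpow (by linarith) h4 hb0.le
    have e : D ^ 2 = exp (-L ^ b / 64) := by rw [hD, ← exp_nat_mul]; congr 1; push_cast; ring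
    rw [abs_mul, abs_of_pos hy0]
    calc y * |SS y| ≤ y * (C * y * exp (-(log y) ^ b / 32)) := by gcongr
      _ ≤ (2 * x) * (C * (2 * x) * D ^ 2) := by rw [e]; gcongr ?_ * (C * ?_ * exp ?_); linarith
      _ = _ := by ring
  set h := x * D with hh
  have hh0 : 0 < h := by linarith
  have hhx : h ≤ x / 2 := by
    calc x * D ≤ x * (1/2) := by gcongr
      _ = _ := by ring
  have u1 := (unsmooth (y := x) (z := x + h) hx0 (by linarith)).1
  have u2 := (unsmooth (y := x - h) (z := x) (by linarith) (by linarith)).2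
  rw [add_sub_cancel_left] at u1
  rw [sub_sub_cancel] at u2
  have b1 := abs_le.mp (hy x (by linarith) (by linarith))
  have b2 := abs_le.mp (hy (x + h) (by linarith) (by linarith))
  have b3 := abs_le.mp (hy (x - h) (by linarith) (by linarith))
  obtain ⟨b1, b1'⟩ := b1
  obtain ⟨b2, b2'⟩ := b2
  obtain ⟨b3, b3'⟩ := b3
  have e : 4 * C * x ^ 2 * D ^ 2 = h * (4 * C * h) := by rw [hh]; ring
  rw [e] at b1 b1' b2 b2' b3 b3'
  have hgoal : (8 * C + 2) * x * D = 8 * C * h + 2 * h := by rw [hh]; ring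
  rw [hgoal, abs_le]
  constructor
  · have : h * (-(8 * C * h + 2 * h)) ≤ h * RR x := by
      have : h * (h + 1) ≤ h * (2 * h) := by gcongr; linarith
      linarith
    exact le_of_mul_le_mul_left this hh0
  · have : h * RR x ≤ h * (8 * C * h + 2 * h) := by
      have : h * (h + 1) ≤ h * (2 * h) := by gcongr; linarith
      linarith
    exact le_of_mul_le_mul_left this hh0

end
end VK

namespace VK
open Real Filter Topology MeasureTheory
open ArithmeticFunction hiding log

noncomputable section

open scoped Classical in
def pp : ArithmeticFunction ℝ := ⟨fun n => if IsPrimePow n then 1 else 0, if_neg not_isPrimePow_zero⟩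

def ww (n:ℕ) : ℝ := vonMangoldt n / log n

def vp (n:ℕ) : ℝ := pp n - ww n

lemma pp_apply (n:ℕ) [Decidable (IsPrimePow n)] : pp n = if IsPrimePow n then 1 else 0 := by
  simp only [pp, ArithmeticFunction.coe_mk]
  congr

lemma pp_sum {n : ℕ} : ∑ i ∈ n.divisors, pp i = (n.primeFactorsList.length:ℝ) := by
  refine Nat.recOnPrimeCoprime ?_ ?_ ?_ n
  · simp
  · intro p k hp
    rw [Nat.sum_divisors_prime_pow hp, Finset.sum_range_succ', Nat.pow_zero, hp.primeFactorsList_pow]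
    have h : ∀ k : ℕ, pp (p ^ (k+1)) = 1 := fun k => by
      classical
      rw [pp_apply, if_pos (hp.isPrimePow.pow (Nat.succ_ne_zero k))]
    have h1 : pp 1 = 0 := by
      classical
      rw [pp_apply, if_neg not_isPrimePow_one]
    simp [h, h1]
  intro a b ha' hb' hab ha hb
  classical
  simp only [pp_apply, ← Finset.sum_filter] at ha hb ⊢
  rw [Nat.mul_divisors_filter_prime_pow hab, Finset.filter_union,
    Finset.sum_union (Nat.disjoint_divisors_filter_isPrimePow hab), ha, hb]
  have := (Nat.perm_primeFactorsList_mul (a := a) (b := b) (by omega) (by omega)).length_eq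
  rw [this]
  simp

lemma omega_sum (N:ℕ) : ∑ n ∈ Finset.Icc 1 N, (n.primeFactorsList.length:ℝ)
    = ∑ m ∈ Finset.Icc 1 N, pp m * ((N / m:ℕ):ℝ) := by
  have h := sum_Ioc_mul_zeta_eq_sum pp N
  have e : Finset.Ioc 0 N = Finset.Icc 1 N := by ext; simp [Nat.succ_le_iff]
  rw [e] at h
  rw [← h]
  refine Finset.sum_congr rfl fun n _ => ?_
  rw [coe_mul_zeta_apply, pp_sum]

lemma ww_pow (p : Nat.Primes) (k:ℕ) : ww ((p:ℕ) ^ (k+1)) = 1 / ((k:ℝ)+1) := by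
  have hp := p.2
  have h : (0:ℝ) < log (p:ℕ) := log_pos (by exact_mod_cast hp.one_lt)
  rw [ww, vonMangoldt_apply_pow (Nat.succ_ne_zero k), vonMangoldt_apply_prime hp, Nat.cast_pow, Real.log_pow]
  push_cast
  field_simp

lemma vp_pow (p : Nat.Primes) (k:ℕ) : vp ((p:ℕ) ^ (k+1)) = 1 - 1 / ((k:ℝ)+1) := by
  classical
  rw [vp, ww_pow, pp_apply, if_pos (p.2.isPrimePow.pow (Nat.succ_ne_zero k))]

lemma vp_not {n : ℕ} (h : ¬ IsPrimePow n) : vp n = 0 := by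
  classical
  rw [vp, pp_apply, if_neg h, ww, vonMangoldt_eq_zero_iff.mpr h]; simp

lemma vp_nonneg (n:ℕ) : 0 ≤ vp n := by
  by_cases h : IsPrimePow n
  · obtain ⟨⟨p, k⟩, hk⟩ := Nat.Primes.prodNatEquiv.surjective ⟨n, h⟩
    have : n = (p:ℕ)^(k+1) := by rw [Nat.Primes.prodNatEquiv_apply] at hk; exact (congrArg Subtype.val hk).symm
    rw [this, vp_pow, sub_nonneg, div_le_one (by positivity)]
    linarith [Nat.cast_nonneg (α := ℝ) k]
  · rw [vp_not h]

lemma ww_nonneg (n:ℕ) : 0 ≤ ww n := div_nonneg vonMangoldt_nonneg (log_natCast_nonneg n)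

lemma ww_le_one (n:ℕ) : ww n ≤ 1 := by
  have h : 0 ≤ vp n := vp_nonneg n
  have : pp n ≤ 1 := by
    classical
    rw [pp_apply]; split_ifs <;> norm_num
  rw [vp] at h; linarith

def qq (p : Nat.Primes × ℕ) : ℕ := (p.1:ℕ) ^ (p.2+1)

lemma qq_inj : Function.Injective qq :=
  Subtype.val_injective.comp Nat.Primes.prodNatEquiv.injective

lemma supp_qq {r : ℝ} (n:ℕ) (h : n ∉ Set.range qq) : vp n * r = 0 := by
  rw [vp_not, zero_mul]
  intro hn
  exact h ⟨Nat.Primes.prodNatEquiv.symm ⟨n, hn⟩, congrArg Subtype.val (Nat.Primes.prodNatEquiv.apply_symm_apply ⟨n, hn⟩)⟩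

lemma vp_summable : Summable (fun n : ℕ => vp n * (n:ℝ) ^ (-(3/4):ℝ)) := by
  rw [← qq_inj.summable_iff (fun n h => supp_qq n h)]
  have h1 : Summable (fun p : Nat.Primes => ((p:ℕ):ℝ) ^ (-(3/2):ℝ)) := Nat.Primes.summable_rpow.mpr (by norm_num)
  have h2 : Summable (fun k : ℕ => 2 * ((2:ℝ) ^ (-(3/4):ℝ)) ^ k) :=
    (summable_geometric_of_lt_one (by positivity) (rpow_lt_one_of_one_lt_of_neg (by norm_num) (by norm_num))).mul_left _
  refine (h1.mul_of_nonneg h2 (fun _ => by positivity) (fun _ => by positivity)).of_nonneg_of_le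
    (fun _ => mul_nonneg (vp_nonneg _) (by positivity)) ?_
  rintro ⟨p, k⟩
  simp only [Function.comp, qq, vp_pow]
  have hp : (2:ℝ) ≤ (p:ℕ) := by exact_mod_cast p.2.two_le
  have hp0 : (0:ℝ) < (p:ℕ) := by linarith
  rcases k with _ | k
  · simp
    positivity
  · have e1 : (((p:ℕ) ^ (k+1+1):ℕ):ℝ) ^ (-(3/4):ℝ) = ((p:ℕ):ℝ) ^ (-(3/2):ℝ) * (((p:ℕ):ℝ) ^ (-(3/4):ℝ)) ^ k := by
      rw [Nat.cast_pow, ← rpow_natCast, ← rpow_natCast, ← rpow_mul hp0.le, ← rpow_mul hp0.le, ← rpow_add hp0]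
      congr 1; push_cast; ring
    have e2 : (((p:ℕ):ℝ) ^ (-(3/4):ℝ)) ^ k ≤ ((2:ℝ) ^ (-(3/4):ℝ)) ^ k :=
      pow_le_pow_left₀ (by positivity) (rpow_le_rpow_of_nonpos (by norm_num) hp (by norm_num)) k
    have e3 : (1:ℝ) ≤ 2 * (2:ℝ) ^ (-(3/4):ℝ) := by
      have : (2:ℝ) * (2:ℝ) ^ (-(3/4):ℝ) = (2:ℝ) ^ ((1/4):ℝ) := by
        rw [show (1/4:ℝ) = 1 + (-(3/4)) by norm_num, rpow_add (by norm_num), rpow_one]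
      rw [this]; exact one_le_rpow (by norm_num) (by norm_num)
    have e4 : (1:ℝ) - 1 / (((k+1:ℕ):ℝ) + 1) ≤ 1 := by
      have : (0:ℝ) ≤ 1 / (((k+1:ℕ):ℝ) + 1) := by positivity
      linarith
    rw [e1]
    calc (1 - 1 / (((k+1:ℕ):ℝ) + 1)) * (((p:ℕ):ℝ) ^ (-(3/2):ℝ) * (((p:ℕ):ℝ) ^ (-(3/4):ℝ)) ^ k)
        ≤ 1 * (((p:ℕ):ℝ) ^ (-(3/2):ℝ) * ((2:ℝ) ^ (-(3/4):ℝ)) ^ k) := by gcongr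
      _ ≤ (2 * (2:ℝ) ^ (-(3/4):ℝ)) * (((p:ℕ):ℝ) ^ (-(3/2):ℝ) * ((2:ℝ) ^ (-(3/4):ℝ)) ^ k) := by gcongr
      _ = _ := by ring

lemma vp_summable' : Summable (fun n : ℕ => vp n * (n:ℝ)⁻¹) := by
  refine vp_summable.of_nonneg_of_le (fun n => mul_nonneg (vp_nonneg _) (by positivity)) fun n => ?_
  refine mul_le_mul_of_nonneg_left ?_ (vp_nonneg _)
  rcases Nat.eq_zero_or_pos n with rfl | hn
  · simp
  · rw [← rpow_neg_one]
    exact rpow_le_rpow_of_exponent_le (by exact_mod_cast hn) (by norm_num)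

lemma vp_tsum : ∑' n : ℕ, vp n * (n:ℝ)⁻¹ = ∑' p : Nat.Primes, 1 / (((p:ℕ):ℝ) * (((p:ℕ):ℝ) - 1))
    - ∑' p : Nat.Primes, ∑' k : ℕ, 1 / (((k + 2):ℝ) * ((p:ℕ):ℝ) ^ (k + 2)) := by
  have hs := vp_summable'
  rw [← qq_inj.summable_iff (fun n h => supp_qq n h)] at hs
  rw [← qq_inj.tsum_eq (Function.support_subset_iff'.mpr fun n h => supp_qq n h)]
  have h1 := hs.tsum_prod
  simp only [Function.comp] at h1
  rw [h1]
  have key : ∀ p : Nat.Primes, HasSum (fun k : ℕ => 1 / ((p:ℕ):ℝ) ^ (k+2)) (1 / (((p:ℕ):ℝ) * (((p:ℕ):ℝ) - 1))) := by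
    intro p
    have hp : (1:ℝ) < (p:ℕ) := by exact_mod_cast p.2.one_lt
    have := (hasSum_geometric_of_lt_one (r := ((p:ℕ):ℝ)⁻¹) (by positivity) (inv_lt_one_of_one_lt₀ hp)).mul_left (((p:ℕ):ℝ)⁻¹ ^ 2)
    have e1 : (1 / (((p:ℕ):ℝ) * (((p:ℕ):ℝ) - 1))) = (((p:ℕ):ℝ)⁻¹ ^ 2) * (1 - ((p:ℕ):ℝ)⁻¹)⁻¹ := by
      have : ((p:ℕ):ℝ) - 1 ≠ 0 := by linarith
      field_simp
    rw [e1]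
    refine this.congr_fun fun k => ?_
    rw [← pow_add, one_div, inv_pow, Nat.add_comm 2 k]
  have key2 : ∀ p : Nat.Primes, Summable (fun k : ℕ => 1 / (((k + 2):ℝ) * ((p:ℕ):ℝ) ^ (k + 2))) := by
    intro p
    have hp : (0:ℝ) < (p:ℕ) := by exact_mod_cast p.2.pos
    refine (key p).summable.of_nonneg_of_le (fun k => by positivity) fun k => ?_
    apply one_div_le_one_div_of_le (by positivity)
    have : (1:ℝ) ≤ (k:ℝ) + 2 := by linarith [Nat.cast_nonneg (α := ℝ) k]
    nlinarith [pow_pos hp (k+2)]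
  have hin : ∀ p : Nat.Primes, ∑' k : ℕ, vp (qq (p, k)) * ((qq (p, k):ℕ):ℝ)⁻¹ =
      1 / (((p:ℕ):ℝ) * (((p:ℕ):ℝ) - 1)) - ∑' k : ℕ, 1 / (((k + 2):ℝ) * ((p:ℕ):ℝ) ^ (k + 2)) := by
    intro p
    have hp : (0:ℝ) < (p:ℕ) := by exact_mod_cast p.2.pos
    have := (key p).sub (key2 p).hasSum
    refine HasSum.tsum_eq ?_
    rw [← hasSum_nat_add_iff' 1]
    simp only [Finset.sum_range_one]
    convert this using 1
    · ext k
      simp only [qq, vp_pow]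
      push_cast
      have : (k:ℝ) + 2 ≠ 0 := by positivity
      have : (k:ℝ) + 1 + 1 ≠ 0 := by positivity
      field_simp
      ring
    · simp [qq, show vp (p:ℕ) = 0 by simpa using vp_pow p 0]
  simp_rw [hin]
  have hp1 : Summable (fun p : Nat.Primes => 1 / (((p:ℕ):ℝ) * (((p:ℕ):ℝ) - 1))) := by
    have h1 : Summable (fun p : Nat.Primes => ((p:ℕ):ℝ) ^ (-2:ℝ)) := Nat.Primes.summable_rpow.mpr (by norm_num)
    refine (h1.mul_left 2).of_nonneg_of_le (fun p => ?_) fun p => ?_ <;>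
    have hp : (2:ℝ) ≤ (p:ℕ) := by exact_mod_cast p.2.two_le
    · have : (0:ℝ) < ((p:ℕ):ℝ) - 1 := by linarith
      positivity
    · rw [rpow_neg (by linarith), show (2:ℝ) = ((2:ℕ):ℝ) by norm_num, rpow_natCast, ← div_eq_mul_inv, div_le_div_iff₀ (by nlinarith) (by positivity)]
      push_cast
      nlinarith
  refine Summable.tsum_sub hp1 ?_
  have := hp1.sub hs.prod
  refine this.congr fun p => ?_
  simp only [Function.comp, hin]; ring

lemma vp_part : ∃ K > (0:ℝ), ∀ x : ℝ, 1 ≤ x → |∑ m ∈ Finset.Icc 1 ⌊x⌋₊, vp m * ((⌊x⌋₊ / m:ℕ):ℝ) -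
    x * ∑' n : ℕ, vp n * (n:ℝ)⁻¹| ≤ K * x ^ ((3/4):ℝ) := by
  refine ⟨∑' n : ℕ, vp n * (n:ℝ) ^ (-(3/4):ℝ) + 1, by
    have : 0 ≤ ∑' n : ℕ, vp n * (n:ℝ) ^ (-(3/4):ℝ) := tsum_nonneg fun n => mul_nonneg (vp_nonneg _) (by positivity)
    linarith, fun x hx => ?_⟩
  have hx0 : 0 < x := by linarith
  have hd : ∀ m : ℕ, |vp m * ((⌊x⌋₊ / m:ℕ):ℝ) - x * (vp m * (m:ℝ)⁻¹)| ≤ x ^ ((3/4):ℝ) * (vp m * (m:ℝ) ^ (-(3/4):ℝ)) := by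
    intro m
    rcases Nat.eq_zero_or_pos m with rfl | hm
    · simp
    have hm0 : (0:ℝ) < m := by exact_mod_cast hm
    rw [← Nat.floor_div_natCast]
    have e : vp m * ((⌊x / m⌋₊:ℕ):ℝ) - x * (vp m * (m:ℝ)⁻¹) = - (vp m * (x / m - ⌊x/m⌋₊)) := by
      rw [div_eq_mul_inv]; ring
    have h0 : 0 ≤ x / m := by positivity
    have h1 := Nat.floor_le h0
    rw [e, abs_neg, abs_of_nonneg (mul_nonneg (vp_nonneg _) (by linarith)),
      show x ^ ((3/4):ℝ) * (vp m * (m:ℝ) ^ (-(3/4):ℝ)) = vp m * (x ^ ((3/4):ℝ) * (m:ℝ) ^ (-(3/4):ℝ)) by ring]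
    refine mul_le_mul_of_nonneg_left ?_ (vp_nonneg _)
    have e2 : x ^ ((3/4):ℝ) * (m:ℝ) ^ (-(3/4):ℝ) = (x / m) ^ ((3/4):ℝ) := by
      rw [div_rpow hx0.le hm0.le, rpow_neg hm0.le]; rfl
    rw [e2]
    rcases le_total 1 (x / m) with h | h
    · have := Nat.lt_floor_add_one (x / m)
      have h3 := one_le_rpow h (show (0:ℝ) ≤ 3/4 by norm_num)
      linarith
    · have h3 := rpow_le_rpow_of_exponent_ge (show 0 < x / m by positivity) h (show (3/4:ℝ) ≤ 1 by norm_num)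
      rw [rpow_one] at h3
      have : (0:ℝ) ≤ ⌊x/m⌋₊ := Nat.cast_nonneg _
      linarith
  have e1 : ∑ m ∈ Finset.Icc 1 ⌊x⌋₊, vp m * ((⌊x⌋₊ / m:ℕ):ℝ) = ∑' m : ℕ, vp m * ((⌊x⌋₊ / m:ℕ):ℝ) := by
    refine (tsum_eq_sum fun m hm => ?_).symm
    rw [Finset.mem_Icc, not_and_or, not_le, not_le] at hm
    rcases hm with hm | hm
    · rw [show m = 0 by omega]; simp
    · rw [Nat.div_eq_of_lt hm]; simp
  have hs1 : Summable (fun m : ℕ => vp m * ((⌊x⌋₊ / m:ℕ):ℝ)) := by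
    refine summable_of_ne_finset_zero (s := Finset.Icc 1 ⌊x⌋₊) fun m hm => ?_
    rw [Finset.mem_Icc, not_and_or, not_le, not_le] at hm
    rcases hm with hm | hm
    · rw [show m = 0 by omega]; simp
    · rw [Nat.div_eq_of_lt hm]; simp
  rw [e1, ← tsum_mul_left, ← hs1.tsum_sub (vp_summable'.mul_left x)]
  have := tsum_of_norm_bounded (vp_summable.mul_left (x ^ ((3/4):ℝ))).hasSum (fun m => by rw [Real.norm_eq_abs]; exact hd m)
  rw [Real.norm_eq_abs, tsum_mul_left] at this
  have h2 : 0 ≤ x ^ ((3/4):ℝ) := by positivity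
  linarith

end

end VK

namespace VK
open Real Filter Topology MeasureTheory
open ArithmeticFunction hiding log

noncomputable section

lemma abel_phi {a R g φ : ℕ → ℝ} {M : ℝ} {N : ℕ} (hR : ∀ n, R (n+1) = R n + a (n+1))
    (hg0 : ∀ m, N < m → 0 ≤ g m) (hg : ∀ m, N < m → g (m+1) ≤ g m)
    (hRb : ∀ m, N ≤ m → |R m| ≤ M * φ m) (X:ℕ) (hX : N ≤ X) :
    |∑ m ∈ Finset.Ioc N X, a m * g m| ≤ M * (2 * φ N * g (N+1) + ∑ m ∈ Finset.Ioc N X, g m * (φ m - φ (m-1))) := by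
  have h : |∑ m ∈ Finset.Ioc N X, a m * g m - R X * g (X+1)| ≤
      M * (2 * φ N * g (N+1) + ∑ m ∈ Finset.Ioc N X, g m * (φ m - φ (m-1)) - φ X * g (X+1)) := by
    induction X, hX using Nat.le_induction with
    | base =>
      simp only [Finset.Ioc_self, Finset.sum_empty, zero_sub, abs_neg, abs_mul, add_zero]
      rw [abs_of_nonneg (hg0 _ (Nat.lt_succ_self N))]
      have := mul_le_mul_of_nonneg_right (hRb N le_rfl) (hg0 _ (Nat.lt_succ_self N))
      linarith
    | succ X hX ih =>
      rw [Finset.sum_Ioc_succ_top (by omega), Finset.sum_Ioc_succ_top (by omega)]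
      have h1 := hg (X+1) (by omega)
      have h2 := mul_le_mul_of_nonneg_right (hRb (X+1) (by omega)) (sub_nonneg.mpr h1)
      have e : ∑ m ∈ Finset.Ioc N X, a m * g m + a (X+1) * g (X+1) - R (X+1) * g (X+1+1)
        = (∑ m ∈ Finset.Ioc N X, a m * g m - R X * g (X+1)) + R (X+1) * (g (X+1) - g (X+1+1)) := by
        rw [hR]; ring
      rw [e]
      refine (abs_add_le _ _).trans ?_
      rw [abs_mul (R (X+1)), abs_of_nonneg (sub_nonneg.mpr h1)]
      refine (add_le_add ih h2).trans (le_of_eq ?_)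
      rw [Nat.add_sub_cancel]; ring
  have h3 := mul_le_mul_of_nonneg_right (hRb X hX) (hg0 (X+1) (by omega))
  have h4 : |R X * g (X+1)| ≤ M * φ X * g (X+1) := by
    rwa [abs_mul, abs_of_nonneg (hg0 (X+1) (by omega))]
  have h5 := abs_add_le (∑ m ∈ Finset.Ioc N X, a m * g m - R X * g (X+1)) (R X * g (X+1))
  rw [sub_add_cancel] at h5
  linarith

lemma log_step {m : ℕ} (hm : 2 ≤ m) : 1 / ((m:ℝ)+1) ≤ log ((m:ℝ)+1) - log m ∧ log ((m:ℝ)+1) - log m ≤ 1 / (m:ℝ) := by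
  have hm0 : (0:ℝ) < m := by exact_mod_cast (by omega : 0 < m)
  constructor
  · have := log_le_sub_one_of_pos (show 0 < (m:ℝ) / (m+1) by positivity)
    rw [log_div hm0.ne' (by positivity)] at this
    have e : (m:ℝ) / (m+1) - 1 = -(1/((m:ℝ)+1)) := by field_simp; ring
    linarith
  · have := log_le_sub_one_of_pos (show 0 < ((m:ℝ)+1) / m by positivity)
    rw [log_div (by positivity) hm0.ne'] at this
    have e : ((m:ℝ)+1) / m - 1 = 1/(m:ℝ) := by field_simp; ring
    linarith

lemma log_nat_pos {m : ℕ} (hm : 2 ≤ m) : 0 < log (m:ℝ) := log_pos (by exact_mod_cast (by omega : 1 < m))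

lemma loglog_step {m : ℕ} (hm : 2 ≤ m) : 1 / (((m:ℝ)+1) * log ((m:ℝ)+1)) ≤ log (log ((m:ℝ)+1)) - log (log m) ∧
    log (log ((m:ℝ)+1)) - log (log m) ≤ 1 / ((m:ℝ) * log m) := by
  obtain ⟨h1, h2⟩ := log_step hm
  have hl : 0 < log (m:ℝ) := log_nat_pos hm
  have hl' : 0 < log ((m:ℝ)+1) := by have : 0 < 1 / ((m:ℝ)+1) := by positivity
                                     linarith
  constructor
  · have := log_le_sub_one_of_pos (div_pos hl hl')
    rw [log_div hl.ne' hl'.ne'] at this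
    have e : log (m:ℝ) / log ((m:ℝ)+1) - 1 = -((log ((m:ℝ)+1) - log m) / log ((m:ℝ)+1)) := by field_simp; ring
    have h3 : 1 / (((m:ℝ)+1) * log ((m:ℝ)+1)) ≤ (log ((m:ℝ)+1) - log m) / log ((m:ℝ)+1) := by
      rw [← div_div]; exact div_le_div_of_nonneg_right h1 hl'.le
    linarith
  · have := log_le_sub_one_of_pos (div_pos hl' hl)
    rw [log_div hl'.ne' hl.ne'] at this
    have e : log ((m:ℝ)+1) / log (m:ℝ) - 1 = ((log ((m:ℝ)+1) - log m) / log (m:ℝ)) := by field_simp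
    have h3 : (log ((m:ℝ)+1) - log m) / log (m:ℝ) ≤ 1 / ((m:ℝ) * log (m:ℝ)) := by
      rw [← div_div]; exact div_le_div_of_nonneg_right h2 hl.le
    linarith

lemma VV_bound {N : ℕ} (hN : 2 ≤ N) (X:ℕ) (hX : N ≤ X) :
    0 ≤ log (log X) - log (log N) - ∑ m ∈ Finset.Ioc N X, 1 / ((m:ℝ) * log m) ∧
    log (log X) - log (log N) - ∑ m ∈ Finset.Ioc N X, 1 / ((m:ℝ) * log m) ≤ 1 / ((N:ℝ) * log N) - 1 / ((X:ℝ) * log X) := by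
  induction X, hX using Nat.le_induction with
  | base => simp
  | succ X hX ih =>
    obtain ⟨h1, h2⟩ := ih
    obtain ⟨h3, h4⟩ := loglog_step (m := X) (by omega)
    rw [Finset.sum_Ioc_succ_top (by omega)]
    push_cast
    constructor <;> linarith

lemma log_sq_sum {N : ℕ} (hN : 2 ≤ N) (X:ℕ) (hX : N ≤ X) :
    ∑ m ∈ Finset.Ioc N X, 1 / ((m:ℝ) * log m ^ 2) ≤ 1 / log N - 1 / log X := by
  induction X, hX using Nat.le_induction with
  | base => simp
  | succ X hX ih =>
    obtain ⟨h1, h2⟩ := log_step (m := X) (by omega)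
    have hl : 0 < log (X:ℝ) := log_nat_pos (by omega)
    have hX0 : (0:ℝ) < X := by exact_mod_cast (by omega : 0 < X)
    have hl' : log (X:ℝ) < log ((X:ℝ)+1) := by have : 0 < 1 / ((X:ℝ)+1) := by positivity
                                               linarith
    rw [Finset.sum_Ioc_succ_top (by omega)]
    push_cast
    have : 1 / (((X:ℝ)+1) * log ((X:ℝ)+1) ^ 2) ≤ 1 / log X - 1 / log ((X:ℝ)+1) := by
      have e : 1 / log (X:ℝ) - 1 / log ((X:ℝ)+1) = (log ((X:ℝ)+1) - log X) / (log X * log ((X:ℝ)+1)) := by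
        have := (hl.trans hl').ne'
        field_simp
      rw [e, ← div_div]
      refine div_le_div₀ (by linarith [show 0 < 1 / ((X:ℝ)+1) by positivity]) h1 (mul_pos hl (hl.trans hl')) ?_
      rw [pow_two]
      exact mul_le_mul_of_nonneg_right hl'.le (hl.trans hl').le
    linarith

def AA (n:ℕ) : ℝ := ∑ m ∈ Finset.Icc 1 n, ww m / m

lemma AA_sub {N X : ℕ} (h : N ≤ X) : AA X - AA N = ∑ m ∈ Finset.Ioc N X, ww m / m := by
  induction X, h using Nat.le_induction with
  | base => simp
  | succ X hX ih =>
    rw [Finset.sum_Ioc_succ_top (by omega), ← ih]; simp only [AA]; rw [Finset.sum_Icc_succ_top (by omega)]; ring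

lemma RR_succ (n:ℕ) : RR ((n+1:ℕ):ℝ) = RR (n:ℝ) + aa (n+1) := by
  simp only [RR, Nat.floor_natCast]
  rw [Finset.sum_Icc_succ_top (by omega)]

lemma RR_nat {ε : ℝ} (hε : 0 < ε) (hε3 : ε ≤ 1 / 3) : ∃ N0 : ℕ, 3 ≤ N0 ∧ ∃ C > (0:ℝ), ∀ n : ℕ, N0 ≤ n →
    |RR (n:ℝ)| ≤ C * n * exp (-(log n) ^ (3/5 - 3/5 * ε) / 128) := by
  obtain ⟨X0, C, hC, h⟩ := RR_bound hε hε3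
  refine ⟨max 3 ⌈X0⌉₊, le_max_left _ _, C, hC, fun n hn => h n ?_⟩
  exact (Nat.le_ceil X0).trans (by exact_mod_cast (le_max_right _ _).trans hn)

def ph (n:ℕ) : ℝ := ∑ k ∈ Finset.Icc 2 n, 1 / log (k:ℝ) ^ 2

lemma ph_lower {n : ℕ} (hn : 2 ≤ n) : (n:ℝ) / log n ^ 2 ≤ 2 * ph n := by
  have h1 : ∀ k ∈ Finset.Icc 2 n, 1 / log (n:ℝ) ^ 2 ≤ 1 / log (k:ℝ) ^ 2 := by
    intro k hk
    rw [Finset.mem_Icc] at hk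
    have h0 := log_nat_pos hk.1
    have h2 : log (k:ℝ) ≤ log n := log_le_log (by exact_mod_cast (by omega : 0 < k)) (by exact_mod_cast hk.2)
    gcongr
  have h2 := Finset.card_nsmul_le_sum _ _ _ h1
  rw [Nat.card_Icc, nsmul_eq_mul] at h2
  have h3 : (n:ℝ) ≤ 2 * ((n + 1 - 2:ℕ):ℝ) := by exact_mod_cast (by omega : n ≤ 2 * (n+1-2))
  have h4 : (0:ℝ) ≤ 1 / log (n:ℝ) ^ 2 := by positivity
  rw [ph, div_eq_mul_one_div]
  have := mul_le_mul_of_nonneg_right h3 h4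
  linarith

lemma ph_upper (n:ℕ) : ph n ≤ 4 * n := by
  have h1 : ∀ k ∈ Finset.Icc 2 n, 1 / log (k:ℝ) ^ 2 ≤ 4 := by
    intro k hk
    rw [Finset.mem_Icc] at hk
    have h2 : log 2 ≤ log (k:ℝ) := log_le_log (by norm_num) (by exact_mod_cast hk.1)
    have h3 := Real.log_two_gt_d9
    have h4 : (1/2:ℝ) ≤ log k := by linarith
    rw [div_le_iff₀ (by positivity)]
    nlinarith
  have h2 := Finset.sum_le_card_nsmul _ _ _ h1
  rw [Nat.card_Icc, nsmul_eq_mul] at h2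
  have h3 : ((n + 1 - 2:ℕ):ℝ) ≤ n := by exact_mod_cast (by omega : n + 1 - 2 ≤ n)
  rw [ph]; linarith

theorem AA_lim {ε : ℝ} (hε : 0 < ε) (hε3 : ε ≤ 1 / 3) : ∃ κ : ℝ, ∃ N0 : ℕ, 3 ≤ N0 ∧ ∃ C > (0:ℝ), ∀ n : ℕ, N0 ≤ n →
    |AA n - log (log n) - κ| ≤ C * exp (-(log n) ^ (3/5 - 3/5 * ε) / 256) := by
  obtain ⟨N1, hN1, C, hC, hR⟩ := RR_nat hε hε3
  set b := 3/5 - 3/5 * ε with hb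
  have hb0 : 0 < b := by rw [hb]; linarith
  have hb1 : b ≤ 1 := by rw [hb]; linarith
  obtain ⟨N2, hN2⟩ := eventually_atTop.mp ((tendsto_log_atTop.comp tendsto_natCast_atTop_atTop).eventually
    ((ev_pow_exp 1 2 (c := 1/256) (by norm_num) hb0).and (eventually_ge_atTop 1)))
  set e : ℕ → ℝ := fun n => exp (-(log n) ^ b / 256) with he
  have he0 : ∀ n, 0 < e n := fun n => exp_pos _
  set N0 := max N1 N2 with hN0
  have hmono : ∀ N m : ℕ, N0 ≤ N → N ≤ m → e m ≤ e N := by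
    intro N m hN hm
    have hL : 1 ≤ log (N:ℝ) := (hN2 N ((le_max_right _ _).trans hN)).2
    have h3 : (0:ℝ) < N := by exact_mod_cast (by omega : 0 < N)
    have h1 : log (N:ℝ) ≤ log m := log_le_log h3 (by exact_mod_cast hm)
    have h2 : log (N:ℝ) ^ b ≤ log (m:ℝ) ^ b := rpow_le_rpow (by linarith) h1 hb0.le
    apply exp_le_exp.mpr; linarith
  have key : ∀ N X : ℕ, N0 ≤ N → N ≤ X → |(AA X - log (log X)) - (AA N - log (log N))| ≤ (64 * C + 1) * e N := by
    intro N X hN hX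
    have hN3 : 3 ≤ N := hN1.trans ((le_max_left _ _).trans hN)
    have hN0' : (0:ℝ) < N := by exact_mod_cast (by omega : 0 < N)
    have hLN : 1 ≤ log (N:ℝ) := (hN2 N ((le_max_right _ _).trans hN)).2
    have hRb : ∀ m, N ≤ m → |RR (m:ℝ)| ≤ (2 * C * e N) * ph m := by
      intro m hm
      have h1 := hR m ((le_max_left _ _).trans (hN.trans hm))
      obtain ⟨h2, h2'⟩ := hN2 m ((le_max_right _ _).trans (hN.trans hm))
      simp only [Function.comp] at h2 h2'
      have h3 : exp (-(log m) ^ b / 128) = e m * e m := by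
        rw [he]; simp only; rw [← exp_add]; congr 1; ring
      have h4 : e m ≤ 1 / log m ^ 2 := by
        have hl : 0 < log (m:ℝ) := by linarith
        rw [le_div_iff₀ (by positivity)]
        have : e m * exp (1/256 * log m ^ b) = 1 := by
          rw [he]; simp only; rw [← exp_add, exp_eq_one_iff]; ring
        rw [one_mul, show (2:ℝ) = ((2:ℕ):ℝ) by norm_num, rpow_natCast] at h2
        have h6 := mul_le_mul_of_nonneg_left h2 (he0 m).le
        linarith
      rw [h3] at h1
      have h5 := ph_lower (n := m) (by omega)
      calc |RR (m:ℝ)| ≤ C * m * (e m * e m) := h1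
        _ ≤ C * m * (e N * (1 / log m ^ 2)) := by
          have := hmono N m hN hm
          have := he0 m
          have := he0 N
          gcongr
        _ = C * e N * (m / log m ^ 2) := by ring
        _ ≤ C * e N * (2 * ph m) := by have := he0 N; gcongr
        _ = _ := by ring
    have hlp : ∀ m : ℕ, N < m → 1 ≤ log (m:ℝ) := fun m hm =>
      hLN.trans (log_le_log hN0' (by exact_mod_cast hm.le))
    have hA := abel_phi (a := aa) (R := fun n => RR (n:ℝ)) (g := fun m : ℕ => 1 / ((m:ℝ) * log m)) (φ := ph)
      (N := N) RR_succ (fun m hm => by have := hlp m hm; positivity) (fun m hm => by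
        have h1 := hlp m hm
        have h2 : log (m:ℝ) ≤ log ((m+1:ℕ):ℝ) := log_le_log (by exact_mod_cast (by omega : 0 < m)) (by exact_mod_cast (by omega))
        have h3 : (0:ℝ) < m := by exact_mod_cast (by omega : 0 < m)
        have h4 : (m:ℝ) ≤ ((m+1:ℕ):ℝ) := by exact_mod_cast (by omega)
        apply one_div_le_one_div_of_le (by positivity)
        gcongr) hRb X hX
    have hS : ∑ m ∈ Finset.Ioc N X, 1 / ((m:ℝ) * log m) * (ph m - ph (m-1)) ≤ 1 := by
      have h1 := log_sq_sum (N := N) (by omega) X hX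
      have h2 : ∑ m ∈ Finset.Ioc N X, 1 / ((m:ℝ) * log m) * (ph m - ph (m-1)) ≤ ∑ m ∈ Finset.Ioc N X, 1 / ((m:ℝ) * log m ^ 2) := by
        refine Finset.sum_le_sum fun m hm => ?_
        rw [Finset.mem_Ioc] at hm
        obtain ⟨k, rfl⟩ : ∃ k, m = k + 1 := ⟨m-1, by omega⟩
        have hl := hlp _ hm.1
        rw [Nat.add_sub_cancel, ph, Finset.sum_Icc_succ_top (by omega), ph, add_sub_cancel_left]
        have h3 : 1 / log ((k+1:ℕ):ℝ) ^ 2 ≤ 1 / log ((k+1:ℕ):ℝ) := by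
          apply one_div_le_one_div_of_le (by linarith)
          exact le_self_pow₀ hl (by norm_num)
        calc 1 / (((k+1:ℕ):ℝ) * log ((k+1:ℕ):ℝ)) * (1 / log ((k+1:ℕ):ℝ) ^ 2) ≤ 1 / (((k+1:ℕ):ℝ) * log ((k+1:ℕ):ℝ)) * (1 / log ((k+1:ℕ):ℝ)) := by gcongr
          _ = _ := by field_simp
      have h5 : 1 / log (N:ℝ) ≤ 1 := by rw [div_le_one (by linarith)]; exact hLN
      have h6 : 0 ≤ 1 / log (X:ℝ) := by
        have := log_natCast_nonneg X
        positivity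
      linarith
    have hP : 2 * ph N * (1 / (((N+1:ℕ):ℝ) * log ((N+1:ℕ):ℝ))) ≤ 8 := by
      have h1 := ph_upper N
      have h2 := hlp (N+1) (by omega)
      rw [mul_one_div, div_le_iff₀ (by positivity)]
      have : (N:ℝ) * 1 ≤ ((N+1:ℕ):ℝ) * log ((N+1:ℕ):ℝ) := mul_le_mul (by exact_mod_cast (by omega)) h2 (by norm_num) (by positivity)
      linarith
    obtain ⟨hV1, hV2⟩ := VV_bound (N := N) (by omega) X hX
    have hV3 : 0 ≤ 1 / ((X:ℝ) * log X) := by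
      have := log_natCast_nonneg X
      positivity
    have hV4 : 1 / ((N:ℝ) * log N) ≤ e N := by
      have h1 : 1 / ((N:ℝ) * log N) ≤ 1 / N := by
        apply one_div_le_one_div_of_le hN0'
        exact le_mul_of_one_le_right hN0'.le hLN
      have h2 : (1:ℝ) / N = exp (- log N) := by rw [exp_neg, exp_log hN0', one_div]
      have h3 : log (N:ℝ) ^ b ≤ log N := by
        have := rpow_le_rpow_of_exponent_le hLN hb1
        rwa [rpow_one] at this
      have h4 : exp (-log (N:ℝ)) ≤ e N := by apply exp_le_exp.mpr; linarith
      linarith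
    have hsplit : ∑ m ∈ Finset.Ioc N X, ww m / m = ∑ m ∈ Finset.Ioc N X, aa m * (1 / ((m:ℝ) * log m)) + ∑ m ∈ Finset.Ioc N X, 1 / ((m:ℝ) * log m) := by
      rw [← Finset.sum_add_distrib]
      refine Finset.sum_congr rfl fun m hm => ?_
      rw [Finset.mem_Ioc] at hm
      have := hlp m hm.1
      rw [aa, if_neg (by omega), ww]
      have h3 : (m:ℝ) ≠ 0 := Nat.cast_ne_zero.mpr (by omega)
      field_simp
      ring
    have hM : (2 * C * e N) * (2 * ph N * (1 / (((N+1:ℕ):ℝ) * log ((N+1:ℕ):ℝ))) + ∑ m ∈ Finset.Ioc N X, 1 / ((m:ℝ) * log m) * (ph m - ph (m-1))) ≤ (2 * C * e N) * 9 :=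
      mul_le_mul_of_nonneg_left (by linarith) (by have := he0 N; positivity)
    have hA' := abs_le.mp (hA.trans hM)
    have hAs := AA_sub hX
    have h18 : 0 ≤ C * e N := by have := he0 N; positivity
    obtain ⟨ha1, ha2⟩ := hA'
    rw [abs_le]
    constructor <;> linarith
  have het : Tendsto (fun n => (64 * C + 1) * e n) atTop (𝓝 0) := by
    rw [show (0:ℝ) = (64 * C + 1) * 0 by ring]
    refine Tendsto.const_mul _ ?_
    refine tendsto_exp_atBot.comp ?_
    have h1 := ((tendsto_rpow_atTop hb0).comp (tendsto_log_atTop.comp tendsto_natCast_atTop_atTop)).const_mul_atTop_of_neg (show (-1/256:ℝ) < 0 by norm_num)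
    refine h1.congr fun n => ?_
    simp only [Function.comp]; ring
  have hcau : CauchySeq (fun n => AA (n + N0) - log (log ((n+N0:ℕ):ℝ))) := by
    refine cauchySeq_of_le_tendsto_0' (fun n => (64 * C + 1) * e (n+N0)) (fun n m hnm => ?_) (het.comp (tendsto_add_atTop_nat N0))
    rw [dist_comm, Real.dist_eq]
    exact key (n+N0) (m+N0) (by omega) (by omega)
  obtain ⟨κ, hκ⟩ := cauchySeq_tendsto_of_complete hcau
  have hκ' : Tendsto (fun n : ℕ => AA n - log (log (n:ℝ))) atTop (𝓝 κ) := (tendsto_add_atTop_iff_nat N0).mp hκ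
  refine ⟨κ, N0, hN1.trans (le_max_left _ _), 64 * C + 1, by positivity, fun n hn => ?_⟩
  have h1 := (hκ'.sub_const (AA n - log (log n))).abs
  rw [abs_sub_comm]
  refine le_of_tendsto h1 ?_
  filter_upwards [eventually_ge_atTop n] with X hX
  exact key n X hn hX

end

end VK

namespace VK
open Real Filter Topology MeasureTheory
open ArithmeticFunction hiding log

noncomputable section

def Lw (s:ℂ) : ℂ := LSeries (fun n => (ww n:ℂ)) s

lemma ww_absc : LSeries.abscissaOfAbsConv (fun n => (ww n:ℂ)) ≤ 1 :=
  LSeries.abscissaOfAbsConv_le_of_le_const ⟨1, fun n _ => by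
    rw [Complex.norm_real, Real.norm_eq_abs, abs_of_nonneg (ww_nonneg n)]; exact ww_le_one n⟩

lemma ww_logMul : LSeries.logMul (fun n => (ww n:ℂ)) = fun n => (vonMangoldt n:ℂ) := by
  ext n
  rw [LSeries.logMul, ← Complex.natCast_log, ← Complex.ofReal_mul, ww]
  congr 1
  rcases Nat.lt_or_ge n 2 with h | h
  · interval_cases n <;> simp
  · have := (log_nat_pos h).ne'
    field_simp

lemma zeta_exp {σ : ℝ} (hσ : 1 < σ) : riemannZeta σ * Complex.exp (-Lw σ) = 1 := by
  have hd : ∀ x ∈ Set.Ioi (1:ℝ), HasDerivAt (fun x : ℝ => riemannZeta x * Complex.exp (-Lw x)) 0 x := by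
    intro x hx
    have hx1 : 1 < ((x:ℂ)).re := by simpa using hx
    have h1 : HasDerivAt Lw (-LSeries (LSeries.logMul (fun n => (ww n:ℂ))) x) x := by
      refine LSeries_hasDerivAt (ww_absc.trans_lt ?_)
      rw [Complex.ofReal_re]; exact_mod_cast hx
    rw [ww_logMul, LSeries_vonMangoldt_eq_deriv_riemannZeta_div hx1] at h1
    have hz : riemannZeta (x:ℂ) ≠ 0 := riemannZeta_ne_zero_of_one_lt_re hx1
    have h2 : HasDerivAt riemannZeta (deriv riemannZeta x) x := by
      refine (differentiableAt_riemannZeta ?_).hasDerivAt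
      intro h; rw [h] at hx1; simp at hx1
    have h3 := (h2.mul (h1.neg.cexp)).comp_ofReal
    refine h3.congr_deriv ?_
    field_simp
    ring
  obtain ⟨a, ha⟩ := isOpen_Ioi.exists_is_const_of_deriv_eq_zero isPreconnected_Ioi
    (fun x hx => (hd x hx).differentiableAt.differentiableWithinAt) (fun x hx => (hd x hx).deriv)
  have t1 : Tendsto (fun x : ℝ => riemannZeta x) atTop (𝓝 1) := by
    have := LSeries.tendsto_atTop (f := 1) ((LSeries.abscissaOfAbsConv_le_of_le_const ⟨1, fun n _ => by simp⟩).trans_lt (by decide : (1:EReal) < ⊤))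
    refine (this.congr' ?_)
    filter_upwards [eventually_gt_atTop 1] with x hx
    exact LSeries_one_eq_riemannZeta (by simpa using hx)
  have t2 : Tendsto (fun x : ℝ => Lw x) atTop (𝓝 0) := by
    have := LSeries.tendsto_atTop (f := fun n => (ww n:ℂ)) (ww_absc.trans_lt (by decide : (1:EReal) < ⊤))
    have e : ((ww 1:ℝ):ℂ) = 0 := by simp [ww]
    rw [e] at this
    exact this
  have t3 := t1.mul (t2.neg.cexp)
  rw [neg_zero, Complex.exp_zero, one_mul] at t3
  have t4 : Tendsto (fun x : ℝ => riemannZeta x * Complex.exp (-Lw x)) atTop (𝓝 a) := by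
    refine tendsto_const_nhds.congr' ?_
    filter_upwards [eventually_gt_atTop 1] with x hx
    exact (ha x hx).symm
  rw [ha σ hσ, tendsto_nhds_unique t4 t3]

lemma AA_le (n:ℕ) : AA n ≤ 1 + log n := by
  have h := harmonic_le_one_add_log n
  rw [harmonic_eq_sum_Icc] at h
  push_cast at h
  refine le_trans (Finset.sum_le_sum fun m _ => ?_) h
  rw [← one_div]
  exact div_le_div_of_nonneg_right (ww_le_one m) (by positivity)

lemma AA_nonneg (n:ℕ) : 0 ≤ AA n := Finset.sum_nonneg fun m _ => div_nonneg (ww_nonneg m) (by positivity)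

lemma Lw_int {δ : ℝ} (hδ : 0 < δ) : Lw ((1 + δ:ℝ):ℂ) = ((∫ v in Set.Ioi (0:ℝ), AA ⌊exp (v / δ)⌋₊ * exp (-v):ℝ):ℂ) := by
  have hO : (fun n : ℕ => ∑ k ∈ Finset.Icc 1 n, ww k / k) =O[atTop] fun n => (n:ℝ) ^ (δ/2) := by
    refine Asymptotics.IsBigO.of_bound (1 + 1/(δ/2)) ?_
    filter_upwards [eventually_ge_atTop 1] with n hn
    have h1 := AA_le n
    have h2 := Real.log_natCast_le_rpow_div n (show 0 < δ/2 by positivity)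
    have h3 : 1 ≤ (n:ℝ) ^ (δ/2) := one_le_rpow (by exact_mod_cast hn) (by positivity)
    change |AA n| ≤ _
    rw [Real.norm_eq_abs, abs_of_nonneg (AA_nonneg n), abs_of_nonneg (by positivity)]
    calc AA n ≤ 1 + log n := h1
      _ ≤ (n:ℝ) ^ (δ/2) + (n:ℝ) ^ (δ/2) / (δ/2) := by linarith
      _ = _ := by ring
  have h1 := LSeries_eq_mul_integral_of_nonneg (fun n => ww n / n) (r := δ/2) (by positivity) (s := (δ:ℂ)) (by rw [Complex.ofReal_re]; linarith)
    hO (fun n => div_nonneg (ww_nonneg n) (by positivity))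
  have h2 : Lw ((1 + δ:ℝ):ℂ) = LSeries (fun n => ((ww n / n:ℝ):ℂ)) δ := by
    rw [Lw, LSeries, LSeries]
    congr 1
    ext n
    rcases Nat.eq_zero_or_pos n with rfl | hn
    · simp
    have hn' : (n:ℂ) ≠ 0 := Nat.cast_ne_zero.mpr hn.ne'
    rw [LSeries.term_of_ne_zero hn.ne', LSeries.term_of_ne_zero hn.ne']
    push_cast
    rw [Complex.cpow_add _ _ hn', Complex.cpow_one, div_div]
  have h3 : ∀ t ∈ Set.Ioi (1:ℝ), (∑ k ∈ Finset.Icc 1 ⌊t⌋₊, ((ww k / k:ℝ):ℂ)) * (t:ℂ) ^ (-((δ:ℂ) + 1)) = ((AA ⌊t⌋₊ * t ^ (-(δ+1)):ℝ):ℂ) := by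
    intro t ht
    have ht0 : 0 ≤ t := (zero_lt_one.trans ht).le
    rw [Complex.ofReal_mul, Complex.ofReal_cpow ht0, AA]
    push_cast
    rfl
  rw [h2, h1, setIntegral_congr_fun measurableSet_Ioi h3, integral_complex_ofReal, ← Complex.ofReal_mul]
  congr 1
  have himg : (fun v : ℝ => exp (v / δ)) '' Set.Ioi 0 = Set.Ioi 1 := by
    ext t
    simp only [Set.mem_image, Set.mem_Ioi]
    constructor
    · rintro ⟨v, hv, rfl⟩
      exact one_lt_exp_iff.mpr (by positivity)
    · intro ht
      refine ⟨δ * log t, mul_pos hδ (log_pos ht), ?_⟩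
      rw [mul_div_cancel_left₀ _ hδ.ne', exp_log (by linarith)]
  have h4 := integral_image_eq_integral_abs_deriv_smul (s := Set.Ioi (0:ℝ)) (f := fun v => exp (v / δ)) (f' := fun v => exp (v / δ) * (1 / δ)) measurableSet_Ioi
    (fun v _ => ((hasDerivAt_id v).div_const δ).exp.hasDerivWithinAt) (fun u _ v _ h => by
      have := exp_injective h
      field_simp at this
      exact this) (fun t => AA ⌊t⌋₊ * t ^ (-(δ+1)))
  rw [himg] at h4
  rw [h4, ← integral_const_mul]
  refine setIntegral_congr_fun measurableSet_Ioi fun v _ => ?_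
  simp only [smul_eq_mul]
  rw [abs_of_pos (by positivity), ← exp_mul]
  have e : exp (-v) = exp (v / δ) * exp (v / δ * (-(δ+1))) := by
    rw [← exp_add]; congr 1; field_simp; ring
  rw [e]; field_simp

lemma log_exp_int : ∫ v in Set.Ioi (0:ℝ), log v * exp (-v) = -eulerMascheroniConstant := by
  have h1 := Complex.hasDerivAt_GammaIntegral (s := 1) (by simp)
  have h2 : HasDerivAt Complex.GammaIntegral (-(eulerMascheroniConstant:ℂ)) 1 := by
    refine Complex.hasDerivAt_Gamma_one.congr_of_eventuallyEq ?_
    have : ∀ᶠ s : ℂ in 𝓝 1, 0 < s.re := (isOpen_lt continuous_const Complex.continuous_re).mem_nhds (by simp)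
    filter_upwards [this] with s hs
    exact (Complex.Gamma_eq_integral hs).symm
  have h3 := h1.unique h2
  simp only [sub_self, Complex.cpow_zero, one_mul] at h3
  have h4 : ((∫ v in Set.Ioi (0:ℝ), log v * exp (-v):ℝ):ℂ) = ((-eulerMascheroniConstant:ℝ):ℂ) := by
    rw [← integral_complex_ofReal]
    push_cast
    push_cast at h3
    exact h3
  exact_mod_cast h4

lemma log_exp_integrable : IntegrableOn (fun v => log v * exp (-v)) (Set.Ioi (0:ℝ)) := by
  by_contra h
  have := log_exp_int
  rw [integral_undef h] at this
  linarith [one_half_lt_eulerMascheroniConstant]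

lemma exp_integrable : IntegrableOn (fun v => exp (-v)) (Set.Ioi (0:ℝ)) := integrableOn_exp_neg_Ioi 0

lemma floor_exp {u : ℝ} (hu : 1 ≤ u) : 2 ≤ ⌊exp u⌋₊ ∧ |log (log (⌊exp u⌋₊:ℝ)) - log u| ≤ 1 / ((⌊exp u⌋₊:ℝ) * log ⌊exp u⌋₊) := by
  have h2 : 2 ≤ ⌊exp u⌋₊ := Nat.le_floor (by push_cast; linarith [add_one_le_exp u])
  have hl := log_nat_pos h2
  obtain ⟨_, h3⟩ := loglog_step h2
  have h4 := log_le_log (by exact_mod_cast (by omega : 0 < ⌊exp u⌋₊)) (Nat.floor_le (exp_pos u).le)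
  have h5 := log_le_log (exp_pos u) (Nat.lt_floor_add_one (exp u)).le
  rw [log_exp] at h4 h5
  have h6 := log_le_log hl h4
  have h7 := log_le_log (by linarith) h5
  refine ⟨h2, ?_⟩
  rw [abs_sub_comm, abs_of_nonneg (by linarith)]
  linarith

theorem kappa_eq {κ : ℝ} (h : Tendsto (fun n : ℕ => AA n - log (log n)) atTop (𝓝 κ)) : κ = eulerMascheroniConstant := by
  obtain ⟨K, hK⟩ := (Metric.isBounded_range_of_tendsto _ h).exists_norm_le
  have hK' : ∀ n : ℕ, |AA n - log (log n)| ≤ K := fun n => hK _ (Set.mem_range_self n)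
  have hK0 : 0 ≤ K := (abs_nonneg _).trans (hK' 0)
  set D : ℝ → ℝ := fun u => AA ⌊exp u⌋₊ - log u with hD
  have hfl : Tendsto (fun u => ⌊exp u⌋₊) atTop atTop := tendsto_nat_floor_atTop.comp tendsto_exp_atTop
  have hDt : Tendsto D atTop (𝓝 κ) := by
    have h1 := h.comp hfl
    have h2 : Tendsto (fun u : ℝ => log (log (⌊exp u⌋₊:ℝ)) - log u) atTop (𝓝 0) := by
      refine squeeze_zero_norm' (a := fun u => 1 / ((⌊exp u⌋₊:ℝ) * log ⌊exp u⌋₊)) ?_ ?_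
      · filter_upwards [eventually_ge_atTop 1] with u hu
        exact (floor_exp hu).2
      · have : Tendsto (fun n : ℕ => ((n:ℝ) * log n)) atTop atTop :=
          tendsto_natCast_atTop_atTop.atTop_mul_atTop₀ (tendsto_log_atTop.comp tendsto_natCast_atTop_atTop)
        exact (this.comp hfl).inv_tendsto_atTop.congr fun u => by simp [Function.comp]
    have h3 := h1.add h2
    rw [add_zero] at h3
    refine h3.congr fun u => ?_
    simp only [Function.comp, hD]; ring
  have hDb : ∀ v δ : ℝ, 0 < v → 0 < δ → δ ≤ 1 → |D (v / δ)| ≤ (K + 3) + |log v| := by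
    intro v δ hv hδ hδ1
    have hvd : v ≤ v / δ := by rw [le_div_iff₀ hδ]; nlinarith
    rcases le_total 1 (v/δ) with h1 | h1
    · obtain ⟨h2, h3⟩ := floor_exp h1
      have h4 := hK' ⌊exp (v/δ)⌋₊
      have h5 : 1 / ((⌊exp (v/δ)⌋₊:ℝ) * log ⌊exp (v/δ)⌋₊) ≤ 1 := by
        have h6 : (2:ℝ) ≤ (⌊exp (v/δ)⌋₊:ℝ) := by exact_mod_cast h2
        have h7 := log_le_log (by norm_num) h6
        have h8 := Real.log_two_gt_d9
        rw [div_le_one (by nlinarith)]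
        nlinarith
      have h9 := abs_add_le (AA ⌊exp (v/δ)⌋₊ - log (log ⌊exp (v/δ)⌋₊)) (log (log (⌊exp (v/δ)⌋₊:ℝ)) - log (v/δ))
      rw [sub_add_sub_cancel] at h9
      have := abs_nonneg (log v)
      simp only [hD]
      linarith
    · have h2 : |log (v/δ)| ≤ |log v| := by
        rw [abs_of_nonpos (log_nonpos (by linarith) h1), abs_of_nonpos (log_nonpos hv.le (by linarith))]
        linarith [log_le_log hv hvd]
      have h4 : AA ⌊exp (v/δ)⌋₊ ≤ 2 := by
        have h5 := AA_le ⌊exp (v/δ)⌋₊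
        have h6 : log (⌊exp (v/δ)⌋₊:ℝ) ≤ v/δ := by
          have h7 : 0 < ⌊exp (v/δ)⌋₊ := Nat.floor_pos.mpr (one_le_exp (by positivity))
          have := log_le_log (by exact_mod_cast h7) (Nat.floor_le (exp_pos (v/δ)).le)
          rwa [log_exp] at this
        linarith
      have h5 := abs_sub (AA ⌊exp (v/δ)⌋₊) (log (v/δ))
      rw [abs_of_nonneg (AA_nonneg _)] at h5
      simp only [hD]
      linarith
  have hmeas : ∀ δ : ℝ, Measurable (fun v => D (v/δ) * exp (-v)) := by
    intro δ
    have h1 : Measurable (fun v : ℝ => AA ⌊exp (v/δ)⌋₊) :=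
      (measurable_from_nat (f := AA)).comp (Nat.measurable_floor.comp (measurable_exp.comp (measurable_id.div_const δ)))
    exact (h1.sub (measurable_log.comp (measurable_id.div_const δ))).mul (measurable_exp.comp measurable_neg)
  have hbint : IntegrableOn (fun v => ((K+3) + |log v|) * exp (-v)) (Set.Ioi (0:ℝ)) := by
    have := (exp_integrable.const_mul (K+3)).add log_exp_integrable.norm
    refine this.congr (ae_of_all _ fun v => ?_)
    simp only [Pi.add_apply, norm_mul, Real.norm_eq_abs, abs_of_pos (exp_pos _)]
    ring
  have hnorm : ∀ v δ : ℝ, 0 < v → 0 < δ → δ ≤ 1 → ‖D (v / δ) * exp (-v)‖ ≤ ((K + 3) + |log v|) * exp (-v) := by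
    intro v δ hv hδ hδ1
    rw [norm_mul, Real.norm_eq_abs, Real.norm_eq_abs, abs_of_pos (exp_pos _)]
    exact mul_le_mul_of_nonneg_right (hDb v δ hv hδ hδ1) (exp_pos _).le
  have hev : ∀ᶠ δ : ℝ in 𝓝[>] 0, 0 < δ ∧ δ ≤ 1 := by
    filter_upwards [Ioo_mem_nhdsGT (show (0:ℝ) < 1 by norm_num)] with δ hδ
    exact ⟨hδ.1, hδ.2.le⟩
  have hlim := tendsto_integral_filter_of_dominated_convergence (μ := volume.restrict (Set.Ioi (0:ℝ))) (l := 𝓝[>] (0:ℝ))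
    (F := fun δ v => D (v/δ) * exp (-v)) (f := fun v => κ * exp (-v)) (fun v => ((K+3) + |log v|) * exp (-v))
    (Eventually.of_forall fun δ => (hmeas δ).aestronglyMeasurable)
    (by
      filter_upwards [hev] with δ hδ
      filter_upwards [ae_restrict_mem measurableSet_Ioi] with v hv
      exact hnorm v δ hv hδ.1 hδ.2) hbint
    (by
      filter_upwards [ae_restrict_mem measurableSet_Ioi] with v hv
      refine (hDt.comp ?_).mul_const _
      exact (tendsto_inv_nhdsGT_zero.const_mul_atTop (show 0 < v from hv)).congr fun δ => rfl)
  rw [integral_const_mul, integral_exp_neg_Ioi_zero, mul_one] at hlim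
  have hLw : ∀ δ : ℝ, 0 < δ → δ ≤ 1 → (∫ v in Set.Ioi (0:ℝ), AA ⌊exp (v / δ)⌋₊ * exp (-v)) =
      (∫ v in Set.Ioi (0:ℝ), D (v/δ) * exp (-v)) - eulerMascheroniConstant - log δ := by
    intro δ hδ hδ1
    have hi : IntegrableOn (fun v => D (v/δ) * exp (-v)) (Set.Ioi (0:ℝ)) := by
      refine Integrable.mono' hbint (hmeas δ).aestronglyMeasurable ?_
      filter_upwards [ae_restrict_mem measurableSet_Ioi] with v hv
      exact hnorm v δ hv hδ hδ1
    have h1 : ∀ v ∈ Set.Ioi (0:ℝ), AA ⌊exp (v / δ)⌋₊ * exp (-v) = D (v/δ) * exp (-v) + (log v * exp (-v) - log δ * exp (-v)) := by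
      intro v hv
      simp only [hD]
      rw [log_div (ne_of_gt hv) hδ.ne']; ring
    rw [setIntegral_congr_fun measurableSet_Ioi h1]
    have i2 : IntegrableOn (fun v => log δ * exp (-v)) (Set.Ioi (0:ℝ)) := exp_integrable.const_mul _
    have e1 := integral_add hi (log_exp_integrable.sub i2)
    have e2 := integral_sub log_exp_integrable i2
    simp only [Pi.sub_apply] at e1
    rw [e1, e2, log_exp_int, integral_const_mul, integral_exp_neg_Ioi_zero]; ring
  have hz : Tendsto (fun δ : ℝ => exp ((∫ v in Set.Ioi (0:ℝ), D (v/δ) * exp (-v)) - eulerMascheroniConstant)) (𝓝[>] 0) (𝓝 1) := by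
    have h1 : Tendsto (fun δ : ℝ => ((1 + δ:ℝ):ℂ)) (𝓝[>] 0) (𝓝[≠] 1) := by
      refine tendsto_nhdsWithin_iff.mpr ⟨?_, ?_⟩
      · have : Continuous (fun δ : ℝ => ((1 + δ:ℝ):ℂ)) := by fun_prop
        have := this.tendsto 0
        simp only [add_zero, Complex.ofReal_one] at this
        exact this.mono_left nhdsWithin_le_nhds
      · filter_upwards [self_mem_nhdsWithin] with δ hδ
        rw [Set.mem_compl_iff, Set.mem_singleton_iff]
        intro h
        have h' : (1 + δ:ℝ) = 1 := by exact_mod_cast h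
        have : 0 < δ := hδ
        linarith
    have h2 := (Complex.continuous_re.tendsto 1).comp (riemannZeta_residue_one.comp h1)
    simp only [Complex.one_re] at h2
    refine h2.congr' ?_
    filter_upwards [hev] with δ hδ
    have h3 := zeta_exp (σ := 1 + δ) (by linarith [hδ.1])
    rw [Lw_int hδ.1, hLw δ hδ.1 hδ.2] at h3
    have h4 : riemannZeta ((1 + δ:ℝ):ℂ) = ((exp ((∫ v in Set.Ioi (0:ℝ), D (v/δ) * exp (-v)) - eulerMascheroniConstant - log δ):ℝ):ℂ) := by
      rw [Complex.exp_neg] at h3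
      rw [Complex.ofReal_exp]
      field_simp at h3
      exact h3
    simp only [Function.comp]
    rw [h4, show (((1 + δ:ℝ):ℂ) - 1) = (δ:ℂ) by push_cast; ring, ← Complex.ofReal_mul, Complex.ofReal_re]
    nth_rw 1 [← exp_log hδ.1]
    rw [← exp_add]; congr 1; ring
  have h5 := tendsto_nhds_unique hz ((hlim.sub_const _).rexp)
  have h6 := exp_eq_one_iff _ |>.mp h5.symm
  linarith

end

end VK

namespace VK
open Real Filter Topology MeasureTheory
open ArithmeticFunction hiding log

noncomputable section

lemma fr_meas (x:ℝ) : Measurable (fun t : ℝ => Int.fract (x / t) / log t) :=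
  (measurable_fract.comp (measurable_const.div measurable_id)).div measurable_log

lemma fr_bd (x:ℝ) {t : ℝ} (ht : 2 ≤ t) : 0 ≤ Int.fract (x / t) / log t ∧ Int.fract (x / t) / log t ≤ 2 := by
  have h1 := log_le_log (by norm_num) ht
  have h2 := Real.log_two_gt_d9
  have h3 := Int.fract_nonneg (x / t)
  have h4 := Int.fract_lt_one (x / t)
  refine ⟨div_nonneg h3 (by linarith), ?_⟩
  rw [div_le_iff₀ (by linarith)]
  linarith

lemma fr_int (x:ℝ) {a b : ℝ} (ha : 2 ≤ a) (hab : a ≤ b) : IntervalIntegrable (fun t : ℝ => Int.fract (x / t) / log t) volume a b := by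
  refine (intervalIntegrable_const (c := (2:ℝ))).mono_fun' (fr_meas x).aestronglyMeasurable ?_
  filter_upwards [ae_restrict_mem measurableSet_uIoc] with t ht
  rw [Set.uIoc_of_le hab] at ht
  obtain ⟨h1, h2⟩ := fr_bd x (ha.trans ht.1.le)
  rwa [Real.norm_eq_abs, abs_of_nonneg h1]

lemma fr_int_bd (x:ℝ) {a b : ℝ} (ha : 2 ≤ a) (hab : a ≤ b) : 0 ≤ ∫ t in a..b, Int.fract (x / t) / log t ∧
    ∫ t in a..b, Int.fract (x / t) / log t ≤ 2 * (b - a) := by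
  constructor
  · exact intervalIntegral.integral_nonneg hab fun t ht => (fr_bd x (ha.trans ht.1)).1
  · have := intervalIntegral.integral_mono_on hab (fr_int x ha hab) intervalIntegrable_const (fun t ht => (fr_bd x (ha.trans ht.1)).2)
    rw [intervalIntegral.integral_const, smul_eq_mul] at this
    linarith

lemma loglog_int {a b : ℝ} (ha : 2 ≤ a) (hab : a ≤ b) : IntervalIntegrable (fun t : ℝ => 1 / (t * log t)) volume a b ∧
    ∫ t in a..b, 1 / (t * log t) = log (log b) - log (log a) := by
  have h0 : ∀ t ∈ Set.uIcc a b, 0 < t ∧ 0 < log t := by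
    intro t ht
    rw [Set.uIcc_of_le hab] at ht
    have : 2 ≤ t := ha.trans ht.1
    exact ⟨by linarith, log_pos (by linarith)⟩
  have hi : IntervalIntegrable (fun t : ℝ => 1 / (t * log t)) volume a b := by
    refine ContinuousOn.intervalIntegrable fun t ht => ?_
    obtain ⟨h1, h2⟩ := h0 t ht
    exact (continuousAt_const.div (continuousAt_id.mul (continuousAt_log h1.ne')) (mul_pos h1 h2).ne').continuousWithinAt
  refine ⟨hi, intervalIntegral.integral_eq_sub_of_hasDerivAt (f := fun t => log (log t)) (fun t ht => ?_) hi⟩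
  obtain ⟨h1, h2⟩ := h0 t ht
  refine ((hasDerivAt_log h1.ne').log h2.ne').congr_deriv ?_
  field_simp

lemma int_part {x : ℝ} {N : ℕ} (hN : 3 ≤ N) (hx : (N:ℝ) ≤ x) :
    |∑ m ∈ Finset.Ioc N ⌊x⌋₊, ((⌊x⌋₊ / m:ℕ):ℝ) / log m - (x * (log (log x) - log (log N)) -
      ∫ t in (2:ℝ)..x, Int.fract (x / t) / log t)| ≤ x / N + 2 * N + 4 := by
  have hN3 : (3:ℝ) ≤ N := by exact_mod_cast hN
  have hx0 : 0 < x := by linarith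
  set X := ⌊x⌋₊ with hXd
  have hNX : N ≤ X := Nat.le_floor hx
  have hNX' : (N:ℝ) ≤ X := by exact_mod_cast hNX
  have hXx : (X:ℝ) ≤ x := Nat.floor_le hx0.le
  have hxX : x < X + 1 := Nat.lt_floor_add_one x
  have hlog1 : ∀ t : ℝ, (N:ℝ) ≤ t → 1 ≤ log t := by
    intro t ht
    rw [le_log_iff_exp_le (by linarith)]
    linarith [exp_one_lt_d9]
  set f : ℝ → ℝ := fun t => (⌊x / t⌋₊:ℝ) / log t with hf
  have hanti : AntitoneOn f (Set.Icc (N:ℝ) X) := by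
    intro s hs t ht hst
    have h1 := hlog1 s hs.1
    have hs0 : 0 < s := by linarith [hs.1]
    have h2 := log_le_log hs0 hst
    have h3 : (⌊x/t⌋₊:ℝ) ≤ ⌊x/s⌋₊ := by
      exact_mod_cast Nat.floor_le_floor (div_le_div_of_nonneg_left hx0.le hs0 hst)
    exact div_le_div₀ (by positivity) h3 (by linarith) h2
  have h1 := hanti.sum_le_integral_Ico hNX
  have h2 := hanti.integral_le_sum_Ico hNX
  have hIoc : ∑ m ∈ Finset.Ioc N X, ((X / m:ℕ):ℝ) / log m = ∑ i ∈ Finset.Ico N X, f ((i+1:ℕ):ℝ) := by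
    rw [Finset.sum_Ico_add' (fun i : ℕ => f (i:ℝ)) N X 1]
    refine Finset.sum_congr (by ext; simp) fun m _ => ?_
    rw [hf]; simp only
    rw [Nat.floor_div_natCast]
  have hIco : ∑ i ∈ Finset.Ico N X, f (i:ℝ) + f X = f N + ∑ i ∈ Finset.Ico N X, f ((i+1:ℕ):ℝ) := by
    rw [Finset.sum_Ico_add' (fun i : ℕ => f (i:ℝ)) N X 1, ← Finset.sum_Ico_succ_top hNX (fun i : ℕ => f (i:ℝ)),
      Finset.sum_eq_sum_Ico_succ_bot (by omega)]
  have hfX : 0 ≤ f X := div_nonneg (Nat.cast_nonneg _) (by linarith [hlog1 X hNX'])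
  have hfN : f N ≤ x / N := by
    have h3 := hlog1 N le_rfl
    have h4 := Nat.floor_le (show 0 ≤ x / N by positivity)
    refine (div_le_self (Nat.cast_nonneg _) h3).trans h4
  have hI : ∫ t in (N:ℝ)..X, f t = x * (log (log X) - log (log N)) - ∫ t in (N:ℝ)..X, Int.fract (x / t) / log t := by
    obtain ⟨i1, i2⟩ := loglog_int (a := N) (b := X) (by linarith) hNX'
    rw [← i2, ← intervalIntegral.integral_const_mul, ← intervalIntegral.integral_sub (i1.const_mul x) (fr_int x (by linarith) hNX')]
    refine intervalIntegral.integral_congr fun t ht => ?_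
    rw [Set.uIcc_of_le hNX'] at ht
    have ht0 : 0 < t := by linarith [ht.1]
    have hl := hlog1 t ht.1
    simp only [hf]
    rw [natCast_floor_eq_intCast_floor (by positivity), Int.fract]
    field_simp
    ring
  have hs1 := intervalIntegral.integral_add_adjacent_intervals (fr_int x (a := 2) (b := N) le_rfl (by linarith)) (fr_int x (a := N) (b := X) (by linarith) hNX')
  have hs2 := intervalIntegral.integral_add_adjacent_intervals (fr_int x (a := 2) (b := X) le_rfl (by linarith)) (fr_int x (a := X) (b := x) (by linarith) hXx)
  obtain ⟨b1, b2⟩ := fr_int_bd x (a := 2) (b := N) le_rfl (by linarith)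
  obtain ⟨b3, b4⟩ := fr_int_bd x (a := X) (b := x) (by linarith) hXx
  have hll : 0 ≤ x * (log (log x) - log (log X)) ∧ x * (log (log x) - log (log X)) ≤ 2 := by
    have hX1 := hlog1 X hNX'
    obtain ⟨_, l1⟩ := loglog_step (m := X) (by omega)
    have l2 := log_le_log (by linarith) hXx
    have l3 := log_le_log hx0 hxX.le
    have l4 := log_le_log (by linarith) l2
    have l5 := log_le_log (by linarith) l3
    refine ⟨mul_nonneg hx0.le (by linarith), ?_⟩
    have l6 : 1 / ((X:ℝ) * log X) ≤ 1 / X := one_div_le_one_div_of_le (by linarith) (le_mul_of_one_le_right (by linarith) hX1)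
    calc x * (log (log x) - log (log X)) ≤ x * (1 / X) := mul_le_mul_of_nonneg_left (by linarith) hx0.le
      _ ≤ 2 := by rw [mul_one_div, div_le_iff₀ (by linarith)]; linarith
  obtain ⟨c1, c2⟩ := hll
  rw [hIoc]
  rw [show x * (log (log x) - log (log (N:ℝ))) = x * (log (log x) - log (log X)) + x * (log (log (X:ℝ)) - log (log N)) by ring]
  rw [hI] at h1 h2
  rw [abs_le]
  constructor <;> linarith

lemma q4a {s x : ℝ} (h : 1 ≤ s) (h2 : s * s = x) : s ≤ x := by nlinarith

lemma q4b {s n : ℝ} (h : 3 ≤ n) (h2 : s < n + 1) : s ≤ n ^ 2 := by nlinarith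

lemma q4c {s n x : ℝ} (hs : 1 ≤ s) (h : 3 ≤ n) (h2 : s * s = x) (h3 : s < n + 1) : x ≤ 4 * s * n := by
  have := mul_le_mul_of_nonneg_left (show s ≤ 4 * n by linarith) (by linarith : 0 ≤ s)
  linarith

lemma q4d {n x : ℝ} (hx : 0 < x) : n * x ≤ x * (n + 1) := by linarith

set_option maxHeartbeats 1000000 in
theorem main_ww {ε : ℝ} (hε : 0 < ε) (hε3 : ε ≤ 1 / 3) : ∃ C > (0:ℝ), ∀ᶠ x : ℝ in atTop,
    |∑ m ∈ Finset.Icc 1 ⌊x⌋₊, ww m * ((⌊x⌋₊ / m:ℕ):ℝ) - (x * log (log x) + eulerMascheroniConstant * x -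
      ∫ t in (2:ℝ)..x, Int.fract (x / t) / log t)| ≤ C * x * exp (-(log x) ^ (3/5 - 3/5 * ε) / 1024) := by
  obtain ⟨N1, hN1, C1, hC1, hR⟩ := RR_nat hε hε3
  obtain ⟨κ, N2, hN2, C2, hC2, hA⟩ := AA_lim hε hε3
  set b := 3/5 - 3/5 * ε with hb
  have hb0 : 0 < b := by rw [hb]; linarith
  have hb1 : b ≤ 1 := by rw [hb]; linarith
  have hκ : κ = eulerMascheroniConstant := by
    apply kappa_eq
    rw [tendsto_iff_norm_sub_tendsto_zero]
    have h1 := ((tendsto_rpow_atTop hb0).comp (tendsto_log_atTop.comp tendsto_natCast_atTop_atTop)).const_mul_atTop_of_neg (show (-1/256:ℝ) < 0 by norm_num)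
    have h2 := (tendsto_exp_atBot.comp h1).const_mul C2
    rw [mul_zero] at h2
    refine squeeze_zero' (Eventually.of_forall fun _ => norm_nonneg _) ?_ h2
    filter_upwards [eventually_ge_atTop N2] with n hn
    refine (hA n hn).trans (le_of_eq ?_)
    simp only [Function.comp]
    congr 2; ring
  subst hκ
  set γ := eulerMascheroniConstant
  refine ⟨12 + 4 * C1 + C2, by positivity, ?_⟩
  filter_upwards [(tendsto_sqrt_atTop.eventually (eventually_ge_atTop ((max N1 N2:ℕ) + 1:ℝ))), eventually_ge_atTop (4^4), tendsto_log_atTop.eventually (eventually_ge_atTop 1)] with x hx1 hx2 hL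
  have hx0 : 0 < x := by linarith
  set N := ⌊√x⌋₊ with hNd
  have hNm : max N1 N2 ≤ N := Nat.le_floor (by linarith)
  have hNN1 := (le_max_left _ _).trans hNm
  have hNN2 := (le_max_right _ _).trans hNm
  have hN3 : 3 ≤ N := hN1.trans hNN1
  have hN3' : (3:ℝ) ≤ N := by exact_mod_cast hN3
  have hNs : (N:ℝ) ≤ √x := Nat.floor_le (sqrt_nonneg x)
  have hsN : √x < N + 1 := Nat.lt_floor_add_one _
  have hss : √x * √x = x := mul_self_sqrt hx0.le
  have hs1 : 1 ≤ √x := by linarith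
  have hNx : (N:ℝ) ≤ x := hNs.trans (q4a hs1 hss)
  have hlogN : log x ≤ 4 * log N := by
    have h1 : x ≤ (N:ℝ) ^ 4 := by
      have h2 : √x ≤ (N:ℝ) ^ 2 := q4b hN3' hsN
      calc x = √x * √x := hss.symm
        _ ≤ (N:ℝ)^2 * (N:ℝ)^2 := mul_le_mul h2 h2 (by positivity) (by positivity)
        _ = _ := by ring
    have := log_le_log hx0 h1
    rw [Real.log_pow] at this
    exact_mod_cast this
  have hlN : 1 ≤ log (N:ℝ) := by
    rw [le_log_iff_exp_le (by linarith)]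
    linarith [exp_one_lt_d9]
  set E := exp (-(log x) ^ b / 1024) with hE
  have hEN : exp (-(log N) ^ b / 256) ≤ E := by
    apply exp_le_exp.mpr
    have h1 : (log x / 4) ^ b ≤ log N ^ b := rpow_le_rpow (by linarith) (by linarith) hb0.le
    have h2 : log x ^ b / 4 ≤ (log x / 4) ^ b := by
      rw [div_rpow (by linarith) (by norm_num)]
      have h3 : (4:ℝ) ^ b ≤ 4 := by
        have := rpow_le_rpow_of_exponent_le (show (1:ℝ) ≤ 4 by norm_num) hb1
        rwa [rpow_one] at this
      exact div_le_div_of_nonneg_left (rpow_nonneg (by linarith) _) (by positivity) h3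
    linarith
  have hEN' : exp (-(log N) ^ b / 128) ≤ E := by
    refine le_trans (exp_le_exp.mpr ?_) hEN
    have : 0 ≤ log (N:ℝ) ^ b := rpow_nonneg (by linarith) _
    linarith
  have hsE : √x ≤ x * E := by
    have h1 : log x ^ b ≤ log x := by
      have := rpow_le_rpow_of_exponent_le hL hb1
      rwa [rpow_one] at this
    have h2 : √x * exp (-(log x)/2) = 1 := by
      have : √x = exp (log x / 2) := by
        rw [exp_half, exp_log hx0]
      rw [this, ← exp_add, exp_eq_one_iff]; ring
    have h3 : exp (-(log x)/2) ≤ E := exp_le_exp.mpr (by linarith)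
    calc √x = √x * √x * exp (-(log x)/2) := by rw [mul_assoc, h2, mul_one]
      _ ≤ x * E := by rw [hss]; gcongr
  set X := ⌊x⌋₊ with hX
  have hNX : N ≤ X := Nat.le_floor hNx
  have hXx : (X:ℝ) ≤ x := Nat.floor_le hx0.le
  -- split
  have hsplit : ∑ m ∈ Finset.Icc 1 X, ww m * ((X / m:ℕ):ℝ) = ∑ m ∈ Finset.Icc 1 N, ww m * ((X / m:ℕ):ℝ)
      + ∑ m ∈ Finset.Ioc N X, aa m * (((X / m:ℕ):ℝ) / log m) + ∑ m ∈ Finset.Ioc N X, ((X / m:ℕ):ℝ) / log m := by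
    rw [add_assoc, ← Finset.sum_add_distrib]
    have e : Finset.Icc 1 X = Finset.Icc 1 N ∪ Finset.Ioc N X := by ext; simp; omega
    rw [e, Finset.sum_union (by rw [Finset.disjoint_left]; intro m; simp; omega)]
    congr 1
    refine Finset.sum_congr rfl fun m hm => ?_
    rw [Finset.mem_Ioc] at hm
    rw [aa, if_neg (by omega), ww]; ring
  have hp1 : |∑ m ∈ Finset.Icc 1 N, ww m * ((X / m:ℕ):ℝ) - x * AA N| ≤ N := by
    rw [AA, Finset.mul_sum, ← Finset.sum_sub_distrib]
    refine (Finset.abs_sum_le_sum_abs _ _).trans ?_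
    have : ∀ m ∈ Finset.Icc 1 N, |ww m * ((X / m:ℕ):ℝ) - x * (ww m / m)| ≤ 1 := by
      intro m hm
      rw [hX, ← Nat.floor_div_natCast]
      have h1 : 0 ≤ x / m := by positivity
      have h2 := Nat.floor_le h1
      have h3 := Nat.lt_floor_add_one (x / m)
      have h4 := ww_nonneg m
      have h5 := ww_le_one m
      rw [show ww m * (⌊x / m⌋₊:ℝ) - x * (ww m / m) = - (ww m * (x / m - ⌊x/m⌋₊)) by ring, abs_neg, abs_of_nonneg (mul_nonneg h4 (by linarith))]
      calc ww m * (x / m - ⌊x/m⌋₊) ≤ 1 * 1 := mul_le_mul h5 (by linarith) (by linarith) (by norm_num)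
        _ = 1 := by norm_num
    refine (Finset.sum_le_card_nsmul _ _ _ this).trans ?_
    simp
  have hlp : ∀ m : ℕ, N ≤ m → 1 ≤ log (m:ℝ) := fun m hm =>
      hlN.trans (log_le_log (by linarith) (by exact_mod_cast hm))
  have hgm : ∀ m : ℕ, N < m → ((X / m:ℕ):ℝ) / log m ≤ x * (1 / ((m:ℝ) * log m)) := by
    intro m hm
    have h1 := hlp m hm.le
    have h2 : ((X / m:ℕ):ℝ) ≤ x / m := (Nat.cast_div_le).trans (div_le_div_of_nonneg_right hXx (by positivity))
    rw [mul_one_div, ← div_div]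
    exact div_le_div_of_nonneg_right h2 (by linarith)
  have hp2 : |∑ m ∈ Finset.Ioc N X, aa m * (((X / m:ℕ):ℝ) / log m)| ≤ C1 * E * (4 * x) := by
    have hRb : ∀ m : ℕ, N ≤ m → |RR (m:ℝ)| ≤ (C1 * E) * (m:ℝ) := by
      intro m hm
      have h1 := hR m (hNN1.trans hm)
      have h2 : exp (-(log m) ^ b / 128) ≤ E := by
        refine le_trans (exp_le_exp.mpr ?_) hEN'
        have := rpow_le_rpow (by linarith) (log_le_log (by linarith) (show (N:ℝ) ≤ m by exact_mod_cast hm)) hb0.le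
        linarith
      calc |RR (m:ℝ)| ≤ C1 * m * exp (-(log m) ^ b / 128) := h1
        _ ≤ C1 * m * E := by gcongr
        _ = _ := by ring
    have h1 := abel_phi (a := aa) (R := fun n => RR (n:ℝ)) (g := fun m : ℕ => ((X / m:ℕ):ℝ) / log m) (φ := fun m => (m:ℝ))
      (N := N) RR_succ (fun m hm => div_nonneg (Nat.cast_nonneg _) (by linarith [hlp m hm.le])) (fun m hm => by
        have h1 := hlp m hm.le
        have h2 : log (m:ℝ) ≤ log ((m+1:ℕ):ℝ) := log_le_log (by exact_mod_cast (by omega : 0 < m)) (by exact_mod_cast (by omega))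
        have h3 : ((X / (m+1):ℕ):ℝ) ≤ ((X / m:ℕ):ℝ) := by exact_mod_cast Nat.div_le_div_left (by omega) (by omega)
        exact div_le_div₀ (Nat.cast_nonneg _) h3 (by linarith) h2) hRb X hNX
    refine h1.trans (mul_le_mul_of_nonneg_left ?_ (by positivity))
    have h2 : 2 * (N:ℝ) * (((X / (N+1):ℕ):ℝ) / log ((N+1:ℕ):ℝ)) ≤ 2 * x := by
      have h3 := hlp (N+1) (by omega)
      have h4 : ((X / (N+1):ℕ):ℝ) ≤ x / ((N+1:ℕ):ℝ) := (Nat.cast_div_le).trans (div_le_div_of_nonneg_right hXx (by positivity))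
      have h5 : ((X / (N+1):ℕ):ℝ) / log ((N+1:ℕ):ℝ) ≤ x / ((N+1:ℕ):ℝ) := (div_le_self (Nat.cast_nonneg _) h3).trans h4
      have h6 : (N:ℝ) * (x / ((N+1:ℕ):ℝ)) ≤ x := by
        rw [mul_div_assoc', div_le_iff₀ (by positivity)]; push_cast; exact q4d hx0
      have h7 := mul_le_mul_of_nonneg_left h5 (Nat.cast_nonneg (α := ℝ) N)
      linarith
    have h3 : ∑ m ∈ Finset.Ioc N X, ((X / m:ℕ):ℝ) / log m * ((m:ℝ) - ((m-1:ℕ):ℝ)) ≤ 2 * x := by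
      have h4 : ∑ m ∈ Finset.Ioc N X, ((X / m:ℕ):ℝ) / log m * ((m:ℝ) - ((m-1:ℕ):ℝ)) ≤ ∑ m ∈ Finset.Ioc N X, x * (1 / ((m:ℝ) * log m)) := by
        refine Finset.sum_le_sum fun m hm => ?_
        rw [Finset.mem_Ioc] at hm
        rw [Nat.cast_sub (by omega), Nat.cast_one, sub_sub_cancel, mul_one]
        exact hgm m hm.1
      rw [← Finset.mul_sum] at h4
      obtain ⟨h5, _⟩ := VV_bound (N := N) (by omega) X hNX
      have h6 : log (log (X:ℝ)) - log (log N) ≤ 2 := by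
        have h7 : log (X:ℝ) ≤ 4 * log N := (log_le_log (by exact_mod_cast (by omega : 0 < X)) hXx).trans hlogN
        have h8 := log_le_log (by linarith [hlp X hNX]) h7
        rw [log_mul (by norm_num) (by linarith)] at h8
        have h9 : log 4 ≤ 2 := by
          rw [show (4:ℝ) = 2 ^ 2 by norm_num, Real.log_pow]
          have := Real.log_two_lt_d9
          push_cast; linarith
        linarith
      have h7 : x * ∑ m ∈ Finset.Ioc N X, 1 / ((m:ℝ) * log m) ≤ x * 2 := mul_le_mul_of_nonneg_left (by linarith) hx0.le
      linarith
    linarith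
  have hp3 := int_part (x := x) hN3 hNx
  have hp4 : |x * AA N - x * log (log N) - γ * x| ≤ C2 * (x * E) := by
    have h1 := hA N hNN2
    rw [show x * AA N - x * log (log N) - γ * x = x * (AA N - log (log N) - γ) by ring, abs_mul, abs_of_pos hx0]
    calc x * |AA N - log (log N) - γ| ≤ x * (C2 * exp (-(log N) ^ b / 256)) := by gcongr
      _ ≤ x * (C2 * E) := by gcongr
      _ = _ := by ring
  have hxN : x / N ≤ 4 * √x := by
    rw [div_le_iff₀ (by linarith)]
    exact q4c hs1 hN3' hss hsN
  rw [hsplit]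
  obtain ⟨a1, a2⟩ := abs_le.mp hp1
  obtain ⟨a3, a4⟩ := abs_le.mp hp2
  obtain ⟨a5, a6⟩ := abs_le.mp hp3
  obtain ⟨a7, a8⟩ := abs_le.mp hp4
  rw [show (12 + 4 * C1 + C2) * x * E = 12 * (x * E) + C1 * E * (4 * x) + C2 * (x * E) by ring]
  rw [abs_le]
  constructor <;> linarith

theorem main_pre {ε : ℝ} (hε : 0 < ε) : ∃ c > (0:ℝ), ∃ C > (0:ℝ), ∀ᶠ x : ℝ in atTop,
    |(∑ n ∈ Finset.Icc 1 ⌊x⌋₊, (n.primeFactorsList.length:ℝ)) - (x * log (log x) + (eulerMascheroniConstant -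
    (∑' p : Nat.Primes, ∑' k : ℕ, 1 / (((k + 2):ℝ) * ((p:ℕ):ℝ) ^ (k + 2))) +
    ∑' p : Nat.Primes, 1 / (((p:ℕ):ℝ) * (((p:ℕ):ℝ) - 1))) * x -
      ∫ t in (2:ℝ)..x, Int.fract (x / t) / log t)| ≤ C * x * exp (-c * (log x) ^ ((3:ℝ)/5 - ε)) := by
  obtain ⟨C, hC, h⟩ := main_ww (ε := min ε (1/3)) (lt_min hε (by norm_num)) (min_le_right _ _)
  obtain ⟨K, hK, hv⟩ := vp_part
  have hε' : 3/5 * min ε (1/3) ≤ ε := by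
    have h1 := min_le_left ε (1/3)
    linarith
  refine ⟨1/1024, by norm_num, C + K, by positivity, ?_⟩
  filter_upwards [h, eventually_ge_atTop 1, tendsto_log_atTop.eventually (eventually_ge_atTop 1)] with x hx hx1 hL
  have hx0 : 0 < x := by linarith
  have h1 := hv x hx1
  rw [vp_tsum] at h1
  set E := exp (-(1/1024) * (log x) ^ ((3:ℝ)/5 - ε)) with hE
  have hE1 : exp (-(log x) ^ (3/5 - 3/5 * min ε (1/3)) / 1024) ≤ E := by
    apply exp_le_exp.mpr
    have := rpow_le_rpow_of_exponent_le hL (show (3:ℝ)/5 - ε ≤ 3/5 - 3/5 * min ε (1/3) by linarith)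
    linarith
  have hE2 : x ^ ((3/4):ℝ) ≤ x * E := by
    have h2 : (log x) ^ ((3:ℝ)/5 - ε) ≤ log x := by
      have := rpow_le_rpow_of_exponent_le hL (show (3:ℝ)/5 - ε ≤ 1 by linarith)
      rwa [rpow_one] at this
    have h3 : exp (-(1/4) * log x) ≤ E := exp_le_exp.mpr (by linarith)
    have h4 : x ^ ((3/4):ℝ) = x * exp (-(1/4) * log x) := by
      rw [rpow_def_of_pos hx0]
      nth_rw 2 [← exp_log hx0]
      rw [← exp_add]; congr 1; ring
    rw [h4]; gcongr
  have h5 : ∑ n ∈ Finset.Icc 1 ⌊x⌋₊, (n.primeFactorsList.length:ℝ) = ∑ m ∈ Finset.Icc 1 ⌊x⌋₊, ww m * ((⌊x⌋₊ / m:ℕ):ℝ)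
      + ∑ m ∈ Finset.Icc 1 ⌊x⌋₊, vp m * ((⌊x⌋₊ / m:ℕ):ℝ) := by
    rw [omega_sum, ← Finset.sum_add_distrib]
    refine Finset.sum_congr rfl fun m _ => ?_
    rw [vp]; ring
  have h6 : C * x * exp (-(log x) ^ (3/5 - 3/5 * min ε (1/3)) / 1024) ≤ C * x * E := by gcongr
  have h7 : K * x ^ ((3/4):ℝ) ≤ K * (x * E) := by gcongr
  obtain ⟨a1, a2⟩ := abs_le.mp hx
  obtain ⟨a3, a4⟩ := abs_le.mp h1
  rw [h5, show (C + K) * x * E = C * x * E + K * (x * E) by ring, abs_le]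
  constructor <;> linarith

end

end VK

theorem sum_bigOmega_asymptotic :
    ∀ ε > (0:ℝ), ∃ c > (0:ℝ), ∃ C > (0:ℝ), ∀ᶠ x : ℝ in atTop,
      |(∑ n ∈ Finset.Icc 1 ⌊x⌋₊, (n.primeFactorsList.length : ℝ)) -
          (x * Real.log (Real.log x) + mertensB2 * x - lif x)| ≤
        C * x * Real.exp (-c * (Real.log x) ^ ((3:ℝ)/5 - ε)) := by
  intro ε hε
  exact VK.main_pre hε
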